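/- Let μ be an m-asymptotically optimally doubling Radon measure on ℝⁿ and x ∈ supp μ. If one tangent measure to μ at x is m-flat, then x is a flat point of supp μ, i.e. θ^P_Σ(x,r) → 0 as r ↓ 0 where Σ = supp μ (with planes of dimension m in the definition of θ^P). -/

import Mathlib

open Metric Set MeasureTheory Filter Module
open scoped RealInnerProductSpace Topology Pointwise ENNReal

noncomputable section

/-- `ℝⁿ` as a Euclidean space. -/
abbrev E (n : ℕ) : Type := EuclideanSpace ℝ (Fin n)

/-- `d(A,B) = sup_{a ∈ A} inf_{b ∈ B} |a - b|`. -/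
def setD {n : ℕ} (A B : Set (E n)) : ℝ := ⨆ a ∈ A, Metric.infDist a B

/-- `d^{x,r}(A,B) = (1/r) d(A ∩ B(x,r), B ∩ B(x,r))`. -/
def dxr {n : ℕ} (x : E n) (r : ℝ) (A B : Set (E n)) : ℝ :=
  (1 / r) * setD (A ∩ closedBall x r) (B ∩ closedBall x r)

/-- `D^{x,r}(A,B) = max(d^{x,r}(A,B), d^{x,r}(B,A))`. -/
def Dxr {n : ℕ} (x : E n) (r : ℝ) (A B : Set (E n)) : ℝ :=
  max (dxr x r A B) (dxr x r B A)

/-- `d̃^{x,r}(A,B) = (1/r) d(A ∩ B(x,r), B)`. -/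
def dtxr {n : ℕ} (x : E n) (r : ℝ) (A B : Set (E n)) : ℝ :=
  (1 / r) * setD (A ∩ closedBall x r) B

/-- `D̃^{x,r}(A,B) = max(d̃^{x,r}(A,B), d̃^{x,r}(B,A))`. -/
def Dtxr {n : ℕ} (x : E n) (r : ℝ) (A B : Set (E n)) : ℝ :=
  max (dtxr x r A B) (dtxr x r B A)

/-- `C` is a cone based at `y`: `y ∈ C` and `s • (C − y) = C − y` for all `s > 0`. -/
def IsConeAt {n : ℕ} (y : E n) (C : Set (E n)) : Prop :=
  y ∈ C ∧ ∀ s : ℝ, 0 < s → s • {z : E n | y + z ∈ C} = {z : E n | y + z ∈ C}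

/-- The standard KP cone `{x₄² = x₁² + x₂² + x₃²}` in `ℝⁿ`, `n ≥ 4`. -/
def stdKP (n : ℕ) (hn : 4 ≤ n) : Set (E n) :=
  {x : E n | (x ⟨3, by omega⟩) ^ 2 =
    (x ⟨0, by omega⟩) ^ 2 + (x ⟨1, by omega⟩) ^ 2 + (x ⟨2, by omega⟩) ^ 2}

/-- `C` is a KP cone based at `y`: in some orthonormal coordinates centered at the origin,
`C − y` is the standard KP cone. -/
def IsKPCone {n : ℕ} (hn : 4 ≤ n) (y : E n) (C : Set (E n)) : Prop :=
  ∃ f : E n ≃ₗᵢ[ℝ] E n, {z : E n | y + z ∈ C} = f ⁻¹' stdKP n hn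

/-- `θ^P_Σ(x,r)` : best approximation of `S` in `B(x,r)` by affine `m`-planes through `x`. -/
def thetaP {n : ℕ} (m : ℕ) (S : Set (E n)) (x : E n) (r : ℝ) : ℝ :=
  ⨅ L : {L : AffineSubspace ℝ (E n) // x ∈ L ∧ Module.finrank ℝ L.direction = m},
    Dxr x r S (L.1 : Set (E n))

/-- `θ^C_Σ(x,r)` : best approximation of `S` in `B(x,r)` by KP cones based at `x`. -/
def thetaC {n : ℕ} (hn : 4 ≤ n) (S : Set (E n)) (x : E n) (r : ℝ) : ℝ :=
  ⨅ C : {C : Set (E n) // IsKPCone hn x C}, Dxr x r S C.1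

/-- `ϑ^C_Σ(x,r)` : best approximation of `S` in `B(x,r)` by KP cones containing `x`. -/
def varthetaC {n : ℕ} (hn : 4 ≤ n) (S : Set (E n)) (x : E n) (r : ℝ) : ℝ :=
  ⨅ C : {C : Set (E n) // (∃ y, IsKPCone hn y C) ∧ x ∈ C}, Dxr x r S C.1

/-- The angle `∠(P₁,P₂) = arcsin Γ(P₁,P₂)` between two affine planes. -/
def planeAngle {n : ℕ} (P₁ P₂ : AffineSubspace ℝ (E n)) : ℝ :=
  Real.arcsin (dxr (0 : E n) 1 (P₁.direction : Set (E n)) (P₂.direction : Set (E n)))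

/-- The support of a measure. -/
def msupp {n : ℕ} (μ : Measure (E n)) : Set (E n) :=
  {x : E n | ∀ r : ℝ, 0 < r → 0 < μ (closedBall x r)}

/-- Weak convergence of a sequence of measures in the sense of Radon measures. -/
def VagueTendsto {n : ℕ} (μs : ℕ → Measure (E n)) (ν : Measure (E n)) : Prop :=
  ∀ f : E n → ℝ, Continuous f → HasCompactSupport f →
    Tendsto (fun i => ∫ y, f y ∂(μs i)) atTop (nhds (∫ y, f y ∂ν))

/-- `ν` is a tangent measure of `μ` at `x`: `ν ≠ 0` and for some `rᵢ ↓ 0`, `cᵢ > 0`,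
`cᵢ (T_{x,rᵢ})₊μ → ν` weakly. -/
def IsTangentMeasure {n : ℕ} (μ ν : Measure (E n)) (x : E n) : Prop :=
  ν ≠ 0 ∧ ∃ r c : ℕ → ℝ, (∀ i, 0 < r i) ∧ Tendsto r atTop (nhds 0) ∧ (∀ i, 0 < c i) ∧
    VagueTendsto (fun i => ENNReal.ofReal (c i) • Measure.map (fun y => (r i)⁻¹ • (y - x)) μ) ν

/-- `μ` is `m`-asymptotically optimally doubling. -/
def AOD {n : ℕ} (m : ℕ) (μ : Measure (E n)) : Prop :=
  ∀ K : Set (E n), K ⊆ msupp μ → IsCompact K → ∀ δ : ℝ, 0 < δ →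
    ∃ r₀ : ℝ, 0 < r₀ ∧ ∀ x ∈ K, ∀ r : ℝ, 0 < r → r ≤ r₀ →
      ∀ τ : ℝ, τ ∈ Set.Icc (1/2 : ℝ) 1 →
        |(μ (closedBall x (τ * r))).toReal / (μ (closedBall x r)).toReal - τ ^ m| < δ

/-- `ν` is `m`-flat: `m`-dimensional Hausdorff measure restricted to an affine `m`-plane. -/
def IsFlatMeasure {n : ℕ} (m : ℕ) (ν : Measure (E n)) : Prop :=
  ∃ L : AffineSubspace ℝ (E n), (L : Set (E n)).Nonempty ∧
    Module.finrank ℝ L.direction = m ∧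
    ν = (Measure.hausdorffMeasure (m : ℝ)).restrict (L : Set (E n))

/-- Volume of the unit ball in `ℝᵐ`. -/
def unitBallVol (m : ℕ) : ℝ := (volume (Metric.ball (0 : EuclideanSpace ℝ (Fin m)) 1)).toReal

/-- `ω₃`, the volume of the unit `3`-ball. -/
def omega3 : ℝ := unitBallVol 3

/-- The second moment `Q_{0,r}` of a measure on `ℝ⁴`. -/
def Qmom (μ : Measure (E 4)) (r : ℝ) (z : E 4) : ℝ :=
  (5 / (omega3 * r ^ 5)) * ∫ w in closedBall (0 : E 4) r, ⟪z, w⟫ ^ 2 ∂μ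

/-- Entries `q_{ij}` of the second moment matrix in given directions. -/
def qmom (μ : Measure (E 4)) (r : ℝ) (u v : E 4) : ℝ :=
  (5 / (omega3 * r ^ 5)) * ∫ w in closedBall (0 : E 4) r, ⟪u, w⟫ * ⟪v, w⟫ ∂μ

/-- `μ` is `(α,m)`-Hölder asymptotically uniform. -/
def HolderAsympUniform {n : ℕ} (α : ℝ) (m : ℕ) (μ : Measure (E n)) : Prop :=
  ∀ K : Set (E n), K ⊆ msupp μ → IsCompact K →
    ∃ C r₀ : ℝ, 0 < r₀ ∧ ∀ x ∈ K, ∀ r : ℝ, 0 < r → r ≤ r₀ →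
      |(μ (closedBall x r)).toReal / (unitBallVol m * r ^ m) - 1| ≤ C * r ^ α

/-- `φ` is a `C^{1,β}` diffeomorphism from `U` onto `U'`: a continuously differentiable bijection
with `β`-Hölder derivative whose inverse is also `C^{1,β}`. -/
def IsC1HolderDiffeoOn (β : ℝ) (U U' : Set (E 4)) (φ : E 4 → E 4) : Prop :=
  Set.BijOn φ U U' ∧
  (∀ x ∈ U, HasFDerivAt φ (fderiv ℝ φ x) x) ∧
  (∃ M : ℝ, ∀ x ∈ U, ∀ y ∈ U, ‖fderiv ℝ φ x - fderiv ℝ φ y‖ ≤ M * ‖x - y‖ ^ β) ∧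
  ∃ ψ : E 4 → E 4, Set.BijOn ψ U' U ∧
    (∀ x ∈ U, ψ (φ x) = x) ∧ (∀ y ∈ U', φ (ψ y) = y) ∧
    (∀ y ∈ U', HasFDerivAt ψ (fderiv ℝ ψ y) y) ∧
    (∃ M : ℝ, ∀ x ∈ U', ∀ y ∈ U', ‖fderiv ℝ ψ x - fderiv ℝ ψ y‖ ≤ M * ‖x - y‖ ^ β)

set_option linter.unusedSectionVars false
set_option linter.style.haveILetI false
set_option linter.unusedSimpArgs false
set_option linter.unusedVariables false
set_option linter.unnecessarySimpa false

namespace FT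


def Sp {X : Type*} [NormedAddCommGroup X] [MeasurableSpace X] (ν : Measure X) : Set X :=
  {x | ∀ r : ℝ, 0 < r → 0 < ν (closedBall x r)}

def Unif {X : Type*} [NormedAddCommGroup X] [MeasurableSpace X] (m : ℕ) (ν : Measure X) : Prop :=
  ∀ y ∈ Sp ν, ∀ r : ℝ, 0 < r → ν (closedBall y r) = ENNReal.ofReal (r ^ m)

section basic
variable {X : Type*} [NormedAddCommGroup X] [InnerProductSpace ℝ X] [FiniteDimensional ℝ X]
  [MeasurableSpace X] [BorelSpace X]

lemma Sp_eq_support (ν : Measure X) : Sp ν = ν.support := by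
  ext x
  rw [Metric.nhds_basis_closedBall.mem_measureSupport]
  rfl

lemma Sp_closed (ν : Measure X) : IsClosed (Sp ν) := by
  rw [Sp_eq_support]; exact Measure.isClosed_support

lemma Sp_ae (ν : Measure X) : ∀ᵐ z ∂ν, z ∈ Sp ν := by
  haveI : HereditarilyLindelofSpace X := inferInstance
  rw [Sp_eq_support]; exact Measure.support_mem_ae

lemma ext_Iic {α β : Measure ℝ} (h : ∀ r, α (Iic r) = β (Iic r)) (hf : ∀ r, α (Iic r) < ∞) :
    α = β := by
  haveI : IsLocallyFiniteMeasure α := ⟨fun x => ⟨Iic (x+1), Iic_mem_nhds (by linarith), hf _⟩⟩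
  apply Measure.ext_of_Ioc
  intro a b hab
  have : Ioc a b = Iic b \ Iic a := by ext; simp
  rw [this, measure_sdiff (Iic_subset_Iic.2 hab.le) measurableSet_Iic.nullMeasurableSet (hf a).ne,
    measure_sdiff (Iic_subset_Iic.2 hab.le) measurableSet_Iic.nullMeasurableSet (by rw [← h]; exact (hf a).ne), h, h]

variable {m : ℕ} {ν : Measure X}

lemma uball_zero_eq (hU : Unif m ν) {y : X} (hy : y ∈ Sp ν) : ν {y} = if m = 0 then 1 else 0 := by
  have h1 : Tendsto (fun r : ℝ => ν (closedBall y r)) (𝓝[>] 0) (𝓝 (ν {y})) := by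
    have := tendsto_measure_biInter_gt (μ := ν) (s := fun r : ℝ => closedBall y r) (a := 0)
      (fun r _ => isClosed_closedBall.measurableSet.nullMeasurableSet)
      (fun i j _ hij => closedBall_subset_closedBall hij)
      ⟨1, one_pos, by rw [hU y hy 1 one_pos]; simp⟩
    have e : (⋂ r : ℝ, ⋂ (_ : r > 0), closedBall y r) = {y} := by
      ext z
      simp only [mem_iInter, mem_closedBall, mem_singleton_iff]
      constructor
      · intro h
        have : dist z y ≤ 0 := le_of_forall_pos_le_add (fun ε hε => by simpa using h ε hε)
        exact dist_le_zero.1 this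
      · rintro rfl r hr; simpa using hr.le
    rwa [e] at this
  have h2 : Tendsto (fun r : ℝ => ν (closedBall y r)) (𝓝[>] 0) (𝓝 (ENNReal.ofReal ((0:ℝ) ^ m))) := by
    have : Tendsto (fun r : ℝ => ENNReal.ofReal (r ^ m)) (𝓝[>] 0) (𝓝 (ENNReal.ofReal ((0:ℝ) ^ m))) := by
      apply tendsto_nhdsWithin_of_tendsto_nhds
      exact (ENNReal.continuous_ofReal.comp (continuous_pow m)).tendsto 0
    refine this.congr' ?_
    filter_upwards [self_mem_nhdsWithin] with r hr
    exact (hU y hy r hr).symm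
  rw [tendsto_nhds_unique h1 h2]
  by_cases hm : m = 0
  · simp [hm]
  · simp [hm]

lemma uball_eq (hU : Unif m ν) {y : X} (hy : y ∈ Sp ν) (r : ℝ) :
    ν (closedBall y r) = if r < 0 then 0 else ENNReal.ofReal (r ^ m) := by
  split_ifs with h
  · rw [closedBall_eq_empty.2 h, measure_empty]
  · rcases (not_lt.1 h).eq_or_lt with h0 | h0
    · rw [← h0, closedBall_zero, uball_zero_eq hU hy]
      by_cases hm : m = 0 <;> simp [hm]
    · exact hU y hy r h0

lemma map_dist_Iic (ν : Measure X) (y : X) (r : ℝ) :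
    Measure.map (fun z => ‖z - y‖) ν (Iic r) = ν (closedBall y r) := by
  rw [Measure.map_apply (by fun_prop) measurableSet_Iic]
  congr 1; ext z; simp [dist_eq_norm]

lemma map_dist_eq (hU : Unif m ν) {y : X} (hy : y ∈ Sp ν) (h0 : (0:X) ∈ Sp ν) :
    Measure.map (fun z => ‖z - y‖) ν = Measure.map (fun z => ‖z‖) ν := by
  have h := map_dist_Iic ν (0:X)
  simp only [sub_zero] at h
  apply ext_Iic
  · intro r; rw [map_dist_Iic, h, uball_eq hU hy, uball_eq hU h0]
  · intro r; rw [map_dist_Iic, uball_eq hU hy]; split_ifs <;> simp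

lemma map_norm_scale (hU : Unif m ν) (h0 : (0:X) ∈ Sp ν) {σ : ℝ} (hσ : 0 < σ) :
    (Measure.map (fun z => ‖z‖) ν).map (fun r => σ⁻¹ * r) =
      ENNReal.ofReal (σ ^ m) • Measure.map (fun z => ‖z‖) ν := by
  have h := map_dist_Iic ν (0:X)
  simp only [sub_zero] at h
  have key : ∀ r, (Measure.map (fun z => ‖z‖) ν).map (fun r => σ⁻¹ * r) (Iic r)
      = ν (closedBall (0:X) (σ * r)) := by
    intro r
    rw [Measure.map_apply (by fun_prop) measurableSet_Iic, ← h]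
    congr 1; ext z; simp only [mem_preimage, mem_Iic]
    rw [inv_mul_le_iff₀ hσ]
  apply ext_Iic
  · intro r; rw [key, Measure.smul_apply, h, uball_eq hU h0, uball_eq hU h0]
    by_cases hr : r < 0
    · rw [if_pos (by nlinarith), if_pos hr]; simp
    · rw [if_neg (by have := mul_nonneg hσ.le (not_lt.1 hr); linarith), if_neg hr, mul_pow,
        ENNReal.ofReal_mul (by positivity), smul_eq_mul]
  · intro r; rw [key, uball_eq hU h0]; split_ifs <;> simp

lemma map_norm_eq_vol (hU : Unif m ν) (h0 : (0:X) ∈ Sp ν) :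
    volume (ball (0 : EuclideanSpace ℝ (Fin m)) 1) • Measure.map (fun z => ‖z‖) ν =
    Measure.map (fun z : EuclideanSpace ℝ (Fin m) => ‖z‖) volume := by
  have h := map_dist_Iic ν (0:X)
  have h' := map_dist_Iic (volume : Measure (EuclideanSpace ℝ (Fin m))) 0
  simp only [sub_zero] at h h'
  apply ext_Iic
  · intro r
    rw [Measure.smul_apply, h, h', uball_eq hU h0]
    split_ifs with hr
    · simp [closedBall_eq_empty.2 hr]
    · rw [Measure.addHaar_closedBall _ _ (not_lt.1 hr)]
      simp [mul_comm]
  · intro r; rw [Measure.smul_apply, h, uball_eq hU h0]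
    apply ENNReal.mul_lt_top measure_ball_lt_top
    split_ifs <;> simp

lemma gauss_integrable (hU : Unif m ν) (h0 : (0:X) ∈ Sp ν) {σ : ℝ} (hσ : 0 < σ) :
    Integrable (fun z => Real.exp (-(σ^2 * ‖z‖^2))) ν := by
  have hm : Measurable (fun r : ℝ => Real.exp (-(σ^2 * r^2))) := by fun_prop
  have h1 : Integrable (fun r : ℝ => Real.exp (-(σ^2 * r^2)))
      (Measure.map (fun z : EuclideanSpace ℝ (Fin m) => ‖z‖) volume) := by
    rw [integrable_map_measure hm.aestronglyMeasurable (by fun_prop)]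
    have := GaussianFourier.integrable_cexp_neg_mul_sq_norm_add (V := EuclideanSpace ℝ (Fin m))
      (b := (σ^2 : ℝ)) (by rw [Complex.ofReal_re]; positivity) 0 0
    have := this.norm
    refine this.congr (ae_of_all _ fun z => ?_)
    simp only [Function.comp]
    rw [Complex.norm_exp]
    congr 1
    simp [← Complex.ofReal_pow, ← Complex.ofReal_mul]
  rw [← map_norm_eq_vol hU h0, integrable_smul_measure (measure_ball_pos _ _ one_pos).ne'
    measure_ball_lt_top.ne, integrable_map_measure hm.aestronglyMeasurable (by fun_prop)] at h1
  exact h1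

end basic
end FT

namespace FT

section gaussfam
variable {X : Type*} [NormedAddCommGroup X] [InnerProductSpace ℝ X] [FiniteDimensional ℝ X]
  [MeasurableSpace X] [BorelSpace X]

def ZZ (ν : Measure X) (σ : ℝ) : ℝ := ∫ z, Real.exp (-(σ^2 * ‖z‖^2)) ∂ν

def GP (ν : Measure X) (σ : ℝ) : Measure X :=
  ENNReal.ofReal (ZZ ν σ)⁻¹ • ν.withDensity (fun z => ENNReal.ofReal (Real.exp (-(σ^2 * ‖z‖^2))))

variable {m : ℕ} {ν : Measure X}

lemma ZZ_pos (hU : Unif m ν) (h0 : (0:X) ∈ Sp ν) {σ : ℝ} (hσ : 0 < σ) : 0 < ZZ ν σ := by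
  unfold ZZ
  rw [integral_pos_iff_support_of_nonneg (fun z => (Real.exp_pos _).le) (gauss_integrable hU h0 hσ)]
  refine lt_of_lt_of_le (h0 1 one_pos) (measure_mono fun z _ => ?_)
  simp [Function.mem_support, (Real.exp_pos _).ne']

lemma GP_integral (hU : Unif m ν) (h0 : (0:X) ∈ Sp ν) {σ : ℝ} (hσ : 0 < σ) (f : X → ℝ) :
    ∫ z, f z ∂(GP ν σ) = (ZZ ν σ)⁻¹ * ∫ z, Real.exp (-(σ^2 * ‖z‖^2)) * f z ∂ν := by
  unfold GP
  rw [integral_smul_measure, integral_withDensity_eq_integral_toReal_smul (by fun_prop)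
    (ae_of_all _ fun z => ENNReal.ofReal_lt_top),
    ENNReal.toReal_ofReal (inv_nonneg.2 (ZZ_pos hU h0 hσ).le), smul_eq_mul]
  congr 1
  refine integral_congr_ae (ae_of_all _ fun z => ?_)
  simp [ENNReal.toReal_ofReal (Real.exp_pos _).le]

lemma GP_integrable_iff (hU : Unif m ν) (h0 : (0:X) ∈ Sp ν) {σ : ℝ} (hσ : 0 < σ) (f : X → ℝ) :
    Integrable f (GP ν σ) ↔ Integrable (fun z => Real.exp (-(σ^2 * ‖z‖^2)) * f z) ν := by
  unfold GP
  rw [integrable_smul_measure (by simpa using ZZ_pos hU h0 hσ) ENNReal.ofReal_ne_top,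
    integrable_withDensity_iff_integrable_smul' (by fun_prop)
    (ae_of_all _ fun z => ENNReal.ofReal_lt_top)]
  apply integrable_congr (ae_of_all _ fun z => ?_)
  simp [ENNReal.toReal_ofReal (Real.exp_pos _).le]

lemma GP_prob (hU : Unif m ν) (h0 : (0:X) ∈ Sp ν) {σ : ℝ} (hσ : 0 < σ) :
    IsProbabilityMeasure (GP ν σ) := by
  have h1 : Integrable (fun _ => (1:ℝ)) (GP ν σ) := by
    rw [GP_integrable_iff hU h0 hσ]; simpa using gauss_integrable hU h0 hσ
  haveI : IsFiniteMeasure (GP ν σ) := by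
    rw [integrable_const_iff] at h1
    simpa [isFiniteMeasure_iff] using h1
  have h2 : ∫ z, (1:ℝ) ∂(GP ν σ) = 1 := by
    rw [GP_integral hU h0 hσ]
    simp only [mul_one]
    exact inv_mul_cancel₀ (ZZ_pos hU h0 hσ).ne'
  constructor
  rw [integral_const, smul_eq_mul, mul_one, measureReal_def] at h2
  rw [← ENNReal.ofReal_toReal (measure_ne_top (GP ν σ) univ), h2]; simp

lemma GP_ae (ν : Measure X) (σ : ℝ) : ∀ᵐ z ∂(GP ν σ), z ∈ Sp ν := by
  have : GP ν σ ≪ ν := (Measure.smul_absolutelyContinuous).trans (withDensity_absolutelyContinuous _ _)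
  exact this (Sp_ae ν)

lemma integral_scale (hU : Unif m ν) (h0 : (0:X) ∈ Sp ν) {σ : ℝ} (hσ : 0 < σ) {g : ℝ → ℝ}
    (hg : Measurable g) : ∫ z, g (σ⁻¹ * ‖z‖) ∂ν = σ ^ m * ∫ z, g ‖z‖ ∂ν := by
  have h := congrArg (fun ρ : Measure ℝ => ∫ r, g r ∂ρ) (map_norm_scale hU h0 hσ)
  simp only [integral_smul_measure] at h
  have hg' : Measurable (fun x => g (σ⁻¹ * x)) := hg.comp (by fun_prop)
  rw [integral_map (by fun_prop) hg.aestronglyMeasurable,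
    integral_map (by fun_prop) hg'.aestronglyMeasurable,
    integral_map (by fun_prop) hg.aestronglyMeasurable, ENNReal.toReal_ofReal (by positivity)] at h
  simpa using h

lemma integrable_scale (hU : Unif m ν) (h0 : (0:X) ∈ Sp ν) {σ : ℝ} (hσ : 0 < σ) {g : ℝ → ℝ}
    (hg : Measurable g) : Integrable (fun z => g (σ⁻¹ * ‖z‖)) ν ↔ Integrable (fun z => g ‖z‖) ν := by
  have h := congrArg (fun ρ : Measure ℝ => Integrable g ρ) (map_norm_scale hU h0 hσ)
  simp only [eq_iff_iff] at h
  have hg' : Measurable (g ∘ fun x => (σ⁻¹ * x)) := hg.comp (by fun_prop)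
  rw [integrable_smul_measure (by simp; positivity) ENNReal.ofReal_ne_top,
    integrable_map_measure hg.aestronglyMeasurable (by fun_prop),
    integrable_map_measure hg'.aestronglyMeasurable (by fun_prop),
    integrable_map_measure hg.aestronglyMeasurable (by fun_prop)] at h
  exact h

lemma ZZ_scale (hU : Unif m ν) (h0 : (0:X) ∈ Sp ν) {σ : ℝ} (hσ : 0 < σ) :
    ZZ ν 1 = σ ^ m * ZZ ν σ := by
  unfold ZZ
  rw [← integral_scale hU h0 hσ (g := fun r => Real.exp (-(σ^2 * r^2))) (by fun_prop)]
  congr 1; ext z; congr 1; field_simp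

lemma GP_integral_norm (hU : Unif m ν) (h0 : (0:X) ∈ Sp ν) {σ : ℝ} (hσ : 0 < σ) {g : ℝ → ℝ}
    (hg : Measurable g) : ∫ z, g ‖z‖ ∂(GP ν σ) = ∫ z, g (σ⁻¹ * ‖z‖) ∂(GP ν 1) := by
  rw [GP_integral hU h0 hσ, GP_integral hU h0 one_pos, ZZ_scale hU h0 hσ]
  have := integral_scale hU h0 hσ (g := fun r => Real.exp (-(σ^2 * r^2)) * g r) (by fun_prop)
  have e : ∀ z : X, Real.exp (-(σ^2 * (σ⁻¹ * ‖z‖)^2)) * g (σ⁻¹ * ‖z‖) =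
     Real.exp (-(1^2 * ‖z‖^2)) * g (σ⁻¹ * ‖z‖) := by
    intro z; congr 2; field_simp
  simp only [e] at this
  rw [this]
  have := ZZ_pos hU h0 hσ
  field_simp

lemma GP_exp_integrable (hU : Unif m ν) (h0 : (0:X) ∈ Sp ν) {σ : ℝ} (hσ : 0 < σ) (k : ℕ) (c : ℝ) :
    Integrable (fun z => ‖z‖^k * Real.exp (c * ‖z‖)) (GP ν σ) := by
  rw [GP_integrable_iff hU h0 hσ]
  have h1 := (gauss_integrable hU h0 (half_pos hσ)).const_mul
    ((k.factorial : ℝ) * Real.exp ((c+1)^2 / (3 * σ^2)))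
  refine h1.mono' (by fun_prop) (ae_of_all _ fun z => ?_)
  rw [Real.norm_of_nonneg (by positivity)]
  have h2 : ‖z‖^k ≤ k.factorial * Real.exp ‖z‖ := by
    have := Real.pow_div_factorial_le_exp ‖z‖ (norm_nonneg z) k
    rwa [div_le_iff₀ (by positivity), mul_comm] at this
  calc Real.exp (-(σ^2 * ‖z‖^2)) * (‖z‖^k * Real.exp (c * ‖z‖))
      ≤ Real.exp (-(σ^2 * ‖z‖^2)) * ((k.factorial * Real.exp ‖z‖) * Real.exp (c * ‖z‖)) := by gcongr
    _ = k.factorial * Real.exp (-(σ^2 * ‖z‖^2) + ‖z‖ + c * ‖z‖) := by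
        rw [Real.exp_add, Real.exp_add]; ring
    _ ≤ k.factorial * Real.exp ((c+1)^2 / (3 * σ^2) + -((σ/2)^2 * ‖z‖^2)) := by
        refine mul_le_mul_of_nonneg_left (Real.exp_le_exp.2 ?_) (by positivity)
        have : 0 ≤ (3 * σ^2 * ‖z‖ / 2 - (c+1))^2 / (3*σ^2) := by positivity
        have e : (3 * σ^2 * ‖z‖ / 2 - (c+1))^2 / (3*σ^2) =
          3 * σ^2 * ‖z‖^2 / 4 - (c+1) * ‖z‖ + (c+1)^2 / (3 * σ^2) := by field_simp; ring
        rw [e] at this; nlinarith [this]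
    _ = _ := by rw [Real.exp_add]; ring

lemma GP_pow_integrable (hU : Unif m ν) (h0 : (0:X) ∈ Sp ν) {σ : ℝ} (hσ : 0 < σ) (k : ℕ) :
    Integrable (fun z => ‖z‖^k) (GP ν σ) := by
  simpa using GP_exp_integrable hU h0 hσ k 0

def Ck (ν : Measure X) (k : ℕ) : ℝ := ∫ z, ‖z‖^k ∂(GP ν 1)
def Dk (ν : Measure X) (k : ℕ) : ℝ := ∫ z, ‖z‖^k * Real.exp (2 * ‖z‖) ∂(GP ν 1)

lemma Ck_nonneg (ν : Measure X) (k : ℕ) : 0 ≤ Ck ν k := integral_nonneg fun z => by positivity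
lemma Dk_nonneg (ν : Measure X) (k : ℕ) : 0 ≤ Dk ν k := integral_nonneg fun z => by positivity

lemma GP_moment (hU : Unif m ν) (h0 : (0:X) ∈ Sp ν) {σ : ℝ} (hσ : 0 < σ) (k : ℕ) :
    ∫ z, ‖z‖^k ∂(GP ν σ) = σ⁻¹^k * Ck ν k := by
  rw [GP_integral_norm hU h0 hσ (g := fun r => r^k) (by fun_prop)]
  simp only [mul_pow, Ck]
  rw [integral_const_mul]

lemma GP_exp_moment (hU : Unif m ν) (h0 : (0:X) ∈ Sp ν) {σ : ℝ} (hσ : 0 < σ) (k : ℕ) {d : ℝ}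
    (hd : σ * d ≤ 1) :
    ∫ z, ‖z‖^k * Real.exp (2 * σ^2 * d * ‖z‖) ∂(GP ν σ) ≤ σ⁻¹^k * Dk ν k := by
  rw [GP_integral_norm hU h0 hσ (g := fun r => r^k * Real.exp (2 * σ^2 * d * r)) (by fun_prop)]
  simp only [Dk]
  rw [← integral_const_mul]
  have e : ∀ z : X, (σ⁻¹ * ‖z‖)^k * Real.exp (2 * σ^2 * d * (σ⁻¹ * ‖z‖)) =
    σ⁻¹^k * (‖z‖^k * Real.exp ((2 * (σ * d)) * ‖z‖)) := by
    intro z; rw [mul_pow, mul_assoc]; congr 3; field_simp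
  simp only [e]
  apply integral_mono ((GP_exp_integrable hU h0 one_pos k _).const_mul _)
    ((GP_exp_integrable hU h0 one_pos k _).const_mul _)
  intro z
  have : 2 * (σ * d) ≤ 2 := by linarith
  show σ⁻¹^k * (‖z‖^k * Real.exp ((2 * (σ * d)) * ‖z‖)) ≤ σ⁻¹^k * (‖z‖^k * Real.exp (2 * ‖z‖))
  gcongr

lemma GP_exp_inner (hU : Unif m ν) (h0 : (0:X) ∈ Sp ν) {σ : ℝ} (hσ : 0 < σ) {x : X} (hx : x ∈ Sp ν) :
    ∫ z, Real.exp (2 * σ^2 * ⟪z, x⟫) ∂(GP ν σ) = Real.exp (σ^2 * ‖x‖^2) := by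
  have h := congrArg (fun ρ : Measure ℝ => ∫ r, Real.exp (-(σ^2 * r^2)) ∂ρ) (map_dist_eq hU hx h0)
  rw [integral_map (by fun_prop) (by fun_prop), integral_map (by fun_prop) (by fun_prop)] at h
  rw [GP_integral hU h0 hσ]
  have e : ∀ z : X, Real.exp (-(σ^2 * ‖z‖^2)) * Real.exp (2 * σ^2 * ⟪z, x⟫) =
      Real.exp (σ^2 * ‖x‖^2) * Real.exp (-(σ^2 * ‖z - x‖^2)) := by
    intro z; rw [← Real.exp_add, ← Real.exp_add, norm_sub_sq_real]; congr 1; ring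
  simp only [e]
  rw [integral_const_mul, h]
  have := (ZZ_pos hU h0 hσ).ne'
  unfold ZZ at this ⊢
  field_simp

lemma GP_shift (hU : Unif m ν) (h0 : (0:X) ∈ Sp ν) {σ : ℝ} (hσ : 0 < σ) {h : ℝ} (hh : 0 < 1 + h)
    (f : X → ℝ) :
    ∫ z, f z * Real.exp (-((2 * h + h^2) * (σ^2 * ‖z‖^2))) ∂(GP ν σ) =
      ((1+h)^m)⁻¹ * ∫ z, f z ∂(GP ν ((1+h)*σ)) := by
  have hσ' : 0 < (1+h)*σ := by positivity
  rw [GP_integral hU h0 hσ, GP_integral hU h0 hσ']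
  have h1 := ZZ_scale hU h0 hσ
  rw [ZZ_scale hU h0 hσ'] at h1
  have := ZZ_pos hU h0 hσ
  have := ZZ_pos hU h0 hσ'
  have h2 : (ZZ ν σ)⁻¹ = ((1+h)^m)⁻¹ * (ZZ ν ((1+h)*σ))⁻¹ := by
    rw [mul_pow] at h1
    have h3 : (σ^m) * ((1+h)^m * ZZ ν ((1+h)*σ)) = σ^m * ZZ ν σ := by rw [← h1]; ring
    rw [← mul_left_cancel₀ (by positivity) h3, mul_inv]
  rw [h2, mul_assoc]
  congr 2
  refine integral_congr_ae (ae_of_all _ fun z => ?_)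
  dsimp only
  rw [mul_left_comm, ← Real.exp_add, mul_comm]
  congr 2; ring

lemma GP_mass (hU : Unif m ν) (h0 : (0:X) ∈ Sp ν) {δ : ℝ} (hδ : 0 < δ) :
    ∃ q > 0, ∀ σ > 0, (GP ν σ).real {z | σ * ‖z‖ ≤ δ} = q := by
  refine ⟨(GP ν 1).real {z | ‖z‖ ≤ δ}, ?_, ?_⟩
  · haveI := GP_prob hU h0 one_pos
    have h1 : (0:ℝ) < ∫ z, (closedBall (0:X) δ).indicator 1 z ∂(GP ν 1) := by
      rw [GP_integral hU h0 one_pos]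
      refine mul_pos (inv_pos.2 (ZZ_pos hU h0 one_pos)) ?_
      rw [integral_pos_iff_support_of_nonneg]
      · refine lt_of_lt_of_le (h0 δ hδ) (measure_mono fun z hz => ?_)
        simp [Function.mem_support, (Real.exp_pos _).ne', indicator_of_mem hz]; simpa using hz
      · intro z; exact mul_nonneg (Real.exp_pos _).le (indicator_nonneg (fun _ _ => by simp) _)
      · rw [← GP_integrable_iff hU h0 one_pos]
        exact (integrable_const (1:ℝ)).indicator isClosed_closedBall.measurableSet
    rw [integral_indicator_one isClosed_closedBall.measurableSet] at h1
    convert h1 using 2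
    ext z; simp
  · intro σ hσ
    have hm : Measurable ((Iic δ).indicator (1 : ℝ → ℝ)) := measurable_one.indicator measurableSet_Iic
    have := GP_integral_norm hU h0 hσ (g := fun r => (Iic δ).indicator (1 : ℝ → ℝ) (σ * r)) (by fun_prop)
    have e1 : ∀ z : X, (Iic δ).indicator (1 : ℝ → ℝ) (σ * ‖z‖) = ({z | σ * ‖z‖ ≤ δ}).indicator 1 z := by
      intro z; simp [indicator]
    have e2 : ∀ z : X, (Iic δ).indicator (1 : ℝ → ℝ) (σ * (σ⁻¹ * ‖z‖)) = ({z | ‖z‖ ≤ δ}).indicator 1 z := by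
      intro z; rw [mul_inv_cancel_left₀ hσ.ne']; simp [indicator]
    simp only [e1, e2] at this
    rwa [integral_indicator_one (measurableSet_le (by fun_prop) (by fun_prop)),
      integral_indicator_one (measurableSet_le (by fun_prop) (by fun_prop))] at this

end gaussfam
end FT

namespace FT

section expansion
variable {X : Type*} [NormedAddCommGroup X] [InnerProductSpace ℝ X] [FiniteDimensional ℝ X]
  [MeasurableSpace X] [BorelSpace X]
variable {m : ℕ} {ν : Measure X}

def PG (f : X → ℝ) : Prop := Continuous f ∧ ∃ C : ℝ, ∃ k : ℕ, 0 ≤ C ∧ ∀ z, |f z| ≤ C * (1 + ‖z‖)^k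

lemma PG.const (c : ℝ) : PG (fun _ : X => c) :=
  ⟨continuous_const, |c|, 0, abs_nonneg _, fun z => by simp⟩

lemma PG.norm : PG (fun z : X => ‖z‖) :=
  ⟨continuous_norm, 1, 1, zero_le_one, fun z => by rw [abs_norm]; simp⟩

lemma PG.inner (u : X) : PG (fun z : X => ⟪u, z⟫) := by
  refine ⟨by fun_prop, ‖u‖, 1, norm_nonneg _, fun z => (abs_real_inner_le_norm u z).trans ?_⟩
  have := norm_nonneg u
  nlinarith

lemma PG.mul {f g : X → ℝ} (hf : PG f) (hg : PG g) : PG (fun z => f z * g z) := by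
  obtain ⟨cf, C, k, hC, h1⟩ := hf
  obtain ⟨cg, D, l, hD, h2⟩ := hg
  refine ⟨cf.mul cg, C * D, k + l, by positivity, fun z => ?_⟩
  rw [abs_mul, pow_add]
  calc |f z| * |g z| ≤ (C * (1+‖z‖)^k) * (D * (1+‖z‖)^l) :=
        mul_le_mul (h1 z) (h2 z) (abs_nonneg _) (by positivity)
    _ = _ := by ring

lemma PG.add {f g : X → ℝ} (hf : PG f) (hg : PG g) : PG (fun z => f z + g z) := by
  obtain ⟨cf, C, k, hC, h1⟩ := hf
  obtain ⟨cg, D, l, hD, h2⟩ := hg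
  refine ⟨cf.add cg, C + D, k + l, by positivity, fun z => ?_⟩
  have hz : 1 ≤ 1 + ‖z‖ := by linarith [norm_nonneg z]
  have e1 : (1+‖z‖)^k ≤ (1+‖z‖)^(k+l) := pow_le_pow_right₀ hz (by omega)
  have e2 : (1+‖z‖)^l ≤ (1+‖z‖)^(k+l) := pow_le_pow_right₀ hz (by omega)
  calc |f z + g z| ≤ |f z| + |g z| := abs_add_le _ _
    _ ≤ C * (1+‖z‖)^k + D * (1+‖z‖)^l := add_le_add (h1 z) (h2 z)
    _ ≤ C * (1+‖z‖)^(k+l) + D * (1+‖z‖)^(k+l) := by gcongr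
    _ = _ := by ring

lemma PG.cmul {f : X → ℝ} (c : ℝ) (hf : PG f) : PG (fun z => c * f z) := (PG.const c).mul hf

lemma PG.neg {f : X → ℝ} (hf : PG f) : PG (fun z => - f z) := by
  simpa using hf.cmul (-1)

lemma PG.sub {f g : X → ℝ} (hf : PG f) (hg : PG g) : PG (fun z => f z - g z) := by
  simpa [sub_eq_add_neg] using hf.add hg.neg

lemma PG.pow {f : X → ℝ} (hf : PG f) (k : ℕ) : PG (fun z => f z ^ k) := by
  induction k with
  | zero => simpa using PG.const (X := X) 1
  | succ k ih => simpa [pow_succ] using ih.mul hf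

lemma PG.sum {ι : Type*} (s : Finset ι) {f : ι → X → ℝ} (hf : ∀ i ∈ s, PG (f i)) :
    PG (fun z => ∑ i ∈ s, f i z) := by
  classical
  induction s using Finset.induction_on with
  | empty => simpa using PG.const (X := X) 0
  | insert a s ha ih =>
    simp only [Finset.sum_insert ha]
    exact (hf a (by simp)).add (ih fun i hi => hf i (by simp [hi]))

lemma PG.int {f : X → ℝ} (hf : PG f) (hU : Unif m ν) (h0 : (0:X) ∈ Sp ν) {σ : ℝ} (hσ : 0 < σ) :
    Integrable f (GP ν σ) := by
  obtain ⟨cf, C, k, hC, h1⟩ := hf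
  haveI := GP_prob hU h0 hσ
  have : Integrable (fun z : X => C * (2^k * (1 + ‖z‖^k))) (GP ν σ) :=
    (((integrable_const 1).add (GP_pow_integrable hU h0 hσ k)).const_mul _).const_mul _
  refine this.mono' cf.aestronglyMeasurable (ae_of_all _ fun z => ?_)
  refine (h1 z).trans ?_
  gcongr
  have h2 : 1 + ‖z‖ ≤ 2 * max 1 ‖z‖ := by linarith [le_max_left 1 ‖z‖, le_max_right 1 ‖z‖]
  calc (1 + ‖z‖)^k ≤ (2 * max 1 ‖z‖)^k := by gcongr
    _ = 2^k * (max 1 ‖z‖)^k := by rw [mul_pow]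
    _ ≤ _ := by
      gcongr
      rcases le_total 1 ‖z‖ with h | h
      · rw [max_eq_right h]; linarith
      · rw [max_eq_left h]; simp

lemma av_bound (hU : Unif m ν) (h0 : (0:X) ∈ Sp ν) {σ : ℝ} (hσ : 0 < σ) {f : X → ℝ} {C : ℝ} {k : ℕ}
    (hf : ∀ z ∈ Sp ν, |f z| ≤ C * ‖z‖^k) : |∫ z, f z ∂(GP ν σ)| ≤ C * (σ⁻¹^k * Ck ν k) := by
  have h1 := norm_integral_le_of_norm_le ((GP_pow_integrable hU h0 hσ k).const_mul C)
    (f := f) ((GP_ae ν σ).mono fun z hz => hf z hz)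
  rwa [integral_const_mul, GP_moment hU h0 hσ] at h1

lemma av_bound' (hU : Unif m ν) (h0 : (0:X) ∈ Sp ν) {σ : ℝ} (hσ : 0 < σ) {f : X → ℝ} {C : ℝ} {k : ℕ}
    (hf : ∀ z ∈ Sp ν, |f z| ≤ C * ‖z‖^k) : |σ^k * ∫ z, f z ∂(GP ν σ)| ≤ C * Ck ν k := by
  have := av_bound hU h0 hσ hf
  rw [abs_mul, abs_of_pos (by positivity)]
  calc σ^k * |∫ z, f z ∂(GP ν σ)| ≤ σ^k * (C * (σ⁻¹^k * Ck ν k)) := by gcongr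
    _ = _ := by rw [inv_pow]; field_simp

lemma av_small (hU : Unif m ν) (h0 : (0:X) ∈ Sp ν) {f : X → ℝ} {C : ℝ} {k l : ℕ} (hkl : k < l)
    (hf : ∀ z ∈ Sp ν, |f z| ≤ C * ‖z‖^k) :
    Tendsto (fun σ => σ^l * ∫ z, f z ∂(GP ν σ)) (𝓝[>] 0) (𝓝 0) := by
  have h1 : Tendsto (fun σ : ℝ => σ^(l-k) * (C * Ck ν k)) (𝓝[>] 0) (𝓝 0) := by
    apply tendsto_nhdsWithin_of_tendsto_nhds
    have : Continuous (fun σ : ℝ => σ^(l-k) * (C * Ck ν k)) := by fun_prop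
    have := this.tendsto 0
    rwa [zero_pow (by omega), zero_mul] at this
  refine squeeze_zero_norm' ?_ h1
  filter_upwards [self_mem_nhdsWithin] with σ hσ
  have hσ : 0 < σ := hσ
  have := av_bound' hU h0 hσ hf
  have e : σ^l = σ^(l-k) * σ^k := by rw [← pow_add]; congr 1; omega
  rw [e, mul_assoc, Real.norm_eq_abs, abs_mul, abs_of_pos (by positivity : 0 < σ^(l-k))]
  gcongr

lemma exp_taylor (t : ℝ) (K : ℕ) :
    |Real.exp t - ∑ k ∈ Finset.range K, t^k / k.factorial| ≤ |t|^K * Real.exp |t| := by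
  have h := Complex.norm_exp_sub_sum_le_norm_mul_exp (t:ℂ) K
  rw [Complex.norm_real, Real.norm_eq_abs] at h
  refine le_trans (le_of_eq ?_) h
  rw [← Real.norm_eq_abs, ← Complex.norm_real]
  push_cast
  rfl

lemma expansion (hU : Unif m ν) (h0 : (0:X) ∈ Sp ν) {σ : ℝ} (hσ : 0 < σ) {x : X} (hx : x ∈ Sp ν)
    (hσx : σ * ‖x‖ ≤ 1) (K : ℕ) :
    |Real.exp (σ^2 * ‖x‖^2) - ∑ k ∈ Finset.range K, (2*σ^2)^k / k.factorial * ∫ z, ⟪x, z⟫^k ∂(GP ν σ)|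
      ≤ (2 * σ * ‖x‖)^K * Dk ν K := by
  haveI := GP_prob hU h0 hσ
  have hi : ∀ k ∈ Finset.range K, Integrable (fun z => (2*σ^2)^k / k.factorial * ⟪x, z⟫^k) (GP ν σ) :=
    fun k _ => (((PG.inner x).pow k).cmul _).int hU h0 hσ
  have hsum : ∑ k ∈ Finset.range K, (2*σ^2)^k / k.factorial * ∫ z, ⟪x, z⟫^k ∂(GP ν σ)
      = ∫ z, ∑ k ∈ Finset.range K, (2*σ^2)^k / k.factorial * ⟪x, z⟫^k ∂(GP ν σ) := by
    rw [integral_finsetSum _ hi]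
    simp only [integral_const_mul]
  have habs : ∀ z, |2 * σ^2 * ⟪z, x⟫| ≤ 2 * σ^2 * ‖x‖ * ‖z‖ := fun z => by
    rw [abs_mul, abs_of_pos (by positivity : 0 < 2 * σ^2), mul_assoc (2 * σ^2), mul_comm ‖x‖]
    exact mul_le_mul_of_nonneg_left (abs_real_inner_le_norm z x) (by positivity)
  have hie : Integrable (fun z => Real.exp (2 * σ^2 * ⟪z, x⟫)) (GP ν σ) := by
    have := GP_exp_integrable hU h0 hσ 0 (2 * σ^2 * ‖x‖)
    refine this.mono' (by fun_prop) (ae_of_all _ fun z => ?_)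
    rw [Real.norm_of_nonneg (Real.exp_pos _).le]
    simp only [pow_zero, one_mul]
    exact Real.exp_le_exp.2 ((le_abs_self _).trans (habs z))
  rw [hsum, ← GP_exp_inner hU h0 hσ hx, ← integral_sub hie (integrable_finsetSum _ hi)]
  have hb := norm_integral_le_of_norm_le (μ := GP ν σ)
    (f := fun z => Real.exp (2 * σ^2 * ⟪z, x⟫) - ∑ k ∈ Finset.range K, (2*σ^2)^k / k.factorial * ⟪x, z⟫^k)
    ((GP_exp_integrable hU h0 hσ K (2 * σ^2 * ‖x‖)).const_mul ((2 * σ^2 * ‖x‖)^K))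
    (ae_of_all _ fun z => by
      have := exp_taylor (2 * σ^2 * ⟪z, x⟫) K
      have e : ∀ k : ℕ, (2 * σ^2 * ⟪z, x⟫)^k / k.factorial = (2*σ^2)^k / k.factorial * ⟪x, z⟫^k := by
        intro k; rw [mul_pow, real_inner_comm]; ring
      simp only [e] at this
      rw [Real.norm_eq_abs]
      refine this.trans ?_
      have h2 := habs z
      calc |2 * σ^2 * ⟪z, x⟫|^K * Real.exp |2 * σ^2 * ⟪z, x⟫|
          ≤ (2 * σ^2 * ‖x‖ * ‖z‖)^K * Real.exp (2 * σ^2 * ‖x‖ * ‖z‖) := by gcongr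
        _ = _ := by rw [mul_pow _ ‖z‖]; ring)
  rw [Real.norm_eq_abs] at hb
  refine hb.trans ?_
  rw [integral_const_mul]
  calc (2 * σ^2 * ‖x‖)^K * ∫ z, ‖z‖^K * Real.exp (2 * σ^2 * ‖x‖ * ‖z‖) ∂(GP ν σ)
      ≤ (2 * σ^2 * ‖x‖)^K * (σ⁻¹^K * Dk ν K) := by
        gcongr; exact GP_exp_moment hU h0 hσ K hσx
    _ = _ := by rw [← mul_assoc, ← mul_pow]; congr 2; field_simp

lemma ev_small (x : X) : ∀ᶠ σ : ℝ in 𝓝[>] 0, 0 < σ ∧ σ * ‖x‖ ≤ 1 ∧ σ ≤ 1 := by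
  have h : ∀ᶠ σ : ℝ in 𝓝[>] 0, σ < (‖x‖ + 1)⁻¹ := by
    apply tendsto_nhdsWithin_of_tendsto_nhds tendsto_id
    exact Iio_mem_nhds (by positivity)
  filter_upwards [h, self_mem_nhdsWithin] with σ h1 h2
  have h2 : 0 < σ := h2
  have : σ * (‖x‖ + 1) < 1 := by rwa [lt_inv_comm₀ h2 (by positivity), inv_eq_one_div, lt_div_iff₀ h2, mul_comm] at h1
  have := mul_nonneg h2.le (norm_nonneg x)
  exact ⟨h2, by linarith, by linarith⟩

lemma second_order (hU : Unif m ν) (h0 : (0:X) ∈ Sp ν) {x : X} (hx : x ∈ Sp ν) :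
    Tendsto (fun σ => 2 * (∫ z, ⟪x, z⟫ ∂(GP ν σ)) + 2 * σ^2 * (∫ z, ⟪x, z⟫^2 ∂(GP ν σ)) - ‖x‖^2)
      (𝓝[>] 0) (𝓝 0) := by
  have h1 : Tendsto (fun σ : ℝ => σ * ((2 * ‖x‖)^3 * Dk ν 3) + σ^2 * (‖x‖^4 * 3)) (𝓝[>] 0) (𝓝 0) := by
    apply tendsto_nhdsWithin_of_tendsto_nhds
    have : Continuous (fun σ : ℝ => σ * ((2 * ‖x‖)^3 * Dk ν 3) + σ^2 * (‖x‖^4*3)) := by fun_prop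
    simpa using this.tendsto 0
  refine squeeze_zero_norm' ?_ h1
  filter_upwards [ev_small x] with σ ⟨hσ, hs, _⟩
  haveI := GP_prob hU h0 hσ
  have e1 := expansion hU h0 hσ hx hs 3
  have ht : σ^2 * ‖x‖^2 ≤ 1 := by rw [← mul_pow]; exact pow_le_one₀ (by positivity) hs
  have e2 := exp_taylor (σ^2 * ‖x‖^2) 2
  rw [abs_of_nonneg (by positivity : 0 ≤ σ^2 * ‖x‖^2)] at e2
  have e3 : Real.exp (σ^2 * ‖x‖^2) ≤ 3 := (Real.exp_le_exp.2 ht).trans (by have := Real.exp_one_lt_d9; linarith)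
  have e4 : (σ^2 * ‖x‖^2)^2 * Real.exp (σ^2 * ‖x‖^2) ≤ (σ^2 * ‖x‖^2)^2 * 3 := by gcongr
  simp [Finset.sum_range_succ, Nat.factorial] at e1 e2
  rw [Real.norm_eq_abs]
  set A := ∫ z, ⟪x, z⟫ ∂(GP ν σ)
  set B := ∫ z, ⟪x, z⟫^2 ∂(GP ν σ)
  have hσ2 : 0 < σ^2 := by positivity
  rw [abs_le] at e1 e2 ⊢
  constructor
  · have : σ^2 * -(σ * ((2 * ‖x‖)^3 * Dk ν 3) + σ^2 * (‖x‖^4 * 3)) ≤ σ^2 * (2 * A + 2 * σ^2 * B - ‖x‖^2) := by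
      nlinarith [e1.1, e1.2, e2.1, e2.2, e4]
    exact le_of_mul_le_mul_left this hσ2
  · have : σ^2 * (2 * A + 2 * σ^2 * B - ‖x‖^2) ≤ σ^2 * (σ * ((2 * ‖x‖)^3 * Dk ν 3) + σ^2 * (‖x‖^4 * 3)) := by
      nlinarith [e1.1, e1.2, e2.1, e2.2, e4]
    exact le_of_mul_le_mul_left this hσ2

lemma fourth_order (hU : Unif m ν) (h0 : (0:X) ∈ Sp ν) {x : X} (hx : x ∈ Sp ν) :
    Tendsto (fun σ => (2 * (∫ z, ⟪x, z⟫ ∂(GP ν σ)) - ‖x‖^2) / σ^2 + 2 * (∫ z, ⟪x, z⟫^2 ∂(GP ν σ))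
      + (4/3) * (σ^2 * ∫ z, ⟪x, z⟫^3 ∂(GP ν σ)) + (2/3) * (σ^4 * ∫ z, ⟪x, z⟫^4 ∂(GP ν σ)) - ‖x‖^4 / 2)
      (𝓝[>] 0) (𝓝 0) := by
  have h1 : Tendsto (fun σ : ℝ => σ * ((2 * ‖x‖)^5 * Dk ν 5) + σ^2 * (‖x‖^6 * 3)) (𝓝[>] 0) (𝓝 0) := by
    apply tendsto_nhdsWithin_of_tendsto_nhds
    have : Continuous (fun σ : ℝ => σ * ((2 * ‖x‖)^5 * Dk ν 5) + σ^2 * (‖x‖^6*3)) := by fun_prop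
    simpa using this.tendsto 0
  refine squeeze_zero_norm' ?_ h1
  filter_upwards [ev_small x] with σ ⟨hσ, hs, _⟩
  haveI := GP_prob hU h0 hσ
  have e1 := expansion hU h0 hσ hx hs 5
  have ht : σ^2 * ‖x‖^2 ≤ 1 := by rw [← mul_pow]; exact pow_le_one₀ (by positivity) hs
  have e2 := exp_taylor (σ^2 * ‖x‖^2) 3
  rw [abs_of_nonneg (by positivity : 0 ≤ σ^2 * ‖x‖^2)] at e2
  have e3 : Real.exp (σ^2 * ‖x‖^2) ≤ 3 := (Real.exp_le_exp.2 ht).trans (by have := Real.exp_one_lt_d9; linarith)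
  have e4 : (σ^2 * ‖x‖^2)^3 * Real.exp (σ^2 * ‖x‖^2) ≤ (σ^2 * ‖x‖^2)^3 * 3 := by gcongr
  simp [Finset.sum_range_succ, Nat.factorial] at e1 e2
  rw [Real.norm_eq_abs]
  set A := ∫ z, ⟪x, z⟫ ∂(GP ν σ)
  set B := ∫ z, ⟪x, z⟫^2 ∂(GP ν σ)
  set C := ∫ z, ⟪x, z⟫^3 ∂(GP ν σ)
  set D := ∫ z, ⟪x, z⟫^4 ∂(GP ν σ)
  have hσ2 : 0 < σ^4 := by positivity
  have key : σ^4 * ((2 * A - ‖x‖^2) / σ^2 + 2 * B + (4/3) * (σ^2 * C) + (2/3) * (σ^4 * D) - ‖x‖^4 / 2) =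
    (1 + 2 * σ^2 * A + (2*σ^2)^2/2 * B + (2*σ^2)^3/6 * C + (2*σ^2)^4/24 * D)
     - (1 + σ^2 * ‖x‖^2 + (σ^2 * ‖x‖^2)^2/2) := by field_simp; ring
  rw [abs_le] at e1 e2 ⊢
  ring_nf at e1 e2 e4
  constructor
  · have : σ^4 * -(σ * ((2 * ‖x‖)^5 * Dk ν 5) + σ^2 * (‖x‖^6 * 3)) ≤ σ^4 * ((2 * A - ‖x‖^2) / σ^2 + 2 * B + (4/3) * (σ^2 * C) + (2/3) * (σ^4 * D) - ‖x‖^4 / 2) := by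
      rw [key]; ring_nf
      linarith [e1.1, e1.2, e2.1, e2.2, e4]
    exact le_of_mul_le_mul_left this hσ2
  · have : σ^4 * ((2 * A - ‖x‖^2) / σ^2 + 2 * B + (4/3) * (σ^2 * C) + (2/3) * (σ^4 * D) - ‖x‖^4 / 2) ≤ σ^4 * (σ * ((2 * ‖x‖)^5 * Dk ν 5) + σ^2 * (‖x‖^6 * 3)) := by
      rw [key]; ring_nf
      linarith [e1.1, e1.2, e2.1, e2.2, e4]
    exact le_of_mul_le_mul_left this hσ2

end expansion
end FT

namespace FT

section lemmaF
variable {X : Type*} [NormedAddCommGroup X] [InnerProductSpace ℝ X] [FiniteDimensional ℝ X]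
  [MeasurableSpace X] [BorelSpace X]
variable {m : ℕ} {ν : Measure X}

lemma locfin_of_balls {ρ : Measure X} (h : ∀ R : ℝ, 0 < R → ρ (closedBall 0 R) < ∞) :
    IsLocallyFiniteMeasure ρ := by
  refine ⟨fun x => ⟨closedBall 0 (‖x‖ + 1), ?_, h _ (by positivity)⟩⟩
  apply Filter.mem_of_superset (Metric.closedBall_mem_nhds x one_pos)
  intro y hy
  rw [mem_closedBall, dist_eq_norm] at hy
  rw [mem_closedBall_zero_iff]
  linarith [norm_sub_norm_le y x]

lemma Unif.locfin (hU : Unif m ν) (h0 : (0:X) ∈ Sp ν) : IsLocallyFiniteMeasure ν :=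
  locfin_of_balls fun R hR => by rw [hU 0 h0 R hR]; exact ENNReal.ofReal_lt_top

lemma lemmaF (hU : Unif m ν) (h0 : (0:X) ∈ Sp ν) (W : Submodule ℝ X) (hW : finrank ℝ W = m)
    (hsub : Sp ν ⊆ W) : Sp ν = W := by
  haveI := hU.locfin h0
  let H : Measure X := Measure.map (Subtype.val : W → X) volume
  let κ : ℝ≥0∞ := volume (ball (0 : W) 1)
  have hκ0 : κ ≠ 0 := (measure_ball_pos _ _ one_pos).ne'
  have hκt : κ ≠ ∞ := measure_ball_lt_top.ne
  have hH : ∀ x ∈ W, ∀ r : ℝ, 0 < r → H (closedBall x r) = ENNReal.ofReal (r^m) * κ := by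
    intro x hx r hr
    have e : (Subtype.val : W → X) ⁻¹' (closedBall x r) = closedBall (⟨x, hx⟩ : W) r := by
      ext z; simp [Subtype.dist_eq]
    rw [Measure.map_apply measurable_subtype_coe isClosed_closedBall.measurableSet, e,
      Measure.addHaar_closedBall _ _ hr.le, hW]
  haveI : IsLocallyFiniteMeasure H := locfin_of_balls fun R hR => by
    rw [hH 0 W.zero_mem R hR]; exact ENNReal.mul_lt_top ENNReal.ofReal_lt_top hκt.lt_top
  have hrn : H.rnDeriv ν =ᵐ[ν] fun _ => κ := by
    filter_upwards [Besicovitch.ae_tendsto_rnDeriv H ν, Sp_ae ν] with x h1 h2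
    refine tendsto_nhds_unique h1 (tendsto_const_nhds.congr' ?_)
    filter_upwards [self_mem_nhdsWithin] with r hr
    have hr : 0 < r := hr
    rw [hH x (hsub h2) r hr, hU x h2 r hr, mul_comm, ENNReal.mul_div_cancel_right (by simp; positivity) ENNReal.ofReal_ne_top]
  have hdec := Measure.haveLebesgueDecomposition_add H ν
  rw [withDensity_congr_ae hrn, withDensity_const] at hdec
  have hs0 : ∀ R : ℝ, 0 < R → H.singularPart ν (closedBall 0 R) = 0 := by
    intro R hR
    have h1 := congrArg (fun ρ : Measure X => ρ (closedBall 0 R)) hdec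
    simp only [Measure.add_apply, Measure.smul_apply, smul_eq_mul] at h1
    rw [hH 0 W.zero_mem R hR, hU 0 h0 R hR, mul_comm] at h1
    have h3 : κ * ENNReal.ofReal (R^m) ≠ ∞ := ENNReal.mul_ne_top hκt ENNReal.ofReal_ne_top
    have h2 : 0 + κ * ENNReal.ofReal (R^m) = (H.singularPart ν) (closedBall 0 R) + κ * ENNReal.ofReal (R^m) := by
      rw [zero_add]; exact h1
    exact ((ENNReal.add_left_inj h3).1 h2).symm
  have hs : H.singularPart ν = 0 := by
    rw [← Measure.measure_univ_eq_zero, ← iUnion_closedBall_nat (0:X)]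
    rw [measure_iUnion_null_iff]
    intro k
    refine measure_mono_null (closedBall_subset_closedBall (by linarith : (k:ℝ) ≤ k + 1)) (hs0 _ (by positivity))
  rw [hs, zero_add] at hdec
  refine hsub.antisymm fun w hw r hr => ?_
  have h1 := hH w hw r hr
  rw [hdec, Measure.smul_apply, smul_eq_mul, mul_comm] at h1
  have : ν (closedBall w r) * κ ≠ 0 := by
    rw [h1]; exact mul_ne_zero (by simp; positivity) hκ0
  exact pos_iff_ne_zero.2 (left_ne_zero_of_mul this)

end lemmaF
end FT

namespace FT

lemma ultra_lim {α : Type*} (U : Ultrafilter α) {g : α → ℝ} {C : ℝ} (h : ∀ᶠ i in U, |g i| ≤ C) :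
    ∃ l, Tendsto g U (𝓝 l) := by
  have hc : IsCompact (Icc (-C) C) := isCompact_Icc
  obtain ⟨l, _, hl⟩ := hc.ultrafilter_le_nhds (U.map g) (by
    rw [le_principal_iff]
    show ∀ᶠ i in U, g i ∈ Icc (-C) C
    filter_upwards [h] with i hi
    exact abs_le.1 hi)
  exact ⟨l, hl⟩

section compactness
variable {X : Type*} [NormedAddCommGroup X] [InnerProductSpace ℝ X] [FiniteDimensional ℝ X]
  [MeasurableSpace X] [BorelSpace X]

def bump (z : X) (r₁ r₂ : ℝ) (y : X) : ℝ := max 0 (min 1 ((r₂ - ‖y - z‖) / (r₂ - r₁)))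

lemma bump_cont (z : X) (r₁ r₂ : ℝ) : Continuous (bump z r₁ r₂) := by
  unfold bump; fun_prop

lemma bump_nonneg (z : X) (r₁ r₂ : ℝ) (y : X) : 0 ≤ bump z r₁ r₂ y := le_max_left _ _
lemma bump_le_one (z : X) (r₁ r₂ : ℝ) (y : X) : bump z r₁ r₂ y ≤ 1 := by
  unfold bump; simp

lemma bump_zero {z : X} {r₁ r₂ : ℝ} (h : r₁ < r₂) {y : X} (hy : y ∉ closedBall z r₂) :
    bump z r₁ r₂ y = 0 := by
  unfold bump
  rw [mem_closedBall, dist_eq_norm, not_le] at hy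
  apply max_eq_left
  refine (min_le_right _ _).trans (div_nonpos_of_nonpos_of_nonneg (by linarith) (by linarith))

lemma bump_one {z : X} {r₁ r₂ : ℝ} (h : r₁ < r₂) {y : X} (hy : y ∈ closedBall z r₁) :
    bump z r₁ r₂ y = 1 := by
  unfold bump
  rw [mem_closedBall, dist_eq_norm] at hy
  have : 1 ≤ (r₂ - ‖y - z‖) / (r₂ - r₁) := by rw [le_div_iff₀ (by linarith)]; linarith
  rw [min_eq_left this]; simp

lemma bump_cs {z : X} {r₁ r₂ : ℝ} (h : r₁ < r₂) : HasCompactSupport (bump z r₁ r₂) :=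
  HasCompactSupport.intro (isCompact_closedBall z r₂) fun y hy => bump_zero h hy

lemma bump_lower (ρ : Measure X) [IsLocallyFiniteMeasure ρ] (z : X) {r₁ r₂ : ℝ} (h : r₁ < r₂) :
    (ρ (closedBall z r₁)).toReal ≤ ∫ y, bump z r₁ r₂ y ∂ρ := by
  have hi := (bump_cont z r₁ r₂).integrable_of_hasCompactSupport (bump_cs h) (μ := ρ)
  have := integral_indicator_one (μ := ρ) (isClosed_closedBall (x := z) (ε := r₁)).measurableSet
  rw [measureReal_def] at this
  rw [← this]
  apply integral_mono_of_nonneg (ae_of_all _ fun y => indicator_nonneg (fun _ _ => zero_le_one) _) hi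
  refine ae_of_all _ fun y => ?_
  by_cases hy : y ∈ closedBall z r₁
  · simp only [indicator_of_mem hy, bump_one h hy]; simp
  · simp only [indicator_of_notMem hy]; exact bump_nonneg _ _ _ _

lemma bump_upper (ρ : Measure X) [IsLocallyFiniteMeasure ρ] (z : X) {r₁ r₂ : ℝ} (h : r₁ < r₂) :
    ∫ y, bump z r₁ r₂ y ∂ρ ≤ (ρ (closedBall z r₂)).toReal := by
  have := integral_indicator_one (μ := ρ) (isClosed_closedBall (x := z) (ε := r₂)).measurableSet
  rw [measureReal_def] at this
  rw [← this]
  apply integral_mono_of_nonneg (ae_of_all _ fun y => bump_nonneg _ _ _ _)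
  · rw [integrable_indicator_iff isClosed_closedBall.measurableSet]
    exact integrableOn_const (measure_closedBall_lt_top.ne)
  refine ae_of_all _ fun y => ?_
  by_cases hy : y ∈ closedBall z r₂
  · simp only [indicator_of_mem hy]; exact bump_le_one _ _ _ _
  · simp only [indicator_of_notMem hy, bump_zero h hy]; exact le_rfl

lemma exists_mem_Sp {ρ : Measure X} {z : X} {r : ℝ} (h : 0 < ρ (closedBall z r)) :
    ∃ y ∈ Sp ρ, ‖y - z‖ ≤ r := by
  by_contra hc
  push Not at hc
  have : ρ (closedBall z r) = 0 := by
    refine measure_mono_null (t := (Sp ρ)ᶜ) (fun y hy hy2 => ?_) (Sp_ae ρ)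
    have := hc y hy2
    rw [mem_closedBall, dist_eq_norm] at hy
    linarith
  exact h.ne' this

variable {m : ℕ} {α : Type*}

lemma riesz_limit (U : Ultrafilter α) (μs : α → Measure X) [hlf : ∀ i, IsLocallyFiniteMeasure (μs i)]
    (hb : ∀ R : ℝ, 0 < R → ∃ C, ∀ᶠ i in U, (μs i (closedBall 0 R)).toReal ≤ C) :
    ∃ ν : Measure X, IsLocallyFiniteMeasure ν ∧
      ∀ f : X → ℝ, Continuous f → HasCompactSupport f →
        Tendsto (fun i => ∫ y, f y ∂(μs i)) U (𝓝 (∫ y, f y ∂ν)) := by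
  have hint : ∀ i (f : CompactlySupportedContinuousMap X ℝ), Integrable f (μs i) := fun i f =>
    f.continuous.integrable_of_hasCompactSupport f.hasCompactSupport
  have hlim : ∀ f : CompactlySupportedContinuousMap X ℝ, ∃ l, Tendsto (fun i => ∫ y, f y ∂(μs i)) U (𝓝 l) := by
    intro f
    obtain ⟨R, hR, hsub⟩ : ∃ R : ℝ, 0 < R ∧ tsupport f ⊆ closedBall 0 R := by
      obtain ⟨R, hR⟩ := f.hasCompactSupport.isCompact.isBounded.subset_closedBall 0
      exact ⟨max R 1, by positivity, hR.trans (closedBall_subset_closedBall (le_max_left _ _))⟩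
    obtain ⟨M, hM⟩ := f.hasCompactSupport.exists_bound_of_continuous f.continuous
    obtain ⟨C, hC⟩ := hb R hR
    refine ultra_lim U (C := |M| * C) ?_
    filter_upwards [hC] with i hi
    have h1 : ∫ y, f y ∂(μs i) = ∫ y in closedBall 0 R, f y ∂(μs i) := by
      rw [setIntegral_eq_integral_of_forall_compl_eq_zero]
      intro y hy
      exact image_eq_zero_of_notMem_tsupport fun h => hy (hsub h)
    have h2 := norm_setIntegral_le_of_norm_le_const (μ := μs i) (s := closedBall 0 R) (f := f) (C := |M|)
      measure_closedBall_lt_top (fun y _ => (hM y).trans (le_abs_self M))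
    rw [← h1, measureReal_def] at h2
    exact h2.trans (by gcongr)
  choose L hL using hlim
  have hadd : ∀ f g, L (f + g) = L f + L g := fun f g => by
    refine tendsto_nhds_unique (hL (f + g)) (((hL f).add (hL g)).congr fun i => ?_)
    rw [← integral_add (hint i f) (hint i g)]; rfl
  have hsmul : ∀ (c : ℝ) f, L (c • f) = c • L f := fun c f => by
    refine tendsto_nhds_unique (hL (c • f)) (((hL f).const_mul c).congr fun i => ?_)
    rw [← integral_const_mul]; rfl
  have hpos : ∀ f, 0 ≤ f → 0 ≤ L f := fun f hf =>
    ge_of_tendsto' (hL f) fun i => integral_nonneg fun y => hf y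
  let Λ : CompactlySupportedContinuousMap X ℝ →ₚ[ℝ] ℝ :=
    PositiveLinearMap.mk₀ { toFun := L, map_add' := hadd, map_smul' := hsmul } hpos
  refine ⟨RealRMK.rieszMeasure Λ, inferInstance, fun f hf hc => ?_⟩
  have := RealRMK.integral_rieszMeasure Λ ⟨⟨f, hf⟩, hc⟩
  have h2 := hL ⟨⟨f, hf⟩, hc⟩
  have h3 : ∫ y, f y ∂(RealRMK.rieszMeasure Λ) = L ⟨⟨f, hf⟩, hc⟩ := this
  rw [h3]; exact h2

lemma compactness (U : Ultrafilter α) (μs : α → Measure X) (hlf : ∀ i, IsLocallyFiniteMeasure (μs i))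
    (h0 : ∀ i, (0:X) ∈ Sp (μs i))
    (H : ∀ z : α → X, (∀ i, z i ∈ Sp (μs i)) → (∃ C, ∀ i, ‖z i‖ ≤ C) → ∀ r : ℝ, 0 < r →
      Tendsto (fun i => (μs i (closedBall (z i) r)).toReal) U (𝓝 (r^m))) :
    ∃ ν : Measure X, Unif m ν ∧ (0:X) ∈ Sp ν ∧
      (∀ f : X → ℝ, Continuous f → HasCompactSupport f →
        Tendsto (fun i => ∫ y, f y ∂(μs i)) U (𝓝 (∫ y, f y ∂ν))) ∧
      ∀ z, z ∈ Sp ν ↔ ∀ ε : ℝ, 0 < ε → ∀ᶠ i in U, ∃ z' ∈ Sp (μs i), ‖z' - z‖ ≤ ε := by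
  obtain ⟨ν, hν, hconv⟩ := riesz_limit U μs (fun R hR => ⟨R^m + 1, by
    have := H (fun _ => 0) h0 ⟨0, fun _ => by simp⟩ R hR
    exact (this.eventually (Iio_mem_nhds (by linarith : R^m < R^m+1))).mono fun i hi => le_of_lt hi⟩)
  have key : ∀ z, (∀ ε : ℝ, 0 < ε → ∀ᶠ i in U, ∃ z' ∈ Sp (μs i), ‖z' - z‖ ≤ ε) →
      ∀ r : ℝ, 0 < r → (ν (closedBall z r)).toReal = r^m := by
    intro z hz r hr
    have hex : ∀ i, ∃ z' ∈ Sp (μs i), infDist z (Sp (μs i)) = dist z z' := fun i =>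
      (Sp_closed (μs i)).exists_infDist_eq_dist ⟨0, h0 i⟩ z
    choose w hw hwd using hex
    have hwb : ∃ C, ∀ i, ‖w i‖ ≤ C := by
      refine ⟨2 * ‖z‖, fun i => ?_⟩
      have h1 : dist z (w i) ≤ dist z 0 := by rw [← hwd]; exact infDist_le_dist_of_mem (h0 i)
      rw [dist_zero_right, dist_comm, dist_eq_norm] at h1
      linarith [norm_sub_norm_le (w i) z]
    have hwz : ∀ ε : ℝ, 0 < ε → ∀ᶠ i in U, dist z (w i) ≤ ε := by
      intro ε hε
      filter_upwards [hz ε hε] with i ⟨z', hz', hd⟩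
      rw [← hwd]
      refine (infDist_le_dist_of_mem hz').trans ?_
      rwa [dist_comm, dist_eq_norm]
    apply le_antisymm
    · have h1 : ∀ ε : ℝ, 0 < ε → (ν (closedBall z r)).toReal ≤ (r + 2 * ε)^m := by
        intro ε hε
        refine (bump_lower ν z (by linarith : r < r + ε)).trans ?_
        refine le_of_tendsto_of_tendsto (hconv _ (bump_cont _ _ _) (bump_cs (by linarith)))
          (H w hw hwb (r + 2*ε) (by linarith)) ?_
        filter_upwards [hwz ε hε] with i hi
        refine (bump_upper (μs i) z (by linarith)).trans ?_
        apply ENNReal.toReal_mono measure_closedBall_lt_top.ne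
        exact measure_mono (closedBall_subset_closedBall' (by linarith))
      have h2 : Tendsto (fun ε : ℝ => (r + 2 * ε)^m) (𝓝[>] 0) (𝓝 (r^m)) := by
        apply tendsto_nhdsWithin_of_tendsto_nhds
        have : Continuous (fun ε : ℝ => (r + 2 * ε)^m) := by fun_prop
        simpa using this.tendsto 0
      refine ge_of_tendsto h2 ?_
      filter_upwards [self_mem_nhdsWithin] with ε hε using h1 ε hε
    · have h1 : ∀ ε : ℝ, 0 < ε → 2 * ε < r → (r - 2 * ε)^m ≤ (ν (closedBall z r)).toReal := by
        intro ε hε hr2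
        refine le_trans ?_ (bump_upper ν z (by linarith : r - ε < r))
        refine le_of_tendsto_of_tendsto 
          (H w hw hwb (r - 2*ε) (by linarith)) (hconv _ (bump_cont _ _ _) (bump_cs (by linarith))) ?_
        filter_upwards [hwz ε hε] with i hi
        refine le_trans ?_ (bump_lower (μs i) z (by linarith))
        apply ENNReal.toReal_mono measure_closedBall_lt_top.ne
        exact measure_mono (closedBall_subset_closedBall' (by rw [dist_comm]; linarith))
      have h2 : Tendsto (fun ε : ℝ => (r - 2 * ε)^m) (𝓝[>] 0) (𝓝 (r^m)) := by
        apply tendsto_nhdsWithin_of_tendsto_nhds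
        have : Continuous (fun ε : ℝ => (r - 2 * ε)^m) := by fun_prop
        simpa using this.tendsto 0
      refine le_of_tendsto h2 ?_
      have h3 : ∀ᶠ ε : ℝ in 𝓝[>] 0, ε < r / 2 :=
        tendsto_nhdsWithin_of_tendsto_nhds tendsto_id (Iio_mem_nhds (by linarith))
      filter_upwards [self_mem_nhdsWithin, h3] with ε hε h3 using h1 ε hε (by linarith)
  have hSp : ∀ z, z ∈ Sp ν ↔ ∀ ε : ℝ, 0 < ε → ∀ᶠ i in U, ∃ z' ∈ Sp (μs i), ‖z' - z‖ ≤ ε := by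
    intro z
    constructor
    · intro hz ε hε
      have h1 : 0 < ∫ y, bump z (ε/2) ε y ∂ν :=
        lt_of_lt_of_le (ENNReal.toReal_pos (hz (ε/2) (by linarith)).ne' measure_closedBall_lt_top.ne)
          (bump_lower ν z (by linarith))
      have h2 := (hconv _ (bump_cont z (ε/2) ε) (bump_cs (by linarith))).eventually (Ioi_mem_nhds h1)
      filter_upwards [h2] with i hi
      have h3 := lt_of_lt_of_le hi (bump_upper (μs i) z (by linarith))
      exact exists_mem_Sp (ENNReal.toReal_pos_iff.1 h3).1
    · intro hz r hr
      have := key z hz r hr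
      exact (ENNReal.toReal_pos_iff.1 (by rw [this]; positivity)).1
  refine ⟨ν, fun y hy r hr => ?_, (hSp 0).2 fun ε hε => ?_, hconv, hSp⟩
  · rw [← key y ((hSp y).1 hy) r hr, ENNReal.ofReal_toReal measure_closedBall_lt_top.ne]
  · exact Eventually.of_forall fun i => ⟨0, h0 i, by simpa using hε.le⟩

end compactness
end FT

namespace FT

section blow
variable {X : Type*} [NormedAddCommGroup X] [InnerProductSpace ℝ X] [FiniteDimensional ℝ X]
  [MeasurableSpace X] [BorelSpace X]

def blow (μ : Measure X) (x : X) (t c : ℝ) : Measure X :=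
  ENNReal.ofReal c • Measure.map (fun y => t⁻¹ • (y - x)) μ

lemma blow_ball (μ : Measure X) (x : X) {t : ℝ} (ht : 0 < t) (c : ℝ) (z : X) (r : ℝ) :
    blow μ x t c (closedBall z r) = ENNReal.ofReal c * μ (closedBall (x + t • z) (t * r)) := by
  unfold blow
  rw [Measure.smul_apply, Measure.map_apply (by fun_prop) isClosed_closedBall.measurableSet, smul_eq_mul]
  congr 2
  ext y
  simp only [mem_preimage, mem_closedBall, dist_eq_norm]
  have : t⁻¹ • (y - x) - z = t⁻¹ • (y - (x + t • z)) := by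
    rw [← sub_sub, smul_sub _ (y - x), inv_smul_smul₀ ht.ne']
  rw [this, norm_smul, Real.norm_of_nonneg (by positivity), inv_mul_le_iff₀ ht]

lemma blow_Sp (μ : Measure X) (x : X) {t : ℝ} (ht : 0 < t) {c : ℝ} (hc : 0 < c) (z : X) :
    z ∈ Sp (blow μ x t c) ↔ x + t • z ∈ Sp μ := by
  have hc' : ENNReal.ofReal c ≠ 0 := by simpa using hc
  constructor
  · intro h r hr
    have := h (t⁻¹ * r) (by positivity)
    rw [blow_ball μ x ht, mul_inv_cancel_left₀ ht.ne'] at this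
    exact pos_iff_ne_zero.2 (right_ne_zero_of_mul this.ne')
  · intro h r hr
    rw [blow_ball μ x ht]
    exact pos_iff_ne_zero.2 (mul_ne_zero hc' (h _ (by positivity)).ne')

lemma blow_locfin (μ : Measure X) [IsLocallyFiniteMeasure μ] (x : X) {t : ℝ} (ht : 0 < t) (c : ℝ) :
    IsLocallyFiniteMeasure (blow μ x t c) :=
  locfin_of_balls fun R _ => by
    rw [blow_ball μ x ht]
    exact ENNReal.mul_lt_top ENNReal.ofReal_lt_top measure_closedBall_lt_top

variable {m : ℕ} {ν : Measure X} {α : Type*}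

lemma blowdown (hU : Unif m ν) (h0 : (0:X) ∈ Sp ν) (U : Ultrafilter α) (R : α → ℝ) (hR : ∀ i, 0 < R i) :
    ∃ l : Measure X, Unif m l ∧ (0:X) ∈ Sp l ∧
      ∀ z, z ∈ Sp l ↔ ∀ ε : ℝ, 0 < ε → ∀ᶠ i in U, ∃ z', R i • z' ∈ Sp ν ∧ ‖z' - z‖ ≤ ε := by
  haveI := hU.locfin h0
  have hSp : ∀ i z, z ∈ Sp (blow ν 0 (R i) ((R i)^m)⁻¹) ↔ R i • z ∈ Sp ν := fun i z => by
    rw [blow_Sp ν 0 (hR i) (inv_pos.2 (pow_pos (hR i) m)), zero_add]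
  obtain ⟨l, h1, h2, _, h3⟩ := compactness (m := m) U (fun i => blow ν 0 (R i) ((R i)^m)⁻¹)
    (fun i => blow_locfin ν 0 (hR i) _) (fun i => by rw [hSp, smul_zero]; exact h0) (by
      intro z hz _ r hr
      refine tendsto_const_nhds.congr fun i => ?_
      have := (hSp i _).1 (hz i)
      have hp := pow_pos (hR i) m
      rw [blow_ball ν 0 (hR i), zero_add, hU _ this _ (mul_pos (hR i) hr), ← ENNReal.ofReal_mul (inv_pos.2 hp).le,
        ENNReal.toReal_ofReal (by have := hR i; positivity), mul_pow, inv_mul_cancel_left₀ hp.ne'])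
  refine ⟨l, h1, h2, fun z => ?_⟩
  rw [h3]
  simp only [hSp]

variable {ι : Type*} [Fintype ι]

def planeOf (e : OrthonormalBasis ι ℝ X) (P : Finset ι) : Submodule ℝ X :=
  Submodule.span ℝ (Set.range fun i : P => e i)

lemma planeOf_finrank (e : OrthonormalBasis ι ℝ X) (P : Finset ι) : finrank ℝ (planeOf e P) = P.card := by
  unfold planeOf
  rw [finrank_span_eq_card]
  · simp
  · exact e.toBasis.linearIndependent.comp (fun i : P => (i:ι)) Subtype.val_injective |> fun h => by
      simpa [Function.comp_def] using h

lemma mem_planeOf (e : OrthonormalBasis ι ℝ X) (P : Finset ι) (z : X) :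
    z ∈ planeOf e P ↔ ∀ p ∉ P, ⟪e p, z⟫ = 0 := by
  classical
  constructor
  · intro h p hp
    refine Submodule.span_induction (p := fun z _ => ⟪e p, z⟫ = 0) ?_ ?_ ?_ ?_ h
    · rintro _ ⟨i, rfl⟩
      have : p ≠ i := fun h => hp (h ▸ i.2)
      simp [e.inner_eq_ite, this]
    · simp
    · intro x y _ _ hx hy; rw [inner_add_right, hx, hy, add_zero]
    · intro a x _ hx; rw [inner_smul_right, hx, mul_zero]
  · intro h
    rw [← e.sum_repr' z]
    refine Submodule.sum_mem _ fun i _ => ?_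
    by_cases hi : i ∈ P
    · exact Submodule.smul_mem _ _ (Submodule.subset_span ⟨⟨i, hi⟩, rfl⟩)
    · rw [h i hi, zero_smul]; exact Submodule.zero_mem _

lemma growth (hU : Unif m ν) (h0 : (0:X) ∈ Sp ν) (e : OrthonormalBasis ι ℝ X) (P : Finset ι)
    (hP : P.card = m) {C : ℝ} (hC : ∀ x ∈ Sp ν, ∀ p ∉ P, ⟪e p, x⟫^2 ≤ C * ‖x‖) {u : X}
    (hu : u ∈ planeOf e P) :
    ∃ x : ℝ → X, (∀ R, x R ∈ Sp ν) ∧ Tendsto (fun R : ℝ => R⁻¹ • x R) atTop (𝓝 u) := by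
  have main : ∀ ε : ℝ, 0 < ε → ∀ᶠ R : ℝ in atTop, ∃ y ∈ Sp ν, ‖y - R • u‖ ≤ ε * R := by
    intro ε hε
    by_contra hc
    rw [not_eventually] at hc
    have hseq : ∀ k : ℕ, ∃ R : ℝ, (k:ℝ) + 1 ≤ R ∧ ¬ ∃ y ∈ Sp ν, ‖y - R • u‖ ≤ ε * R := fun k => by
      obtain ⟨R, h1, h2⟩ := (frequently_atTop.1 hc) ((k:ℝ)+1)
      exact ⟨R, h1, h2⟩
    choose R hR hbad using hseq
    have hRpos : ∀ k, 0 < R k := fun k => lt_of_lt_of_le (by positivity) (hR k)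
    obtain ⟨l, hl1, hl0, hl⟩ := blowdown hU h0 (hyperfilter ℕ) R hRpos
    have hRt : Tendsto R (hyperfilter ℕ) atTop := by
      have : Tendsto R atTop atTop := tendsto_atTop_mono (fun k => (by linarith [hR k] : (k:ℝ) ≤ R k))
        tendsto_natCast_atTop_atTop
      exact this.mono_left Nat.hyperfilter_le_atTop
    have hsub : Sp l ⊆ planeOf e P := by
      intro z hz
      rw [SetLike.mem_coe, mem_planeOf]
      intro p hp
      have hb : ∀ δ : ℝ, 0 < δ → |⟪e p, z⟫| ≤ 0 + δ := by
        intro δ hδ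
        have h1 := (hl z).1 hz (min 1 (δ/2)) (by positivity)
        have h2 : ∀ᶠ i in (hyperfilter ℕ : Filter ℕ), |C| * (‖z‖ + 1) / (δ/2)^2 < R i :=
          hRt.eventually (eventually_gt_atTop _)
        obtain ⟨i, ⟨z', hz', hd⟩, h3⟩ := (h1.and h2).exists
        have h4 := hC _ hz' p hp
        rw [inner_smul_right, mul_pow, norm_smul, Real.norm_of_nonneg (hRpos i).le] at h4
        have hi := hRpos i
        have hd1 : ‖z' - z‖ ≤ 1 := hd.trans (min_le_left _ _)
        have hd2 : ‖z' - z‖ ≤ δ/2 := hd.trans (min_le_right _ _)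
        have h5 : ‖z'‖ ≤ ‖z‖ + 1 := by linarith [norm_sub_norm_le z' z]
        rw [div_lt_iff₀ (by positivity)] at h3
        have h6 : ⟪e p, z'⟫^2 ≤ (δ/2)^2 := by
          have h7 : R i * (R i * ⟪e p, z'⟫^2) ≤ R i * (|C| * (‖z‖ + 1)) := by
            calc R i * (R i * ⟪e p, z'⟫^2) = R i ^2 * ⟪e p, z'⟫^2 := by ring
              _ ≤ C * (R i * ‖z'‖) := h4
              _ ≤ |C| * (R i * (‖z‖ + 1)) := by gcongr; exact le_abs_self C
              _ = _ := by ring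
          have h8 := le_of_mul_le_mul_left h7 hi
          have h9 : R i * ⟪e p, z'⟫^2 ≤ R i * (δ/2)^2 := h8.trans h3.le
          exact le_of_mul_le_mul_left h9 hi
        have h7 := abs_le_of_sq_le_sq h6 (by positivity)
        have h8 : |⟪e p, z' - z⟫| ≤ δ/2 := by
          refine (abs_real_inner_le_norm _ _).trans ?_
          rw [e.orthonormal.1 p, one_mul]; exact hd2
        rw [inner_sub_right] at h8
        have : |⟪e p, z⟫| ≤ |⟪e p, z'⟫| + |⟪e p, z'⟫ - ⟪e p, z⟫| := by
          have := abs_sub_abs_le_abs_sub ⟪e p, z⟫ ⟪e p, z'⟫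
          rw [abs_sub_comm] at this; linarith
        linarith
      exact abs_eq_zero.1 (le_antisymm (le_of_forall_pos_le_add hb) (abs_nonneg _))
    have heq := lemmaF hl1 hl0 (planeOf e P) (by rw [planeOf_finrank, hP]) hsub
    have hul : u ∈ Sp l := by rw [heq]; exact hu
    obtain ⟨i, z', hz', hd⟩ := ((hl u).1 hul ε hε).exists
    refine hbad i ⟨_, hz', ?_⟩
    rw [← smul_sub, norm_smul, Real.norm_of_nonneg (hRpos i).le, mul_comm]
    exact mul_le_mul_of_nonneg_right hd (hRpos i).le
  have hex : ∀ R : ℝ, ∃ z' ∈ Sp ν, infDist (R • u) (Sp ν) = dist (R • u) z' := fun R =>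
      (Sp_closed ν).exists_infDist_eq_dist ⟨0, h0⟩ _
  choose x hx hxd using hex
  refine ⟨x, hx, ?_⟩
  rw [tendsto_iff_dist_tendsto_zero, Metric.tendsto_nhds]
  intro ε hε
  filter_upwards [main (ε/2) (by positivity), eventually_gt_atTop 0] with R ⟨y, hy, hyd⟩ hR
  rw [Real.dist_0_eq_abs, abs_of_nonneg dist_nonneg, dist_eq_norm]
  have h1 : dist (R • u) (x R) ≤ ε / 2 * R := by
    rw [← hxd]; refine (infDist_le_dist_of_mem hy).trans ?_
    rwa [dist_comm, dist_eq_norm]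
  have h2 : R⁻¹ • x R - u = R⁻¹ • (x R - R • u) := by rw [smul_sub, inv_smul_smul₀ hR.ne']
  rw [dist_comm, dist_eq_norm] at h1
  rw [h2, norm_smul, Real.norm_of_nonneg (by positivity), inv_mul_lt_iff₀ hR]
  nlinarith

end blow
end FT

namespace FT

lemma closed_range {α J S : Type*} [Fintype J] (U : Filter α) [U.NeBot] (g : J → S → ℝ)
    (c : α → J → ℝ) (φ : S → ℝ) (h : ∀ s, Tendsto (fun t => ∑ j, c t j * g j s) U (𝓝 (φ s))) :
    ∃ c' : J → ℝ, ∀ s, φ s = ∑ j, c' j * g j s := by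
  let T : (J → ℝ) →ₗ[ℝ] (S → ℝ) := Fintype.linearCombination ℝ g
  have hT : ∀ c s, T c s = ∑ j, c j * g j s := fun c s => by
    simp [T, Fintype.linearCombination_apply, Finset.sum_apply]
  have hcl : IsClosed (LinearMap.range T : Set (S → ℝ)) := Submodule.closed_of_finiteDimensional _
  have hmem : φ ∈ (LinearMap.range T : Set (S → ℝ)) := by
    refine hcl.mem_of_tendsto (f := fun t => T (c t)) (b := U) ?_ (Eventually.of_forall fun t => ⟨c t, rfl⟩)
    rw [tendsto_pi_nhds]
    intro s
    simp only [hT]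
    exact h s
  obtain ⟨c', hc'⟩ := hmem
  exact ⟨c', fun s => by rw [← hc', hT]⟩

lemma exp_neg_bound {t : ℝ} (ht : 0 ≤ t) : |Real.exp (-t) - 1 + t| ≤ t^2 := by
  by_cases h : t ≤ 1
  · have := Real.abs_exp_sub_one_sub_id_le (x := -t) (by rw [abs_neg, abs_of_nonneg ht]; exact h)
    simpa using this
  · push Not at h
    have h1 := Real.add_one_le_exp (-t)
    have h2 : Real.exp (-t) ≤ 1 := Real.exp_le_one_iff.2 (by linarith)
    rw [abs_le]; constructor <;> nlinarith

lemma lemmaD {a b C : ℝ} {m : ℕ}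
    (h : ∀ h : ℝ, 0 < h → h ≤ 1 → |((1+h)^m)⁻¹ * a - a + (2*h + h^2) * b| ≤ C * h^2) :
    b = m / 2 * a := by
  have hd : HasDerivAt (fun h : ℝ => ((1+h)^m)⁻¹ * a - a + (2*h + h^2) * b) (-(m:ℝ) * a + 2 * b) 0 := by
    have h1 : HasDerivAt (fun h : ℝ => (1+h)^m) (m:ℝ) 0 := by
      simpa using ((hasDerivAt_id' (0:ℝ)).const_add 1).fun_pow m
    have h2 := ((h1.fun_inv (by simp)).mul_const a).sub_const a
    have h3 : HasDerivAt (fun h : ℝ => (2*h + h^2) * b) (2 * b) 0 := by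
      have := (((hasDerivAt_id' (0:ℝ)).const_mul 2).fun_add ((hasDerivAt_id' (0:ℝ)).fun_pow 2)).mul_const b
      simpa using this
    have := h2.fun_add h3
    simpa using this
  have h1 := hd.tendsto_slope_zero_right
  have h2 : Tendsto (fun t : ℝ => C * t) (𝓝[>] 0) (𝓝 0) := by
    apply tendsto_nhdsWithin_of_tendsto_nhds
    have : Continuous (fun t : ℝ => C * t) := by fun_prop
    simpa using this.tendsto 0
  have h3 : Tendsto (fun t : ℝ => t⁻¹ • ((fun h : ℝ => ((1+h)^m)⁻¹ * a - a + (2*h + h^2) * b) (0 + t) -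
      (fun h : ℝ => ((1+h)^m)⁻¹ * a - a + (2*h + h^2) * b) 0)) (𝓝[>] 0) (𝓝 0) := by
    refine squeeze_zero_norm' ?_ h2
    have h4 : ∀ᶠ t : ℝ in 𝓝[>] 0, t < 1 :=
      tendsto_nhdsWithin_of_tendsto_nhds tendsto_id (Iio_mem_nhds one_pos)
    filter_upwards [self_mem_nhdsWithin, h4] with t ht ht1
    have ht : 0 < t := ht
    have := h t ht ht1.le
    simp only [zero_add]
    rw [norm_smul, norm_inv, Real.norm_of_nonneg ht.le, inv_mul_le_iff₀ ht]
    simp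
    linarith
  have := tendsto_nhds_unique h1 h3
  linarith

section stage1
variable {X : Type*} [NormedAddCommGroup X] [InnerProductSpace ℝ X] [FiniteDimensional ℝ X]
  [MeasurableSpace X] [BorelSpace X]
variable {m : ℕ} {ν : Measure X}

lemma trace_lemma (hU : Unif m ν) (h0 : (0:X) ∈ Sp ν) (U : Filter ℝ) [U.NeBot] (hU0 : U ≤ 𝓝[>] 0)
    {f : X → ℝ} (hf : PG f) {A : ℝ} (hA : ∀ z ∈ Sp ν, |f z| ≤ A) {a b : ℝ}
    (ha : Tendsto (fun σ => ∫ z, f z ∂(GP ν σ)) (𝓝[>] 0) (𝓝 a))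
    (hb : Tendsto (fun σ => σ^2 * ∫ z, f z * ‖z‖^2 ∂(GP ν σ)) U (𝓝 b)) : b = m / 2 * a := by
  have hA0 : 0 ≤ A := (abs_nonneg _).trans (hA 0 h0)
  apply lemmaD (C := 9 * A * Ck ν 4)
  intro h hh hh1
  have hsc : Tendsto (fun σ : ℝ => (1+h) * σ) (𝓝[>] 0) (𝓝[>] 0) := by
    rw [tendsto_nhdsWithin_iff]
    constructor
    · apply tendsto_nhdsWithin_of_tendsto_nhds
      have : Continuous (fun σ : ℝ => (1+h) * σ) := by fun_prop
      simpa using this.tendsto 0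
    · filter_upwards [self_mem_nhdsWithin] with σ hσ
      have hσ : 0 < σ := hσ
      show 0 < (1+h) * σ
      positivity
  have h1 : Tendsto (fun σ => |((1+h)^m)⁻¹ * (∫ z, f z ∂(GP ν ((1+h)*σ))) - (∫ z, f z ∂(GP ν σ)) +
      (2*h+h^2) * (σ^2 * ∫ z, f z * ‖z‖^2 ∂(GP ν σ))|) U
      (𝓝 |((1+h)^m)⁻¹ * a - a + (2*h+h^2) * b|) :=
    (((((ha.comp hsc).mono_left hU0).const_mul _).sub (ha.mono_left hU0)).add (hb.const_mul _)).abs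
  refine le_of_tendsto h1 ?_
  filter_upwards [hU0 self_mem_nhdsWithin] with σ hσ
  have hσ : 0 < σ := hσ
  rw [← GP_shift hU h0 hσ (by linarith) f]
  have hη : 0 ≤ 2*h+h^2 := by positivity
  have i0 := hf.int hU h0 hσ
  have i1 : Integrable (fun z => f z * ‖z‖^2) (GP ν σ) := (hf.mul (PG.norm.pow 2)).int hU h0 hσ
  have i2 : Integrable (fun z => f z * Real.exp (-((2 * h + h^2) * (σ^2 * ‖z‖^2)))) (GP ν σ) := by
    refine i0.norm.mono' (by have := hf.1; fun_prop) (ae_of_all _ fun z => ?_)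
    rw [norm_mul, Real.norm_of_nonneg (Real.exp_pos _).le]
    exact mul_le_of_le_one_right (norm_nonneg _) (Real.exp_le_one_iff.2 (by
      have : 0 ≤ (2*h+h^2) * (σ^2 * ‖z‖^2) := by positivity
      linarith))
  have e : (∫ z, f z * Real.exp (-((2 * h + h^2) * (σ^2 * ‖z‖^2))) ∂(GP ν σ)) - (∫ z, f z ∂(GP ν σ)) +
      (2*h+h^2) * (σ^2 * ∫ z, f z * ‖z‖^2 ∂(GP ν σ)) =
      ∫ z, (f z * Real.exp (-((2 * h + h^2) * (σ^2 * ‖z‖^2))) - f z + ((2*h+h^2) * σ^2) * (f z * ‖z‖^2)) ∂(GP ν σ) := by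
    have i3 : Integrable (fun z => f z * Real.exp (-((2 * h + h^2) * (σ^2 * ‖z‖^2))) - f z) (GP ν σ) := i2.sub i0
    rw [integral_add i3 (i1.const_mul _), integral_sub i2 i0, integral_const_mul]; ring
  rw [e]
  have hbd := av_bound hU h0 hσ (k := 4) (C := A * ((2*h+h^2) * σ^2)^2) (f := fun z =>
    f z * Real.exp (-((2 * h + h^2) * (σ^2 * ‖z‖^2))) - f z + ((2*h+h^2) * σ^2) * (f z * ‖z‖^2)) (by
      intro z hz
      have e2 : f z * Real.exp (-((2 * h + h^2) * (σ^2 * ‖z‖^2))) - f z + ((2*h+h^2) * σ^2) * (f z * ‖z‖^2)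
        = f z * (Real.exp (-((2 * h + h^2) * (σ^2 * ‖z‖^2))) - 1 + (2 * h + h^2) * (σ^2 * ‖z‖^2)) := by ring
      rw [e2, abs_mul]
      have := exp_neg_bound (t := (2 * h + h^2) * (σ^2 * ‖z‖^2)) (by positivity)
      calc _ ≤ A * ((2 * h + h^2) * (σ^2 * ‖z‖^2))^2 := mul_le_mul (hA z hz) this (abs_nonneg _) hA0
        _ = _ := by ring)
  refine hbd.trans ?_
  have hC := Ck_nonneg ν 4
  calc A * ((2*h+h^2) * σ^2)^2 * (σ⁻¹^4 * Ck ν 4) = A * Ck ν 4 * (2*h+h^2)^2 := by field_simp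
    _ ≤ A * Ck ν 4 * (3*h)^2 := by gcongr; nlinarith
    _ = _ := by ring

lemma C2_eq (hU : Unif m ν) (h0 : (0:X) ∈ Sp ν) : Ck ν 2 = m / 2 := by
  have h1 : Tendsto (fun σ => ∫ z, (1:ℝ) ∂(GP ν σ)) (𝓝[>] 0) (𝓝 1) := by
    refine tendsto_const_nhds.congr' ?_
    filter_upwards [self_mem_nhdsWithin] with σ hσ
    haveI := GP_prob hU h0 hσ
    simp
  have h2 : Tendsto (fun σ => σ^2 * ∫ z, (1:ℝ) * ‖z‖^2 ∂(GP ν σ)) (𝓝[>] 0) (𝓝 (Ck ν 2)) := by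
    refine tendsto_const_nhds.congr' ?_
    filter_upwards [self_mem_nhdsWithin] with σ hσ
    have hσ : 0 < σ := hσ
    simp only [one_mul]
    rw [GP_moment hU h0 hσ, inv_pow]; field_simp
  have := trace_lemma hU h0 (𝓝[>] 0) le_rfl (PG.const 1) (A := 1) (by simp) h1 h2
  simpa using this

lemma stage1 (hU : Unif m ν) (h0 : (0:X) ∈ Sp ν) (U : Ultrafilter ℝ) (hU0 : (U : Filter ℝ) ≤ 𝓝[>] 0) :
    ∃ (e : OrthonormalBasis (Fin (finrank ℝ X)) ℝ X) (q : Fin (finrank ℝ X) → ℝ) (b : X),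
      (∀ i, 0 ≤ q i) ∧ ∑ i, q i = m ∧
      (∀ u, Tendsto (fun σ => 2 * σ^2 * ∫ z, ⟪u, z⟫^2 ∂(GP ν σ)) U (𝓝 (∑ i, q i * ⟪e i, u⟫^2))) ∧
      ∀ x ∈ Sp ν, ‖x‖^2 - ∑ i, q i * ⟪e i, x⟫^2 = ⟪b, x⟫ := by
  have hpos : ∀ᶠ σ in (U : Filter ℝ), 0 < σ := hU0 self_mem_nhdsWithin
  have hlim : ∀ u v : X, ∃ l, Tendsto (fun σ => 2 * (σ^2 * ∫ z, ⟪u, z⟫ * ⟪v, z⟫ ∂(GP ν σ))) U (𝓝 l) := by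
    intro u v
    refine ultra_lim U (C := 2 * (‖u‖ * ‖v‖ * Ck ν 2)) ?_
    filter_upwards [hpos] with σ hσ
    rw [abs_mul, abs_of_pos (by norm_num : (0:ℝ) < 2)]
    gcongr
    refine av_bound' hU h0 hσ fun z _ => ?_
    rw [abs_mul]
    calc |⟪u, z⟫| * |⟪v, z⟫| ≤ (‖u‖ * ‖z‖) * (‖v‖ * ‖z‖) :=
          mul_le_mul (abs_real_inner_le_norm _ _) (abs_real_inner_le_norm _ _) (abs_nonneg _) (by positivity)
      _ = _ := by ring
  choose B hB using hlim
  have hint : ∀ u v : X, ∀ σ : ℝ, 0 < σ → Integrable (fun z => ⟪u, z⟫ * ⟪v, z⟫) (GP ν σ) :=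
    fun u v σ hσ => ((PG.inner u).mul (PG.inner v)).int hU h0 hσ
  have hsymm : ∀ u v, B u v = B v u := fun u v => by
    refine tendsto_nhds_unique (hB u v) ((hB v u).congr fun σ => ?_)
    simp only [mul_comm]
  have hadd : ∀ u u' v, B (u + u') v = B u v + B u' v := fun u u' v => by
    refine tendsto_nhds_unique (hB (u+u') v) (((hB u v).add (hB u' v)).congr' ?_)
    filter_upwards [hpos] with σ hσ
    simp only [inner_add_left, add_mul]
    rw [integral_add (hint u v σ hσ) (hint u' v σ hσ)]; ring
  have hsmul : ∀ (c : ℝ) u v, B (c • u) v = c * B u v := fun c u v => by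
    refine tendsto_nhds_unique (hB (c • u) v) (((hB u v).const_mul c).congr fun σ => ?_)
    simp only [real_inner_smul_left, mul_assoc]
    rw [integral_const_mul]; ring
  let b0 := stdOrthonormalBasis ℝ X
  let T : X →ₗ[ℝ] X :=
    { toFun := fun u => ∑ j, B u (b0 j) • b0 j
      map_add' := fun u v => by simp only [hadd, add_smul, Finset.sum_add_distrib]
      map_smul' := fun c u => by simp only [hsmul, mul_smul, Finset.smul_sum, RingHom.id_apply] }
  have hadd' : ∀ u v v', B u (v + v') = B u v + B u v' := fun u v v' => by
    rw [hsymm, hadd, hsymm v, hsymm v']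
  have hsmul' : ∀ (c : ℝ) u v, B u (c • v) = c * B u v := fun c u v => by
    rw [hsymm, hsmul, hsymm v]
  have hTB : ∀ u v, ⟪T u, v⟫ = B u v := by
    intro u v
    let Bu : X →ₗ[ℝ] ℝ := { toFun := B u, map_add' := hadd' u, map_smul' := fun c v => hsmul' c u v }
    have h1 : B u v = Bu (∑ j, ⟪b0 j, v⟫ • b0 j) := by rw [b0.sum_repr' v]; rfl
    rw [h1, map_sum]
    show ⟪∑ j, B u (b0 j) • b0 j, v⟫ = _
    rw [sum_inner]
    refine Finset.sum_congr rfl fun j _ => ?_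
    rw [real_inner_smul_left, map_smul, smul_eq_mul, mul_comm]; rfl
  have hTs : T.IsSymmetric := fun u v => by
    rw [hTB, hsymm, ← hTB, real_inner_comm]
  let e := hTs.eigenvectorBasis rfl
  let q : Fin (finrank ℝ X) → ℝ := hTs.eigenvalues rfl
  have hTe : ∀ i, T (e i) = q i • e i := fun i => hTs.apply_eigenvectorBasis rfl i
  have hBxx : ∀ u, B u u = ∑ i, q i * ⟪e i, u⟫^2 := by
    intro u
    rw [← hTB]
    conv_lhs => rw [← e.sum_inner_mul_inner]
    refine Finset.sum_congr rfl fun i _ => ?_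
    rw [hTs u (e i), hTe, inner_smul_right, real_inner_comm]; ring
  have hBq : ∀ i, B (e i) (e i) = q i := fun i => by
    rw [← hTB, hTe, real_inner_smul_left, real_inner_self_eq_norm_sq, e.orthonormal.1 i]; simp
  have hQ : ∀ u, Tendsto (fun σ => 2 * σ^2 * ∫ z, ⟪u, z⟫^2 ∂(GP ν σ)) U (𝓝 (∑ i, q i * ⟪e i, u⟫^2)) := by
    intro u
    rw [← hBxx]
    refine (hB u u).congr fun σ => ?_
    simp only [pow_two]; ring
  have hq0 : ∀ i, 0 ≤ q i := fun i => by
    rw [← hBq]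
    refine ge_of_tendsto' (hB (e i) (e i)) fun σ => ?_
    have : 0 ≤ ∫ z, ⟪e i, z⟫ * ⟪e i, z⟫ ∂(GP ν σ) := integral_nonneg fun z => mul_self_nonneg _
    positivity
  have hqs : ∑ i, q i = m := by
    have h1 : Tendsto (fun σ => ∑ i, 2 * (σ^2 * ∫ z, ⟪e i, z⟫ * ⟪e i, z⟫ ∂(GP ν σ))) U (𝓝 (∑ i, B (e i) (e i))) :=
      tendsto_finsetSum _ fun i _ => hB (e i) (e i)
    simp only [hBq] at h1
    refine tendsto_nhds_unique h1 (tendsto_const_nhds.congr' ?_)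
    filter_upwards [hpos] with σ hσ
    rw [← Finset.mul_sum, ← Finset.mul_sum, ← integral_finsetSum _ (fun i _ => hint (e i) (e i) σ hσ)]
    have h2 : ∀ z, ∑ i, ⟪e i, z⟫ * ⟪e i, z⟫ = ‖z‖^2 := fun z => by
      rw [← e.sum_sq_inner_left z]
      simp only [pow_two]
      refine Finset.sum_congr rfl fun i _ => ?_
      rw [real_inner_comm]
    simp only [h2]
    rw [GP_moment hU h0 hσ, C2_eq hU h0, inv_pow]; field_simp
  obtain ⟨c', hc'⟩ := closed_range (U : Filter ℝ) (fun j (x : Sp ν) => ⟪e j, (x:X)⟫)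
    (fun σ j => 2 * ∫ z, ⟪e j, z⟫ ∂(GP ν σ)) (fun x : Sp ν => ‖(x:X)‖^2 - ∑ i, q i * ⟪e i, (x:X)⟫^2) (by
      rintro ⟨x, hx⟩
      have h1 := ((second_order hU h0 hx).mono_left hU0).sub (hQ x)
      have h2 := h1.add_const (‖x‖^2)
      have h3 : 0 - ∑ i, q i * ⟪e i, x⟫^2 + ‖x‖^2 = ‖x‖^2 - ∑ i, q i * ⟪e i, x⟫^2 := by ring
      rw [h3] at h2
      refine h2.congr' ?_
      filter_upwards [hpos] with σ hσ
      have h4 : ∫ z, ⟪x, z⟫ ∂(GP ν σ) = ∑ j, ⟪e j, x⟫ * ∫ z, ⟪e j, z⟫ ∂(GP ν σ) := by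
        simp only [← integral_const_mul]
        rw [← integral_finsetSum _ (fun j _ => ((PG.inner (e j)).cmul _).int hU h0 hσ)]
        congr 1; ext z
        rw [← e.sum_inner_mul_inner]
        refine Finset.sum_congr rfl fun j _ => ?_
        rw [real_inner_comm]
      have h5 : ∑ j, (2 * ∫ z, ⟪e j, z⟫ ∂(GP ν σ)) * ⟪e j, x⟫ = 2 * ∑ j, ⟪e j, x⟫ * ∫ z, ⟪e j, z⟫ ∂(GP ν σ) := by
        rw [Finset.mul_sum]; refine Finset.sum_congr rfl fun j _ => by ring
      rw [h5, ← h4]; ring)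
  refine ⟨e, q, ∑ j, c' j • e j, hq0, hqs, hQ, fun x hx => ?_⟩
  rw [hc' ⟨x, hx⟩, sum_inner]
  simp only [real_inner_smul_left]

end stage1
end FT

namespace FT

section alg
variable {X : Type*} [NormedAddCommGroup X] [InnerProductSpace ℝ X] [FiniteDimensional ℝ X]

/-- one-sided closeness to an m-plane at scale R -/
def Good (m : ℕ) (ε : ℝ) (S : Set X) (R : ℝ) : Prop :=
  ∃ v : Fin m → X, Orthonormal ℝ v ∧ ∀ w ∈ Submodule.span ℝ (range v), ‖w‖ ≤ 1 →
    ∃ x ∈ S, ‖x - R • w‖ ≤ ε * R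

def eps0 (m : ℕ) : ℝ := 1 / (512 * (m+1)^4)

lemma eps0_pos (m : ℕ) : 0 < eps0 m := by unfold eps0; positivity

variable {ι : Type*} [Fintype ι] {m : ℕ}

lemma alg1 (e : OrthonormalBasis ι ℝ X) (q : ι → ℝ) (hq : ∀ i, 0 ≤ q i) (hqs : ∑ i, q i = m)
    (v : Fin m → X) (hv : Orthonormal ℝ v) {η : ℝ} (hη : η ≤ eps0 m)
    (h : ∀ w ∈ Submodule.span ℝ (range v), ‖w‖ ≤ 1 →
      ∃ y, ‖y - w‖ ≤ eps0 m ∧ ‖y‖^2 - ∑ i, q i * ⟪e i, y⟫^2 ≤ η) :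
    (∃ P : Finset ι, P.card = m ∧ (∀ i, i ∈ P ↔ 1/2 < q i)) ∧
      ∀ i, 1/2 < q i → ∃ y, ‖y - e i‖ ≤ 1 / (4 * (m+1)) ∧ ‖y‖^2 - ∑ i, q i * ⟪e i, y⟫^2 ≤ η := by
  classical
  set ε := eps0 m with hε
  have hε0 : 0 < ε := eps0_pos m
  have hM : (1:ℝ) ≤ m + 1 := by have : (0:ℝ) ≤ m := Nat.cast_nonneg m; linarith
  set M : ℝ := m + 1 with hMdef
  have hεM : ε * (512 * M^4) = 1 := by
    rw [hε]; unfold eps0; rw [← hMdef]; field_simp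
  have hM4 : M ≤ M^4 := le_self_pow₀ hM (by norm_num)
  have hM2 : M^2 ≤ M^4 := pow_le_pow_right₀ hM (by norm_num)
  have hε1 : ε ≤ 1 := by nlinarith
  have hqm : ∀ i, q i ≤ m := fun i => by
    rw [← hqs]; exact Finset.single_le_sum (fun j _ => hq j) (Finset.mem_univ i)
  have hF : ∀ y, ‖y‖^2 - ∑ i, q i * ⟪e i, y⟫^2 = ∑ i, (1 - q i) * ⟪e i, y⟫^2 := fun y => by
    rw [← e.sum_sq_inner_right y, ← Finset.sum_sub_distrib]
    exact Finset.sum_congr rfl fun i _ => by ring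
  have hFV : ∀ w ∈ Submodule.span ℝ (range v), ‖w‖ ≤ 1 → ‖w‖^2 - ∑ i, q i * ⟪e i, w⟫^2 ≤ 4 * M * ε := by
    intro w hw hw1
    obtain ⟨y, hy, hFy⟩ := h w hw hw1
    rw [hF] at hFy ⊢
    have h1 : ∑ i, (1 - q i) * ⟪e i, w⟫^2 - ∑ i, (1 - q i) * ⟪e i, y⟫^2 =
        ∑ i, (1 - q i) * (⟪e i, w - y⟫ * ⟪e i, w + y⟫) := by
      rw [← Finset.sum_sub_distrib]
      refine Finset.sum_congr rfl fun i _ => ?_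
      rw [inner_sub_right, inner_add_right]; ring
    have h2 : ∑ i, (1 - q i) * (⟪e i, w - y⟫ * ⟪e i, w + y⟫) ≤ M * (∑ i, |⟪e i, w - y⟫| * |⟪e i, w + y⟫|) := by
      rw [Finset.mul_sum]
      refine Finset.sum_le_sum fun i _ => ?_
      rw [← abs_mul]
      refine (le_abs_self _).trans ?_
      rw [abs_mul]
      gcongr
      rw [abs_le]
      have := hqm i; have := hq i
      constructor <;> linarith
    have h3 : ∑ i, |⟪e i, w - y⟫| * |⟪e i, w + y⟫| ≤ ‖w - y‖ * ‖w + y‖ := by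
      have := Finset.sum_mul_sq_le_sq_mul_sq Finset.univ (fun i => |⟪e i, w - y⟫|) (fun i => |⟪e i, w + y⟫|)
      simp only [sq_abs] at this
      rw [e.sum_sq_inner_right, e.sum_sq_inner_right, ← mul_pow] at this
      exact (sq_le_sq₀ (by positivity) (by positivity)).1 this
    have h4 : ‖w - y‖ ≤ ε := by rw [norm_sub_rev]; exact hy
    have h5 : ‖w + y‖ ≤ 3 := by
      have : w + y = (y - w) + w + w := by abel
      rw [this]
      exact (norm_add₃_le).trans (by linarith)
    have h6 : ‖w - y‖ * ‖w + y‖ ≤ ε * 3 := mul_le_mul h4 h5 (norm_nonneg _) hε0.le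
    have h7 : M * (∑ i, |⟪e i, w - y⟫| * |⟪e i, w + y⟫|) ≤ M * (ε * 3) := by gcongr; linarith
    nlinarith
  have hvV : ∀ k, v k ∈ Submodule.span ℝ (range v) := fun k => Submodule.subset_span ⟨k, rfl⟩
  set p : ι → ℝ := fun i => ∑ k, ⟪v k, e i⟫^2 with hp
  set w : ι → X := fun i => ∑ k, ⟪v k, e i⟫ • v k with hw
  have hwV : ∀ i, w i ∈ Submodule.span ℝ (range v) := fun i =>
    Submodule.sum_mem _ fun k _ => Submodule.smul_mem _ _ (hvV k)
  have hwn : ∀ i, ‖w i‖^2 = p i := fun i => by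
    rw [← real_inner_self_eq_norm_sq, hw]
    simp only
    rw [hv.inner_sum]
    simp [hp, pow_two]
  have hwe : ∀ i, ⟪e i, w i⟫ = p i := fun i => by
    simp only [hw, inner_sum, real_inner_smul_right, hp]
    exact Finset.sum_congr rfl fun k _ => by rw [real_inner_comm]; ring
  have hdist : ∀ i, ‖w i - e i‖^2 = 1 - p i := fun i => by
    rw [norm_sub_sq_real, hwn, real_inner_comm, hwe, e.orthonormal.1 i]; ring
  have hp1 : ∀ i, p i ≤ 1 := fun i => by have := hdist i; nlinarith [sq_nonneg ‖w i - e i‖]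
  have hp0 : ∀ i, 0 ≤ p i := fun i => Finset.sum_nonneg fun _ _ => sq_nonneg _
  have hps : ∑ i, p i = m := by
    rw [hp, Finset.sum_comm]
    have : ∀ k, ∑ i, ⟪v k, e i⟫^2 = 1 := fun k => by
      rw [e.sum_sq_inner_left, hv.1 k]; norm_num
    simp [this]
  have hsum : ∑ i, q i * (1 - p i) ≤ m * (4 * M * ε) := by
    have h1 : ∑ k, (‖v k‖^2 - ∑ i, q i * ⟪e i, v k⟫^2) ≤ ∑ k : Fin m, 4 * M * ε :=
      Finset.sum_le_sum fun k _ => hFV _ (hvV k) (hv.1 k).le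
    rw [Finset.sum_sub_distrib, Finset.sum_comm] at h1
    simp only [hv.1, ← Finset.mul_sum] at h1
    have h2 : ∀ i, ∑ k, ⟪e i, v k⟫^2 = p i := fun i =>
      Finset.sum_congr rfl fun k _ => by rw [real_inner_comm]
    simp only [h2, one_pow, Finset.sum_const, Finset.card_univ, Fintype.card_fin, nsmul_eq_mul, mul_one] at h1
    simp only [mul_sub, mul_one, Finset.sum_sub_distrib, hqs]
    linarith
  have hmM : (m:ℝ) ≤ M := by linarith
  have hqp : ∀ i, q i * (1 - p i) ≤ 4 * M^2 * ε := fun i => by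
    have h1 : q i * (1 - p i) ≤ ∑ i, q i * (1 - p i) :=
      Finset.single_le_sum (f := fun i => q i * (1 - p i))
        (fun j _ => mul_nonneg (hq j) (by have := hp1 j; linarith)) (Finset.mem_univ i)
    have h2 : m * (4 * M * ε) ≤ M * (4 * M * ε) := by gcongr
    nlinarith
  refine ⟨⟨Finset.univ.filter (fun i => 1/2 < q i), ?_, by simp⟩, ?_⟩
  · set P := Finset.univ.filter (fun i => 1/2 < q i) with hP
    have hle : P.card < m + 1 := by
      have h1 : ∑ i ∈ P, (1 - p i) ≤ ∑ i ∈ P, 2 * (q i * (1 - p i)) := by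
        refine Finset.sum_le_sum fun i hi => ?_
        have : 1/2 < q i := by simpa [hP] using hi
        have := hp1 i
        nlinarith
      have h2 : ∑ i ∈ P, 2 * (q i * (1 - p i)) ≤ ∑ i, 2 * (q i * (1 - p i)) :=
        Finset.sum_le_sum_of_subset_of_nonneg (Finset.subset_univ _) fun j _ _ =>
          mul_nonneg two_pos.le (mul_nonneg (hq j) (by have := hp1 j; linarith))
      have h3 : ∑ i ∈ P, p i ≤ ∑ i, p i :=
        Finset.sum_le_sum_of_subset_of_nonneg (Finset.subset_univ _) fun j _ _ => hp0 j
      rw [← Finset.mul_sum Finset.univ] at h2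
      rw [Finset.sum_sub_distrib] at h1
      simp only [Finset.sum_const, nsmul_eq_mul, mul_one] at h1
      have h4 : m * (4 * M * ε) ≤ M * (4 * M * ε) := by gcongr
      have h5 : (P.card : ℝ) < m + 1 := by nlinarith
      exact_mod_cast h5
    have hge : ¬ P.card < m := by
      intro hlt
      let T : Submodule.span ℝ (range v) →ₗ[ℝ] (P → ℝ) :=
        LinearMap.pi fun i => (innerₛₗ ℝ (e i)) ∘ₗ Submodule.subtype _
      have hker : LinearMap.ker T ≠ ⊥ := by
        apply LinearMap.ker_ne_bot_of_finrank_lt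
        rw [finrank_span_eq_card hv.linearIndependent]
        simpa using hlt
      obtain ⟨u, hu, hu0⟩ := (Submodule.ne_bot_iff _).1 hker
      have hu0' : (u : X) ≠ 0 := by simpa using hu0
      have huP : ∀ i ∈ P, ⟪e i, (u:X)⟫ = 0 := fun i hi => by
        have := congrFun (LinearMap.mem_ker.1 hu) ⟨i, hi⟩
        simpa [T] using this
      set c := ‖(u:X)‖⁻¹
      have hcn : ‖c • (u:X)‖ = 1 := by
        rw [norm_smul, norm_inv, norm_norm]; exact inv_mul_cancel₀ (by simpa using hu0')
      have h1 := hFV (c • (u:X)) (Submodule.smul_mem _ _ u.2) hcn.le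
      have h2 : ∑ i, q i * ⟪e i, c • (u:X)⟫^2 ≤ ∑ i, 1/2 * ⟪e i, c • (u:X)⟫^2 := by
        refine Finset.sum_le_sum fun i _ => ?_
        by_cases hi : i ∈ P
        · simp [real_inner_smul_right, huP i hi]
        · have : q i ≤ 1/2 := by simpa [hP] using hi
          gcongr
      rw [← Finset.mul_sum, e.sum_sq_inner_right, hcn] at h2
      rw [hcn] at h1
      nlinarith
    omega
  · intro i hi
    have hw1 : ‖w i‖ ≤ 1 := by
      have := hp1 i
      rw [← hwn] at this
      exact (sq_le_one_iff₀ (norm_nonneg _)).1 this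
    obtain ⟨y, hy, hFy⟩ := h (w i) (hwV i) hw1
    refine ⟨y, ?_, hFy⟩
    have h1 : ‖w i - e i‖ ≤ 1 / (8 * M) := by
      have h2 : ‖w i - e i‖^2 ≤ (1 / (8 * M))^2 := by
        rw [hdist]
        have h3 := hqp i
        have h4 : 1 - p i ≤ 8 * M^2 * ε := by have := hp1 i; nlinarith
        have h5 : 8 * M^2 * ε = (1 / (8 * M))^2 := by
          have : ε = 1 / (512 * M^4) := by field_simp; linarith
          rw [this]; field_simp; norm_num
        linarith
      exact (sq_le_sq₀ (by positivity) (by positivity)).1 h2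
    have h2 : ε ≤ 1 / (8 * M) := by
      rw [le_div_iff₀ (by positivity)]; nlinarith
    have h3 : y - e i = (y - w i) + (w i - e i) := by abel
    rw [h3]
    refine (norm_add_le _ _).trans ?_
    have : 1 / (4 * M) = 1 / (8 * M) + 1 / (8 * M) := by field_simp; norm_num
    linarith

lemma alg2 (e : OrthonormalBasis ι ℝ X) (q : ι → ℝ) (hq : ∀ i, 0 ≤ q i) (hqs : ∑ i, q i = m)
    (b : X) (S : Set X) (hS : ∀ x ∈ S, ‖x‖^2 - ∑ i, q i * ⟪e i, x⟫^2 = ⟪b, x⟫)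
    (hG : ∀ R₀ : ℝ, ∃ R > R₀, Good m (eps0 m) S R) :
    ∃ P : Finset ι, P.card = m ∧ (∀ i ∈ P, q i = 1) ∧ ∀ i ∉ P, q i = 0 := by
  classical
  have key : ∀ η > 0, ∃ v : Fin m → X, Orthonormal ℝ v ∧ ∀ w ∈ Submodule.span ℝ (range v), ‖w‖ ≤ 1 →
      ∃ y, ‖y - w‖ ≤ eps0 m ∧ ‖y‖^2 - ∑ i, q i * ⟪e i, y⟫^2 ≤ η := by
    intro η hη
    obtain ⟨R, hR, v, hv, h⟩ := hG (max 1 (‖b‖ * (1 + eps0 m) / η))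
    have hR1 : 1 < R := (le_max_left _ _).trans_lt hR
    have hR0 : 0 < R := by linarith
    have hR2 : ‖b‖ * (1 + eps0 m) < R * η := (div_lt_iff₀ hη).1 ((le_max_right _ _).trans_lt hR)
    refine ⟨v, hv, fun w hw hw1 => ?_⟩
    obtain ⟨x, hx, hxw⟩ := h w hw hw1
    have h1 : ‖R⁻¹ • x - w‖ ≤ eps0 m := by
      have : R⁻¹ • x - w = R⁻¹ • (x - R • w) := by
        rw [smul_sub, smul_smul, inv_mul_cancel₀ hR0.ne', one_smul]
      rw [this, norm_smul, norm_inv, Real.norm_of_nonneg hR0.le, inv_mul_le_iff₀ hR0]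
      linarith
    refine ⟨R⁻¹ • x, h1, ?_⟩
    have h2 : ‖R⁻¹ • x‖ ≤ 1 + eps0 m := by
      have : R⁻¹ • x = (R⁻¹ • x - w) + w := by abel
      rw [this]; exact (norm_add_le _ _).trans (by linarith)
    have h3 : ‖R⁻¹ • x‖^2 - ∑ i, q i * ⟪e i, R⁻¹ • x⟫^2 = R⁻¹ * ⟪b, R⁻¹ • x⟫ := by
      rw [real_inner_smul_right, ← hS x hx, norm_smul, norm_inv, Real.norm_of_nonneg hR0.le]
      simp only [real_inner_smul_right, mul_sub, Finset.mul_sum]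
      rw [mul_pow, pow_two R⁻¹, mul_assoc]
      congr 1
      exact Finset.sum_congr rfl fun i _ => by ring
    rw [h3, inv_mul_le_iff₀ hR0]
    calc ⟪b, R⁻¹ • x⟫ ≤ ‖b‖ * ‖R⁻¹ • x‖ := real_inner_le_norm _ _
      _ ≤ ‖b‖ * (1 + eps0 m) := by gcongr
      _ ≤ _ := hR2.le
  obtain ⟨v, hv, h⟩ := key _ (eps0_pos m)
  obtain ⟨⟨P, hPc, hP⟩, -⟩ := alg1 e q hq hqs v hv le_rfl h
  have hPf : 0 ≤ ∑ i ∈ P, (1 - q i) := by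
    rw [Finset.sum_sub_distrib]
    simp only [Finset.sum_const, nsmul_eq_mul, mul_one, hPc]
    have : ∑ i ∈ P, q i ≤ ∑ i, q i :=
      Finset.sum_le_sum_of_subset_of_nonneg (Finset.subset_univ _) fun j _ _ => hq j
    linarith
  have hneg : ∀ i ∈ P, 1 - q i ≤ 0 := by
    by_contra hcon
    push Not at hcon
    obtain ⟨i0, hi0, hi0'⟩ := hcon
    obtain ⟨s, hs, hmax⟩ := P.exists_max_image (fun i => 1 - q i) ⟨i0, hi0⟩
    set β := 1 - q s with hβ
    have hβ0 : 0 < β := hi0'.trans_le (hmax i0 hi0)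
    have hlow : ∀ j ∈ P, -(m * β) ≤ 1 - q j := by
      intro j hj
      have h1 : ∑ i ∈ P, (1 - q i) = (1 - q j) + ∑ i ∈ P.erase j, (1 - q i) :=
        (Finset.add_sum_erase P _ hj).symm
      have h2 : ∑ i ∈ P.erase j, (1 - q i) ≤ ∑ i ∈ P.erase j, β :=
        Finset.sum_le_sum fun i hi => hmax i (Finset.mem_of_mem_erase hi)
      have h3 : ∑ i ∈ P.erase j, β ≤ ∑ i ∈ P, β :=
        Finset.sum_le_sum_of_subset_of_nonneg (Finset.erase_subset _ _) fun _ _ _ => hβ0.le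
      simp only [Finset.sum_const, nsmul_eq_mul, hPc] at h3
      simp only [Finset.sum_const, nsmul_eq_mul] at h2
      linarith
    obtain ⟨v, hv, h⟩ := key (min (eps0 m) (β/4)) (lt_min (eps0_pos m) (by positivity))
    obtain ⟨-, hy⟩ := alg1 e q hq hqs v hv (min_le_left _ _) h
    obtain ⟨y, hy1, hy2⟩ := hy s ((hP s).1 hs)
    have hy2 : ‖y‖^2 - ∑ i, q i * ⟪e i, y⟫^2 ≤ β / 4 := hy2.trans (min_le_right _ _)
    have hM : (0:ℝ) ≤ m := Nat.cast_nonneg m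
    set d : ℝ := 1 / (4 * (m+1)) with hd
    have hd0 : 0 < d := by positivity
    have hdm : d * (4 * (m+1)) = 1 := by rw [hd]; field_simp
    have hd1 : d ≤ 1/4 := by nlinarith
    have hmd : m * d ≤ 1/4 := by nlinarith
    have hsumsq : ∑ i, ⟪e i, y - e s⟫^2 ≤ d^2 := by
      rw [e.sum_sq_inner_right]; gcongr
    have hys : ⟪e s, y - e s⟫^2 ≤ d^2 :=
      (Finset.single_le_sum (f := fun i => ⟪e i, y - e s⟫^2) (fun _ _ => sq_nonneg _) (Finset.mem_univ s)).trans hsumsq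
    have hys1 : 3/4 ≤ ⟪e s, y⟫ := by
      have h1 := abs_le_of_sq_le_sq hys hd0.le
      rw [inner_sub_right, real_inner_self_eq_norm_sq, e.orthonormal.1 s] at h1
      have := (abs_le.1 h1).1
      linarith
    have hF : ‖y‖^2 - ∑ i, q i * ⟪e i, y⟫^2 = ∑ i, (1 - q i) * ⟪e i, y⟫^2 := by
      rw [← e.sum_sq_inner_right y, ← Finset.sum_sub_distrib]
      exact Finset.sum_congr rfl fun i _ => by ring
    have hlb : β * ⟪e s, y⟫^2 - m * β * ∑ i, ⟪e i, y - e s⟫^2 ≤ ∑ i, (1 - q i) * ⟪e i, y⟫^2 := by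
      have e1 : β * ⟪e s, y⟫^2 = ∑ i, if i = s then β * ⟪e s, y⟫^2 else 0 := by simp
      rw [e1, Finset.mul_sum, ← Finset.sum_sub_distrib]
      refine Finset.sum_le_sum fun i _ => ?_
      by_cases his : i = s
      · subst his
        simp only [if_true]
        have : 0 ≤ m * β * ⟪e i, y - e i⟫^2 := by positivity
        linarith
      · simp only [his, if_false, zero_sub]
        have e2 : ⟪e i, y - e s⟫ = ⟪e i, y⟫ := by
          rw [inner_sub_right, e.orthonormal.2 his, sub_zero]
        rw [e2]
        have e3 : -(m * β) ≤ 1 - q i := by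
          by_cases hi : i ∈ P
          · exact hlow i hi
          · have := (hP i).not.1 hi
            push Not at this
            have : 0 ≤ m * β := by positivity
            linarith
        have := mul_le_mul_of_nonneg_right e3 (sq_nonneg ⟪e i, y⟫)
        linarith
    have h1 : m * β * ∑ i, ⟪e i, y - e s⟫^2 ≤ m * β * d^2 := by gcongr
    have h2 : m * β * d^2 ≤ β * (1/16) := by
      have : m * β * d^2 = β * ((m*d)*d) := by ring
      rw [this]; gcongr; nlinarith
    have h3 : β * (9/16) ≤ β * ⟪e s, y⟫^2 := by gcongr; nlinarith
    linarith
  have hz : ∀ i ∈ P, 1 - q i = 0 := by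
    refine (Finset.sum_eq_zero_iff_of_nonpos hneg).1 (le_antisymm (Finset.sum_nonpos hneg) hPf)
  refine ⟨P, hPc, fun i hi => ?_, fun i hi => ?_⟩

  · linarith [hz i hi]
  · have h1 : ∑ i ∈ P, q i = m := by
      rw [Finset.sum_congr rfl fun i hi => show q i = 1 by linarith [hz i hi]]
      simp [hPc]
    have h2 := Finset.sum_add_sum_compl P q
    have h3 : ∑ i ∈ Pᶜ, q i = 0 := by linarith
    exact (Finset.sum_eq_zero_iff_of_nonneg (fun j _ => hq j)).1 h3 i (by simpa using hi)

end alg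
end FT

namespace FT

section stage2
variable {X : Type*} [NormedAddCommGroup X] [InnerProductSpace ℝ X] [FiniteDimensional ℝ X]
  [MeasurableSpace X] [BorelSpace X]
variable {m : ℕ} {ν : Measure X} {ι : Type*} [Fintype ι]

open scoped Classical in
def ac (e : OrthonormalBasis ι ℝ X) (P : Finset ι) (i : ι) : X := if i ∈ P then e i else 0
open scoped Classical in
def cc (e : OrthonormalBasis ι ℝ X) (P : Finset ι) (i : ι) : X := if i ∈ P then 0 else e i

variable (e : OrthonormalBasis ι ℝ X) (P : Finset ι)

lemma ac_add_cc (i : ι) : ac e P i + cc e P i = e i := by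
  unfold ac cc; split_ifs <;> simp

lemma inner_ac_add (i : ι) (z : X) : ⟪e i, z⟫ = ⟪ac e P i, z⟫ + ⟪cc e P i, z⟫ := by
  rw [← inner_add_left, ac_add_cc]

lemma ac_mul_cc (i : ι) (z y : X) : ⟪ac e P i, z⟫ * ⟪cc e P i, y⟫ = 0 := by
  unfold ac cc; split_ifs <;> simp

lemma norm_ac_le (i : ι) : ‖ac e P i‖ ≤ 1 := by
  unfold ac; split_ifs <;> simp

lemma norm_cc_le (i : ι) : ‖cc e P i‖ ≤ 1 := by
  unfold cc; split_ifs <;> simp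

lemma ac_mem (i : ι) : ac e P i ∈ planeOf e P := by
  unfold ac; split_ifs with h
  · exact Submodule.subset_span ⟨⟨i, h⟩, rfl⟩
  · exact Submodule.zero_mem _

lemma inner_ac_cc (i j : ι) : ⟪ac e P i, cc e P j⟫ = 0 := by
  unfold ac cc
  by_cases h1 : i ∈ P <;> by_cases h2 : j ∈ P <;> simp [h1, h2]
  exact e.orthonormal.2 (fun h => h2 (h ▸ h1))

open scoped Classical in
lemma inner_ac_ac (i j : ι) : ⟪ac e P i, ac e P j⟫ = if i = j ∧ i ∈ P then 1 else 0 := by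
  unfold ac
  by_cases hij : i = j
  · subst hij
    by_cases h : i ∈ P <;> simp [h]
  · by_cases h : i ∈ P <;> by_cases h' : j ∈ P <;> simp [h, h', hij, e.orthonormal.2 hij]

lemma inner_split (x z : X) : ⟪x, z⟫ = ∑ i, ⟪ac e P i, x⟫ * ⟪ac e P i, z⟫ + ∑ i, ⟪cc e P i, x⟫ * ⟪cc e P i, z⟫ := by
  rw [← e.sum_inner_mul_inner, ← Finset.sum_add_distrib]
  refine Finset.sum_congr rfl fun i _ => ?_
  rw [real_inner_comm, inner_ac_add e P i x, inner_ac_add e P i z]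
  have h1 := ac_mul_cc e P i x z
  have h2 := ac_mul_cc e P i z x
  linear_combination h1 + h2

lemma norm_split (x : X) : ‖x‖^2 = ∑ i, ⟪ac e P i, x⟫^2 + ∑ i, ⟪cc e P i, x⟫^2 := by
  rw [← real_inner_self_eq_norm_sq, inner_split e P]
  simp only [pow_two]

/-- projections -/
def wp (x : X) : X := ∑ i, ⟪ac e P i, x⟫ • ac e P i
def vp (x : X) : X := ∑ i, ⟪cc e P i, x⟫ • cc e P i

lemma wp_mem (x : X) : wp e P x ∈ planeOf e P :=
  Submodule.sum_mem _ fun i _ => Submodule.smul_mem _ _ (ac_mem e P i)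

lemma inner_wp (x z : X) : ⟪wp e P x, z⟫ = ∑ i, ⟪ac e P i, x⟫ * ⟪ac e P i, z⟫ := by
  unfold wp; rw [sum_inner]; simp only [real_inner_smul_left]

lemma inner_vp (x z : X) : ⟪vp e P x, z⟫ = ∑ i, ⟪cc e P i, x⟫ * ⟪cc e P i, z⟫ := by
  unfold vp; rw [sum_inner]; simp only [real_inner_smul_left]

lemma wp_add_vp (x : X) : wp e P x + vp e P x = x := by
  apply ext_inner_right ℝ
  intro z
  rw [inner_add_left, inner_wp, inner_vp, ← inner_split]

lemma inner_wp_vp (x y : X) : ⟪wp e P x, vp e P y⟫ = 0 := by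
  unfold wp vp
  rw [sum_inner]
  refine Finset.sum_eq_zero fun i _ => ?_
  rw [inner_sum]
  refine Finset.sum_eq_zero fun j _ => ?_
  rw [real_inner_smul_left, real_inner_smul_right, inner_ac_cc]; simp

lemma ac_wp (i : ι) (x : X) : ⟪ac e P i, wp e P x⟫ = ⟪ac e P i, x⟫ := by
  conv_rhs => rw [← wp_add_vp e P x, inner_add_right]
  have : ⟪ac e P i, vp e P x⟫ = 0 := by
    unfold vp; rw [inner_sum]
    exact Finset.sum_eq_zero fun j _ => by rw [real_inner_smul_right, inner_ac_cc]; simp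
  rw [this, add_zero]

lemma cc_wp (i : ι) (x : X) : ⟪cc e P i, wp e P x⟫ = 0 := by
  unfold wp; rw [inner_sum]
  exact Finset.sum_eq_zero fun j _ => by
    rw [real_inner_smul_right, real_inner_comm (ac e P j), inner_ac_cc]; simp

lemma norm_wp (x : X) : ‖wp e P x‖^2 = ∑ i, ⟪ac e P i, x⟫^2 := by
  rw [norm_split e P]; simp [ac_wp, cc_wp]

lemma norm_vp (x : X) : ‖vp e P x‖^2 = ∑ i, ⟪cc e P i, x⟫^2 := by
  have h1 := norm_split e P x
  have h2 : ‖x‖^2 = ‖wp e P x‖^2 + ‖vp e P x‖^2 := by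
    conv_lhs => rw [← wp_add_vp e P x]
    rw [norm_add_sq_real, inner_wp_vp]; ring
  rw [norm_wp] at h2; linarith

lemma norm_wp_le (x : X) : ‖wp e P x‖ ≤ ‖x‖ := by
  have h1 := norm_split e P x
  rw [← norm_wp, ← norm_vp] at h1
  exact (sq_le_sq₀ (norm_nonneg _) (norm_nonneg _)).1 (by nlinarith [sq_nonneg ‖vp e P x‖])

lemma wp_of_mem {u : X} (hu : u ∈ planeOf e P) : wp e P u = u := by
  have : ∀ i, ⟪cc e P i, u⟫ = 0 := fun i => by
    unfold cc; split_ifs with h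
    · simp
    · exact (mem_planeOf e P u).1 hu i h
  conv_rhs => rw [← wp_add_vp e P u]
  unfold vp; simp [this]

structure Str (m : ℕ) (ν : Measure X) (e : OrthonormalBasis ι ℝ X) (P : Finset ι) (b : X) : Prop where
  card : P.card = m
  unif : Unif m ν
  zero : (0:X) ∈ Sp ν
  hv : ∀ x ∈ Sp ν, ‖vp e P x‖^2 = ⟪b, x⟫
  hspan : b ∈ Submodule.span ℝ (Sp ν)

variable {e P} {b : X}

lemma Str.growth (h : Str m ν e P b) {u : X} (hu : u ∈ planeOf e P) :
    ∃ x : ℝ → X, (∀ R, x R ∈ Sp ν) ∧ Tendsto (fun R => R⁻¹ • x R) atTop (𝓝 u) := by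
  refine FT.growth h.unif h.zero e P h.card (C := ‖b‖) ?_ hu
  intro x hx p hp
  have h1 : ⟪e p, x⟫^2 ≤ ‖vp e P x‖^2 := by
    rw [norm_vp]
    have : ⟪e p, x⟫ = ⟪cc e P p, x⟫ := by unfold cc; simp [hp]
    rw [this]
    exact Finset.single_le_sum (f := fun i => ⟪cc e P i, x⟫^2) (fun _ _ => sq_nonneg _) (Finset.mem_univ p)
  rw [h.hv x hx] at h1
  exact h1.trans (real_inner_le_norm _ _)

lemma Str.b_perp (h : Str m ν e P b) {u : X} (hu : u ∈ planeOf e P) : ⟪b, u⟫ = 0 := by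
  have key : ∀ u ∈ planeOf e P, 0 ≤ ⟪b, u⟫ := by
    intro u hu
    obtain ⟨x, hx, hlim⟩ := h.growth hu
    have h1 : Tendsto (fun R : ℝ => ⟪b, R⁻¹ • x R⟫) atTop (𝓝 ⟪b, u⟫) := tendsto_const_nhds.inner hlim
    refine ge_of_tendsto h1 ?_
    filter_upwards [eventually_gt_atTop 0] with R hR
    rw [real_inner_smul_right, ← h.hv _ (hx R)]
    positivity
  have h1 := key u hu
  have h2 := key (-u) (Submodule.neg_mem _ hu)
  rw [inner_neg_right] at h2
  linarith

lemma Str.inner_b (h : Str m ν e P b) (x : X) : ⟪b, vp e P x⟫ = ⟪b, x⟫ := by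
  conv_rhs => rw [← wp_add_vp e P x, inner_add_right, h.b_perp (wp_mem e P x), zero_add]

lemma Str.vp_bound (h : Str m ν e P b) {x : X} (hx : x ∈ Sp ν) : ‖vp e P x‖ ≤ ‖b‖ := by
  have h1 := h.hv x hx
  rw [← h.inner_b] at h1
  have h2 := real_inner_le_norm b (vp e P x)
  by_contra hc
  push Not at hc
  nlinarith [norm_nonneg b, norm_nonneg (vp e P x)]

lemma Str.cc_bound (h : Str m ν e P b) {x : X} (hx : x ∈ Sp ν) (i : ι) : |⟪cc e P i, x⟫| ≤ ‖b‖ := by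
  refine le_trans ?_ (h.vp_bound hx)
  refine abs_le_of_sq_le_sq ?_ (norm_nonneg _)
  rw [norm_vp]
  exact Finset.single_le_sum (f := fun i => ⟪cc e P i, x⟫^2) (fun _ _ => sq_nonneg _) (Finset.mem_univ i)

lemma Str.inner_vp_bound (h : Str m ν e P b) (y : X) {x : X} (hx : x ∈ Sp ν) : |⟪vp e P y, x⟫| ≤ ‖vp e P y‖ * ‖b‖ := by
  have : ⟪vp e P y, x⟫ = ⟪vp e P y, vp e P x⟫ := by
    conv_lhs => rw [← wp_add_vp e P x, inner_add_right, real_inner_comm, inner_wp_vp, zero_add]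
  rw [this]
  exact (abs_real_inner_le_norm _ _).trans (by gcongr; exact h.vp_bound hx)

/-- second moments only see the plane part -/
lemma Str.mixed (h : Str m ν e P b) (u : X) :
    Tendsto (fun σ => 2 * σ^2 * (∫ z, ⟪u, z⟫^2 ∂(GP ν σ)) - 2 * σ^2 * ∫ z, ⟪wp e P u, z⟫^2 ∂(GP ν σ)) (𝓝[>] 0) (𝓝 0) := by
  have hb : ∀ z ∈ Sp ν, |(2 * ⟪wp e P u, z⟫) * ⟪vp e P u, z⟫| ≤ (2 * ‖wp e P u‖ * (‖vp e P u‖ * ‖b‖)) * ‖z‖^1 := by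
    intro z hz
    rw [abs_mul, abs_mul, abs_of_pos (two_pos : (0:ℝ) < 2), pow_one]
    calc 2 * |⟪wp e P u, z⟫| * |⟪vp e P u, z⟫| ≤ 2 * (‖wp e P u‖ * ‖z‖) * (‖vp e P u‖ * ‖b‖) := by
          gcongr
          · exact abs_real_inner_le_norm _ _
          · exact h.inner_vp_bound u hz
      _ = _ := by ring
  have hb2 : ∀ z ∈ Sp ν, |⟪vp e P u, z⟫^2| ≤ (‖vp e P u‖ * ‖b‖)^2 * ‖z‖^0 := by
    intro z hz
    rw [abs_pow, pow_zero, mul_one]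
    gcongr
    exact h.inner_vp_bound u hz
  have t1 := av_small h.unif h.zero (l := 2) (by norm_num) hb
  have t2 := av_small h.unif h.zero (l := 2) (by norm_num) hb2
  have t3 := (t1.const_mul 2).add (t2.const_mul 2)
  simp only [mul_zero, add_zero] at t3
  refine t3.congr' ?_
  filter_upwards [self_mem_nhdsWithin] with σ hσ
  have hσ : 0 < σ := hσ
  have i1 := ((PG.inner (wp e P u)).pow 2).int h.unif h.zero hσ
  have i2 := (((PG.inner (wp e P u)).cmul 2).mul (PG.inner (vp e P u))).int h.unif h.zero hσ
  have i3 := ((PG.inner (vp e P u)).pow 2).int h.unif h.zero hσ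
  have i12 : Integrable (fun z => ⟪wp e P u, z⟫^2 + (2 * ⟪wp e P u, z⟫) * ⟪vp e P u, z⟫) (GP ν σ) := i1.add i2
  have e1 : ∫ z, ⟪u, z⟫^2 ∂(GP ν σ) = ∫ z, (⟪wp e P u, z⟫^2 + (2 * ⟪wp e P u, z⟫) * ⟪vp e P u, z⟫ + ⟪vp e P u, z⟫^2) ∂(GP ν σ) := by
    congr 1; ext z
    conv_lhs => rw [← wp_add_vp e P u, inner_add_left]
    ring
  rw [e1, integral_add i12 i3, integral_add i1 i2]; ring

lemma Str.sec (h : Str m ν e P b) (u : X) :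
    Tendsto (fun σ => 2 * σ^2 * ∫ z, ⟪u, z⟫^2 ∂(GP ν σ)) (𝓝[>] 0) (𝓝 (‖wp e P u‖^2)) := by
  rw [tendsto_iff_ultrafilter]
  intro U hU
  obtain ⟨e', q, b', hq0, hqs, hQ, hb'⟩ := stage1 h.unif h.zero U hU
  have key : ∀ w ∈ planeOf e P, ∑ i, q i * ⟪e' i, w⟫^2 = ‖w‖^2 := by
    intro w hw
    obtain ⟨x, hx, hlim⟩ := h.growth hw
    have hc : Continuous (fun y : X => ‖y‖^2 - ∑ i, q i * ⟪e' i, y⟫^2) := by fun_prop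
    have t1 := (hc.tendsto w).comp hlim
    have t2 : Tendsto (fun R : ℝ => R⁻¹ * ⟪b', R⁻¹ • x R⟫) atTop (𝓝 (0 * ⟪b', w⟫)) :=
      tendsto_inv_atTop_zero.mul (tendsto_const_nhds.inner hlim)
    have t3 : Tendsto (fun R : ℝ => R⁻¹ * ⟪b', R⁻¹ • x R⟫) atTop (𝓝 (‖w‖^2 - ∑ i, q i * ⟪e' i, w⟫^2)) := by
      refine t1.congr' ?_
      filter_upwards [eventually_gt_atTop 0] with R hR
      simp only [Function.comp]
      rw [real_inner_smul_right, ← hb' _ (hx R), norm_smul, norm_inv, Real.norm_of_nonneg hR.le]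
      simp only [real_inner_smul_right, mul_sub, Finset.mul_sum]
      rw [mul_pow, pow_two R⁻¹, mul_assoc]
      congr 1
      exact Finset.sum_congr rfl fun i _ => by ring
    have := tendsto_nhds_unique t2 t3
    linarith
  have t1 := (hQ (wp e P u)).add ((h.mixed u).mono_left hU)
  rw [key _ (wp_mem e P u), add_zero] at t1
  exact t1.congr fun σ => by ring

lemma Str.fst (h : Str m ν e P b) (u : X) :
    Tendsto (fun σ => ∫ z, ⟪u, z⟫ ∂(GP ν σ)) (𝓝[>] 0) (𝓝 (⟪b, u⟫ / 2)) := by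
  have h1 : ∀ x ∈ Submodule.span ℝ (Sp ν), Tendsto (fun σ => ∫ z, ⟪x, z⟫ ∂(GP ν σ)) (𝓝[>] 0) (𝓝 (⟪b, x⟫ / 2)) := by
    intro x hx
    induction hx using Submodule.span_induction with
    | mem x hx =>
      have t := (((second_order h.unif h.zero hx).sub (h.sec x)).add_const (‖x‖^2)).div_const 2
      have e1 : (0 - ‖wp e P x‖^2 + ‖x‖^2) / 2 = ⟪b, x⟫ / 2 := by
        rw [norm_split e P x, ← norm_wp, ← norm_vp, h.hv x hx]; ring
      rw [e1] at t
      exact t.congr fun σ => by ring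
    | zero => simp
    | add x y _ _ hx hy =>
      rw [inner_add_right, add_div]
      refine (hx.add hy).congr' ?_
      filter_upwards [self_mem_nhdsWithin] with σ hσ
      simp only [inner_add_left]
      rw [integral_add ((PG.inner x).int h.unif h.zero hσ) ((PG.inner y).int h.unif h.zero hσ)]
    | smul a x _ hx =>
      rw [inner_smul_right, mul_div_assoc]
      refine (hx.const_mul a).congr fun σ => ?_
      simp only [real_inner_smul_left]
      rw [integral_const_mul]
  set K := Submodule.span ℝ (Sp ν)
  have t := h1 (K.starProjection u) (Submodule.starProjection_apply_mem _ _)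
  have hor : u - K.starProjection u ∈ Kᗮ := Submodule.sub_starProjection_mem_orthogonal u
  have hor' : ∀ z ∈ K, ⟪K.starProjection u, z⟫ = ⟪u, z⟫ := fun z hz => by
    have := (Submodule.mem_orthogonal' K _).1 hor z hz
    rw [inner_sub_left] at this; linarith
  rw [real_inner_comm, hor' b h.hspan, real_inner_comm] at t
  refine t.congr fun σ => ?_
  refine integral_congr_ae ?_
  filter_upwards [GP_ae ν σ] with z hz
  exact hor' z (Submodule.subset_span hz)

lemma exists_Str (hU : Unif m ν) (h0 : (0:X) ∈ Sp ν)
    (hG : ∀ R₀ : ℝ, ∃ R > R₀, Good m (eps0 m) (Sp ν) R) :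
    ∃ (e : OrthonormalBasis (Fin (finrank ℝ X)) ℝ X) (P : Finset (Fin (finrank ℝ X))) (b : X), Str m ν e P b := by
  let U : Ultrafilter ℝ := Ultrafilter.of (𝓝[>] 0)
  obtain ⟨e, q, b, hq0, hqs, hQ, hb⟩ := stage1 hU h0 U (Ultrafilter.of_le _)
  obtain ⟨P, hP, h1, h2⟩ := alg2 e q hq0 hqs b (Sp ν) hb hG
  set K := Submodule.span ℝ (Sp ν) with hK
  refine ⟨e, P, K.starProjection b, hP, hU, h0, fun x hx => ?_, Submodule.starProjection_apply_mem _ _⟩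
  have hor : b - K.starProjection b ∈ Kᗮ := Submodule.sub_starProjection_mem_orthogonal b
  have := (Submodule.mem_orthogonal' K _).1 hor x (Submodule.subset_span hx)
  rw [inner_sub_left, ← hb x hx] at this
  have e1 : ∑ i, q i * ⟪e i, x⟫^2 = ∑ i, ⟪ac e P i, x⟫^2 := by
    refine Finset.sum_congr rfl fun i _ => ?_
    unfold ac
    by_cases hi : i ∈ P
    · simp [hi, h1 i hi]
    · simp [hi, h2 i hi]
  rw [e1, norm_split e P x] at this
  rw [norm_vp]; linarith

end stage2
end FT

namespace FT

section stage4
variable {X : Type*} [NormedAddCommGroup X] [InnerProductSpace ℝ X] [FiniteDimensional ℝ X]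
  [MeasurableSpace X] [BorelSpace X]
variable {m : ℕ} {ν : Measure X} {ι : Type*} [Fintype ι]

lemma int_one (hU : Unif m ν) (h0 : (0:X) ∈ Sp ν) {σ : ℝ} (hσ : 0 < σ) (α : ι → ℝ) {f : ι → X → ℝ} (hf : ∀ i, PG (f i)) :
    ∫ z, (∑ i, α i * f i z) ∂(GP ν σ) = ∑ i, α i * ∫ z, f i z ∂(GP ν σ) := by
  rw [integral_finsetSum _ (fun i _ => ((hf i).cmul (α i)).int hU h0 hσ)]
  simp only [integral_const_mul]

lemma int_two (hU : Unif m ν) (h0 : (0:X) ∈ Sp ν) {σ : ℝ} (hσ : 0 < σ) (α β : ι → ℝ) {f g : ι → X → ℝ}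
    (hf : ∀ i, PG (f i)) (hg : ∀ i, PG (g i)) :
    ∫ z, (∑ i, α i * f i z) * (∑ j, β j * g j z) ∂(GP ν σ) = ∑ i, ∑ j, α i * β j * ∫ z, f i z * g j z ∂(GP ν σ) := by
  have e1 : ∀ z, (∑ i, α i * f i z) * (∑ j, β j * g j z) = ∑ i, α i * (∑ j, β j * (f i z * g j z)) := fun z => by
    rw [Finset.sum_mul]
    refine Finset.sum_congr rfl fun i _ => ?_
    rw [mul_assoc, Finset.mul_sum]
    congr 1
    exact Finset.sum_congr rfl fun j _ => by ring
  simp only [e1]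
  rw [int_one hU h0 hσ α (fun i => PG.sum _ fun j _ => ((hf i).mul (hg j)).cmul (β j))]
  refine Finset.sum_congr rfl fun i _ => ?_
  rw [int_one hU h0 hσ β (fun j => (hf i).mul (hg j)), Finset.mul_sum]
  exact Finset.sum_congr rfl fun j _ => by ring

lemma int_three (hU : Unif m ν) (h0 : (0:X) ∈ Sp ν) {σ : ℝ} (hσ : 0 < σ) (α β γ : ι → ℝ) {f g k : ι → X → ℝ}
    (hf : ∀ i, PG (f i)) (hg : ∀ i, PG (g i)) (hk : ∀ i, PG (k i)) :
    ∫ z, (∑ i, α i * f i z) * (∑ j, β j * g j z) * (∑ l, γ l * k l z) ∂(GP ν σ) =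
      ∑ i, ∑ j, ∑ l, α i * β j * γ l * ∫ z, f i z * g j z * k l z ∂(GP ν σ) := by
  have e1 : ∀ z, (∑ i, α i * f i z) * (∑ j, β j * g j z) * (∑ l, γ l * k l z) =
      ∑ i, α i * ((∑ j, β j * (f i z * g j z)) * (∑ l, γ l * k l z)) := fun z => by
    rw [mul_assoc, Finset.sum_mul]
    refine Finset.sum_congr rfl fun i _ => ?_
    rw [mul_assoc, ← mul_assoc (f i z), Finset.mul_sum Finset.univ (fun j => β j * g j z)]
    congr 2
    exact Finset.sum_congr rfl fun j _ => by ring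
  simp only [e1]
  rw [int_one hU h0 hσ α (fun i => (PG.sum _ fun j _ => ((hf i).mul (hg j)).cmul (β j)).mul
    (PG.sum _ fun l _ => (hk l).cmul (γ l)))]
  refine Finset.sum_congr rfl fun i _ => ?_
  rw [int_two hU h0 hσ β γ (fun j => (hf i).mul (hg j)) hk, Finset.mul_sum]
  refine Finset.sum_congr rfl fun j _ => ?_
  rw [Finset.mul_sum]
  exact Finset.sum_congr rfl fun l _ => by ring

variable {e : OrthonormalBasis ι ℝ X} {P : Finset ι} {b : X}

lemma quad_ac (x : X) : ∑ i, ∑ j, ⟪ac e P i, ac e P j⟫ * (⟪e i, x⟫ * ⟪e j, x⟫) = ‖wp e P x‖^2 := by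
  have e1 : wp e P x = ∑ i, ⟪e i, x⟫ • ac e P i := by
    unfold wp
    refine Finset.sum_congr rfl fun i _ => ?_
    rw [inner_ac_add e P i]
    unfold ac cc; split_ifs <;> simp
  rw [← real_inner_self_eq_norm_sq, e1, sum_inner]
  refine Finset.sum_congr rfl fun i _ => ?_
  rw [inner_sum]
  refine Finset.sum_congr rfl fun j _ => ?_
  rw [real_inner_smul_left, real_inner_smul_right]; ring

lemma Str.trace_sq (h : Str m ν e P b) : ∑ i, ∑ j, ⟪ac e P i, ac e P j⟫ * ⟪ac e P i, ac e P j⟫ = m := by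
  classical
  have : ∀ i j, ⟪ac e P i, ac e P j⟫ * ⟪ac e P i, ac e P j⟫ = if i = j then (if i ∈ P then (1:ℝ) else 0) else 0 := by
    intro i j
    rw [inner_ac_ac]
    by_cases h1 : i = j <;> by_cases h2 : i ∈ P <;> simp [h1, h2]
  simp only [this, Finset.sum_ite_eq, Finset.mem_univ, if_true]
  simp [h.card]

/-- limit of cubic difference -/
lemma Str.cubic (h : Str m ν e P b) (x : X) :
    Tendsto (fun σ => σ^2 * (∫ z, ⟪x, z⟫^3 ∂(GP ν σ)) - σ^2 * (∫ z, ⟪wp e P x, z⟫^3 ∂(GP ν σ))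
      - 3 * (σ^2 * ∫ z, ⟪wp e P x, z⟫ * ⟪wp e P x, z⟫ * ⟪vp e P x, z⟫ ∂(GP ν σ))) (𝓝[>] 0) (𝓝 0) := by
  set w := wp e P x with hw
  set v := vp e P x with hv
  have hb : ∀ z ∈ Sp ν, |3 * ⟪w, z⟫ * ⟪v, z⟫^2| ≤ (3 * ‖w‖ * (‖v‖ * ‖b‖)^2) * ‖z‖^1 := by
    intro z hz
    rw [abs_mul, abs_mul, abs_of_pos (three_pos : (0:ℝ) < 3), pow_one, abs_pow]
    calc 3 * |⟪w, z⟫| * |⟪v, z⟫|^2 ≤ 3 * (‖w‖ * ‖z‖) * (‖v‖ * ‖b‖)^2 := by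
          gcongr
          · exact abs_real_inner_le_norm _ _
          · exact h.inner_vp_bound x hz
      _ = _ := by ring
  have hb2 : ∀ z ∈ Sp ν, |⟪v, z⟫^3| ≤ (‖v‖ * ‖b‖)^3 * ‖z‖^0 := by
    intro z hz
    rw [abs_pow, pow_zero, mul_one]
    gcongr
    exact h.inner_vp_bound x hz
  have t1 := av_small h.unif h.zero (l := 2) (by norm_num) hb
  have t2 := av_small h.unif h.zero (l := 2) (by norm_num) hb2
  have t3 := t1.add t2
  rw [add_zero] at t3
  refine t3.congr' ?_
  filter_upwards [self_mem_nhdsWithin] with σ hσ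
  have hσ : 0 < σ := hσ
  have i1 := ((PG.inner w).pow 3).int h.unif h.zero hσ
  have i2 := ((((PG.inner w).mul (PG.inner w)).mul (PG.inner v)).cmul 3).int h.unif h.zero hσ
  have i3 := (((PG.inner w).cmul 3).mul ((PG.inner v).pow 2)).int h.unif h.zero hσ
  have i4 := ((PG.inner v).pow 3).int h.unif h.zero hσ
  have e1 : ∀ z, ⟪x, z⟫^3 = (⟪w, z⟫^3 + 3 * (⟪w, z⟫ * ⟪w, z⟫ * ⟪v, z⟫)) + (3 * ⟪w, z⟫ * ⟪v, z⟫^2 + ⟪v, z⟫^3) := by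
    intro z
    conv_lhs => rw [← wp_add_vp e P x, inner_add_left]
    ring
  simp only [e1]
  rw [integral_add, integral_add i1 i2, integral_add i3 i4, integral_const_mul]
  · ring
  · exact i1.add i2
  · exact i3.add i4

lemma Str.quartic (h : Str m ν e P b) (x : X) :
    Tendsto (fun σ => σ^4 * (∫ z, ⟪x, z⟫^4 ∂(GP ν σ)) - σ^4 * (∫ z, ⟪wp e P x, z⟫^4 ∂(GP ν σ))) (𝓝[>] 0) (𝓝 0) := by
  set w := wp e P x with hw
  set v := vp e P x with hv
  have hb : ∀ z ∈ Sp ν, |⟪v, z⟫ * (4 * ⟪w, z⟫^3 + 6 * ⟪w, z⟫^2 * ⟪v, z⟫ + 4 * ⟪w, z⟫ * ⟪v, z⟫^2 + ⟪v,z⟫^3)|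
      ≤ ((‖v‖ * ‖b‖) * (15 * (‖w‖ + ‖v‖)^3)) * ‖z‖^3 := by
    intro z hz
    rw [abs_mul, mul_assoc (‖v‖ * ‖b‖)]
    refine mul_le_mul (h.inner_vp_bound x hz) ?_ (abs_nonneg _) (by positivity)
    have a1 : |⟪w, z⟫| ≤ (‖w‖ + ‖v‖) * ‖z‖ := (abs_real_inner_le_norm _ _).trans (by gcongr; linarith [norm_nonneg v])
    have a2 : |⟪v, z⟫| ≤ (‖w‖ + ‖v‖) * ‖z‖ := (abs_real_inner_le_norm _ _).trans (by gcongr; linarith [norm_nonneg w])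
    set D := (‖w‖ + ‖v‖) * ‖z‖
    have hD : 0 ≤ D := by positivity
    calc |4 * ⟪w, z⟫^3 + 6 * ⟪w, z⟫^2 * ⟪v, z⟫ + 4 * ⟪w, z⟫ * ⟪v, z⟫^2 + ⟪v,z⟫^3|
        ≤ |4 * ⟪w, z⟫^3| + |6 * ⟪w, z⟫^2 * ⟪v, z⟫| + |4 * ⟪w, z⟫ * ⟪v, z⟫^2| + |⟪v,z⟫^3| :=
          (abs_add_le _ _).trans (by gcongr; exact abs_add_three _ _ _)
      _ = 4 * |⟪w, z⟫|^3 + 6 * |⟪w, z⟫|^2 * |⟪v, z⟫| + 4 * |⟪w, z⟫| * |⟪v, z⟫|^2 + |⟪v,z⟫|^3 := by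
          simp only [abs_mul, abs_pow]; norm_num
      _ ≤ 4 * D^3 + 6 * D^2 * D + 4 * D * D^2 + D^3 := by gcongr
      _ = _ := by simp only [D]; ring
  have t1 := av_small h.unif h.zero (l := 4) (by norm_num) hb
  refine t1.congr' ?_
  filter_upwards [self_mem_nhdsWithin] with σ hσ
  have hσ : 0 < σ := hσ
  have i1 := ((PG.inner w).pow 4).int h.unif h.zero hσ
  have i2 := ((PG.inner x).pow 4).int h.unif h.zero hσ
  rw [← mul_sub, ← integral_sub i2 i1]
  congr 2; ext z
  have : ⟪x, z⟫ = ⟪w, z⟫ + ⟪v, z⟫ := by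
    conv_lhs => rw [← wp_add_vp e P x, inner_add_left]
  rw [this]; ring

lemma Str.trace_kappa (h : Str m ν e P b) :
    Tendsto (fun σ => ∑ i, ∑ j, (2 * (∫ z, ⟪e i, z⟫ * ⟪e j, z⟫ ∂(GP ν σ)) - ⟪ac e P i, ac e P j⟫ / σ^2)
      * ⟪ac e P i, ac e P j⟫) (𝓝[>] 0) (𝓝 (-‖b‖^2)) := by
  have t := (h.fst b).const_mul (-2)
  have e0 : -2 * (⟪b, b⟫ / 2) = -‖b‖^2 := by rw [real_inner_self_eq_norm_sq]; ring
  rw [e0] at t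
  refine t.congr' ?_
  filter_upwards [self_mem_nhdsWithin] with σ hσ
  have hσ : 0 < σ := hσ
  have e1 : ∑ i, ∑ j, (2 * (∫ z, ⟪e i, z⟫ * ⟪e j, z⟫ ∂(GP ν σ)) - ⟪ac e P i, ac e P j⟫ / σ^2)
      * ⟪ac e P i, ac e P j⟫ = 2 * (∑ i, ∑ j, ⟪ac e P i, ac e P j⟫ * ∫ z, ⟪e i, z⟫ * ⟪e j, z⟫ ∂(GP ν σ)) -
      (∑ i, ∑ j, ⟪ac e P i, ac e P j⟫ * ⟪ac e P i, ac e P j⟫) / σ^2 := by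
    rw [Finset.mul_sum, Finset.sum_div, ← Finset.sum_sub_distrib]
    refine Finset.sum_congr rfl fun i _ => ?_
    rw [Finset.mul_sum, Finset.sum_div, ← Finset.sum_sub_distrib]
    exact Finset.sum_congr rfl fun j _ => by ring
  have e2 : ∑ i, ∑ j, ⟪ac e P i, ac e P j⟫ * ∫ z, ⟪e i, z⟫ * ⟪e j, z⟫ ∂(GP ν σ) = ∫ z, ‖wp e P z‖^2 ∂(GP ν σ) := by
    simp only [← quad_ac, ← integral_const_mul]
    have hpg : ∀ i j, PG (fun z : X => ⟪ac e P i, ac e P j⟫ * (⟪e i, z⟫ * ⟪e j, z⟫)) := fun i j =>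
      ((PG.inner (e i)).mul (PG.inner (e j))).cmul _
    rw [integral_finsetSum _ fun i _ => (PG.sum _ fun j _ => hpg i j).int h.unif h.zero hσ]
    refine Finset.sum_congr rfl fun i _ => ?_
    rw [integral_finsetSum _ fun j _ => (hpg i j).int h.unif h.zero hσ]
  have e3 : ∫ z, ‖wp e P z‖^2 ∂(GP ν σ) = (∫ z, ‖z‖^2 ∂(GP ν σ)) - ∫ z, ⟪b, z⟫ ∂(GP ν σ) := by
    rw [← integral_sub ((PG.norm.pow 2).int h.unif h.zero hσ) ((PG.inner b).int h.unif h.zero hσ)]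
    refine integral_congr_ae ?_
    filter_upwards [GP_ae ν σ] with z hz
    rw [← h.hv z hz, norm_split e P z, norm_wp, norm_vp]; ring
  rw [e1, e2, e3, h.trace_sq, GP_moment h.unif h.zero hσ, C2_eq h.unif h.zero]
  rw [inv_pow]; field_simp; ring

end stage4
end FT

namespace FT

section stage4
variable {X : Type*} [NormedAddCommGroup X] [InnerProductSpace ℝ X] [FiniteDimensional ℝ X]
  [MeasurableSpace X] [BorelSpace X]
variable {m : ℕ} {ν : Measure X} {ι : Type*} [Fintype ι]
variable {e : OrthonormalBasis ι ℝ X} {P : Finset ι} {b : X}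

lemma Str.S_exists (h : Str m ν e P b) (U : Ultrafilter ℝ) (hU0 : (U : Filter ℝ) ≤ 𝓝[>] 0) :
    ∃ S : ι → ι → ι → ℝ, ∀ i j p, Tendsto (fun σ => σ^2 * ∫ z, ⟪ac e P i, z⟫ * ⟪ac e P j, z⟫ * ⟪cc e P p, z⟫ ∂(GP ν σ)) U (𝓝 (S i j p)) := by
  have : ∀ i j p, ∃ l, Tendsto (fun σ => σ^2 * ∫ z, ⟪ac e P i, z⟫ * ⟪ac e P j, z⟫ * ⟪cc e P p, z⟫ ∂(GP ν σ)) U (𝓝 l) := by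
    intro i j p
    refine ultra_lim U (C := ‖b‖ * Ck ν 2) ?_
    filter_upwards [hU0 self_mem_nhdsWithin] with σ hσ
    refine av_bound' h.unif h.zero hσ fun z hz => ?_
    rw [abs_mul, abs_mul]
    calc |⟪ac e P i, z⟫| * |⟪ac e P j, z⟫| * |⟪cc e P p, z⟫| ≤ (1 * ‖z‖) * (1 * ‖z‖) * ‖b‖ := by
          gcongr
          · exact (abs_real_inner_le_norm _ _).trans (by gcongr; exact norm_ac_le e P i)
          · exact (abs_real_inner_le_norm _ _).trans (by gcongr; exact norm_ac_le e P j)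
          · exact h.cc_bound hz p
      _ = _ := by ring
  choose S hS using this
  exact ⟨S, hS⟩

lemma Str.P4_exists (h : Str m ν e P b) (U : Ultrafilter ℝ) (hU0 : (U : Filter ℝ) ≤ 𝓝[>] 0) :
    ∃ P4 : X → ℝ, ∀ u, Tendsto (fun σ => σ^4 * ∫ z, ⟪u, z⟫^4 ∂(GP ν σ)) U (𝓝 (P4 u)) := by
  have : ∀ u : X, ∃ l, Tendsto (fun σ => σ^4 * ∫ z, ⟪u, z⟫^4 ∂(GP ν σ)) U (𝓝 l) := by
    intro u
    refine ultra_lim U (C := ‖u‖^4 * Ck ν 4) ?_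
    filter_upwards [hU0 self_mem_nhdsWithin] with σ hσ
    refine av_bound' h.unif h.zero hσ fun z hz => ?_
    rw [abs_pow, ← mul_pow]
    gcongr
    exact abs_real_inner_le_norm _ _
  choose S hS using this
  exact ⟨S, hS⟩

lemma Str.eqn1 (h : Str m ν e P b) (U : Ultrafilter ℝ) (hU0 : (U : Filter ℝ) ≤ 𝓝[>] 0)
    {S : ι → ι → ι → ℝ} (hS : ∀ i j p, Tendsto (fun σ => σ^2 * ∫ z, ⟪ac e P i, z⟫ * ⟪ac e P j, z⟫ * ⟪cc e P p, z⟫ ∂(GP ν σ)) U (𝓝 (S i j p)))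
    {P4 : X → ℝ} (hP4 : ∀ u, Tendsto (fun σ => σ^4 * ∫ z, ⟪u, z⟫^4 ∂(GP ν σ)) U (𝓝 (P4 u))) :
    ∃ (l : ι → ℝ) (κ : ι → ι → ℝ) (T : ι → ι → ι → ℝ),
      (∑ i, ∑ j, κ i j * ⟪ac e P i, ac e P j⟫ = -‖b‖^2) ∧
      ∀ x ∈ Sp ν, ‖x‖^4 / 2 - (2/3) * P4 (wp e P x) -
          4 * ∑ i, ∑ j, ∑ p, ⟪ac e P i, x⟫ * ⟪ac e P j, x⟫ * ⟪cc e P p, x⟫ * S i j p =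
        ∑ i, l i * ⟪e i, x⟫ + ∑ i, ∑ j, κ i j * (⟪e i, x⟫ * ⟪e j, x⟫) +
        ∑ i, ∑ j, ∑ k, T i j k * (⟪ac e P i, x⟫ * ⟪ac e P j, x⟫ * ⟪ac e P k, x⟫) := by
  let J := ι ⊕ (ι × ι) ⊕ (ι × ι × ι)
  let g : J → Option (Sp ν) → ℝ := fun j s => match j, s with
    | .inl i, some x => ⟪e i, (x:X)⟫
    | .inl i, none => 0
    | .inr (.inl ⟨i, j⟩), some x => ⟪e i, (x:X)⟫ * ⟪e j, (x:X)⟫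
    | .inr (.inl ⟨i, j⟩), none => ⟪ac e P i, ac e P j⟫
    | .inr (.inr ⟨i, j, k⟩), some x => ⟪ac e P i, (x:X)⟫ * ⟪ac e P j, (x:X)⟫ * ⟪ac e P k, (x:X)⟫
    | .inr (.inr ⟨i, j, k⟩), none => 0
  let c : ℝ → J → ℝ := fun σ j => match j with
    | .inl i => (2 * (∫ z, ⟪e i, z⟫ ∂(GP ν σ)) - ⟪e i, b⟫) / σ^2
    | .inr (.inl ⟨i, j⟩) => 2 * (∫ z, ⟪e i, z⟫ * ⟪e j, z⟫ ∂(GP ν σ)) - ⟪ac e P i, ac e P j⟫ / σ^2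
    | .inr (.inr ⟨i, j, k⟩) => (4/3) * (σ^2 * ∫ z, ⟪ac e P i, z⟫ * ⟪ac e P j, z⟫ * ⟪ac e P k, z⟫ ∂(GP ν σ))
  let φ : Option (Sp ν) → ℝ := fun s => match s with
    | some x => ‖(x:X)‖^4 / 2 - (2/3) * P4 (wp e P x) -
          4 * ∑ i, ∑ j, ∑ p, ⟪ac e P i, (x:X)⟫ * ⟪ac e P j, (x:X)⟫ * ⟪cc e P p, (x:X)⟫ * S i j p
    | none => -‖b‖^2
  obtain ⟨c', hc'⟩ := closed_range (U : Filter ℝ) g c φ (by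
    rintro (_ | ⟨x, hx⟩)
    · simp only [J, g, c, φ, Fintype.sum_sum_type, Fintype.sum_prod_type, mul_zero, Finset.sum_const_zero, zero_add, add_zero]
      exact h.trace_kappa.mono_left hU0
    · simp only [J, g, c, φ, Fintype.sum_sum_type, Fintype.sum_prod_type]
      have t1 := (fourth_order h.unif h.zero hx).mono_left hU0
      have t2 := (h.cubic x).mono_left hU0
      have t3 := (h.quartic x).mono_left hU0
      have t4 : Tendsto (fun σ => σ^2 * ∫ z, ⟪wp e P x, z⟫ * ⟪wp e P x, z⟫ * ⟪vp e P x, z⟫ ∂(GP ν σ)) U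
          (𝓝 (∑ i, ∑ j, ∑ p, ⟪ac e P i, x⟫ * ⟪ac e P j, x⟫ * ⟪cc e P p, x⟫ * S i j p)) := by
        have t5 : Tendsto (fun σ => ∑ i, ∑ j, ∑ p, ⟪ac e P i, x⟫ * ⟪ac e P j, x⟫ * ⟪cc e P p, x⟫ *
            (σ^2 * ∫ z, ⟪ac e P i, z⟫ * ⟪ac e P j, z⟫ * ⟪cc e P p, z⟫ ∂(GP ν σ))) U
          (𝓝 (∑ i, ∑ j, ∑ p, ⟪ac e P i, x⟫ * ⟪ac e P j, x⟫ * ⟪cc e P p, x⟫ * S i j p)) :=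
          tendsto_finsetSum _ fun i _ => tendsto_finsetSum _ fun j _ => tendsto_finsetSum _ fun p _ =>
            (hS i j p).const_mul _
        refine t5.congr' ?_
        filter_upwards [hU0 self_mem_nhdsWithin] with σ hσ
        simp only [inner_wp, inner_vp]
        rw [int_three h.unif h.zero hσ _ _ _ (fun i => PG.inner (ac e P i)) (fun i => PG.inner (ac e P i)) (fun i => PG.inner (cc e P i))]
        simp only [Finset.mul_sum]
        exact Finset.sum_congr rfl fun i _ => Finset.sum_congr rfl fun j _ => Finset.sum_congr rfl fun p _ => by ring
      have t6 := (((t1.sub (t2.const_mul (4/3))).sub (t4.const_mul 4)).sub (t3.const_mul (2/3))).sub ((hP4 (wp e P x)).const_mul (2/3))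
      have t7 := t6.add_const (‖x‖^4 / 2)
      have e0 : ∀ y : ℝ, 0 - (4/3) * 0 - 4 * y - (2/3) * 0 - (2/3) * P4 (wp e P x) + ‖x‖^4/2 =
        ‖x‖^4 / 2 - (2/3) * P4 (wp e P x) - 4 * y := fun y => by ring
      rw [e0] at t7
      refine t7.congr' ?_
      filter_upwards [hU0 self_mem_nhdsWithin] with σ hσ
      have hσ : 0 < σ := hσ
      have l1 : ∑ i, (2 * (∫ z, ⟪e i, z⟫ ∂(GP ν σ)) - ⟪e i, b⟫) / σ^2 * ⟪e i, x⟫ = (2 * (∫ z, ⟪x, z⟫ ∂(GP ν σ)) - ⟪b, x⟫) / σ^2 := by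
        have a1 : ∀ z, ⟪x, z⟫ = ∑ i, ⟪e i, x⟫ * ⟪e i, z⟫ := fun z => by
          rw [← e.sum_inner_mul_inner]
          exact Finset.sum_congr rfl fun i _ => by rw [real_inner_comm]
        have a2 : ⟪b, x⟫ = ∑ i, ⟪e i, x⟫ * ⟪e i, b⟫ := by rw [real_inner_comm, a1]
        rw [a2]
        simp only [a1]
        rw [int_one h.unif h.zero hσ _ (fun i => PG.inner (e i)), Finset.mul_sum, ← Finset.sum_sub_distrib, Finset.sum_div]
        exact Finset.sum_congr rfl fun i _ => by ring
      have l2 : ∑ i, ∑ j, (2 * (∫ z, ⟪e i, z⟫ * ⟪e j, z⟫ ∂(GP ν σ)) - ⟪ac e P i, ac e P j⟫ / σ^2) * (⟪e i, x⟫ * ⟪e j, x⟫) =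
          2 * (∫ z, ⟪x, z⟫^2 ∂(GP ν σ)) - ‖wp e P x‖^2 / σ^2 := by
        have a1 : ∀ z, ⟪x, z⟫ = ∑ i, ⟪e i, x⟫ * ⟪e i, z⟫ := fun z => by
          rw [← e.sum_inner_mul_inner]
          exact Finset.sum_congr rfl fun i _ => by rw [real_inner_comm]
        rw [← quad_ac]
        simp only [a1, pow_two]
        rw [int_two h.unif h.zero hσ _ _ (fun i => PG.inner (e i)) (fun i => PG.inner (e i)), Finset.mul_sum,
          Finset.sum_div, ← Finset.sum_sub_distrib]
        refine Finset.sum_congr rfl fun i _ => ?_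
        rw [Finset.mul_sum, Finset.sum_div, ← Finset.sum_sub_distrib]
        exact Finset.sum_congr rfl fun j _ => by ring
      have l3 : ∑ i, ∑ j, ∑ k, (4/3) * (σ^2 * ∫ z, ⟪ac e P i, z⟫ * ⟪ac e P j, z⟫ * ⟪ac e P k, z⟫ ∂(GP ν σ)) *
          (⟪ac e P i, x⟫ * ⟪ac e P j, x⟫ * ⟪ac e P k, x⟫) = (4/3) * (σ^2 * ∫ z, ⟪wp e P x, z⟫^3 ∂(GP ν σ)) := by
        have a1 : ∀ y : ℝ, y^3 = y * y * y := fun y => by ring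
        simp only [a1, inner_wp]
        rw [int_three h.unif h.zero hσ _ _ _ (fun i => PG.inner (ac e P i)) (fun i => PG.inner (ac e P i)) (fun i => PG.inner (ac e P i))]
        simp only [Finset.mul_sum]
        exact Finset.sum_congr rfl fun i _ => Finset.sum_congr rfl fun j _ => Finset.sum_congr rfl fun p _ => by ring
      rw [l1, l2, l3]
      have a3 : ⟪b, x⟫ = ‖x‖^2 - ‖wp e P x‖^2 := by
        rw [norm_split e P x, ← norm_wp, ← norm_vp, h.hv x hx]; ring
      rw [a3]
      ring)
  refine ⟨fun i => c' (.inl i), fun i j => c' (.inr (.inl (i, j))), fun i j k => c' (.inr (.inr (i, j, k))), ?_, fun x hx => ?_⟩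
  · have := hc' none
    simp only [J, g, c, φ, Fintype.sum_sum_type, Fintype.sum_prod_type, mul_zero, Finset.sum_const_zero, zero_add, add_zero] at this
    exact this.symm
  · have := hc' (some ⟨x, hx⟩)
    simp only [J, g, c, φ, Fintype.sum_sum_type, Fintype.sum_prod_type] at this
    rw [this]; ring

end stage4
end FT

namespace FT

section stage5
variable {X : Type*} [NormedAddCommGroup X] [InnerProductSpace ℝ X] [FiniteDimensional ℝ X]
  [MeasurableSpace X] [BorelSpace X]
variable {m : ℕ} {ν : Measure X} {ι : Type*} [Fintype ι]
variable {e : OrthonormalBasis ι ℝ X} {P : Finset ι} {b : X}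

def Lm (ν : Measure X) (U : Filter ℝ) (k : ℕ) (f : X → ℝ) (a : ℝ) : Prop :=
  PG f ∧ Tendsto (fun σ => σ^k * ∫ z, f z ∂(GP ν σ)) U (𝓝 a)

lemma Lm.add (h : Str m ν e P b) {U : Filter ℝ} (hU0 : U ≤ 𝓝[>] 0) {k : ℕ} {f g : X → ℝ} {a c : ℝ}
    (hf : Lm ν U k f a) (hg : Lm ν U k g c) : Lm ν U k (fun z => f z + g z) (a + c) := by
  refine ⟨hf.1.add hg.1, (hf.2.add hg.2).congr' ?_⟩
  filter_upwards [hU0 self_mem_nhdsWithin] with σ hσ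
  rw [integral_add (hf.1.int h.unif h.zero hσ) (hg.1.int h.unif h.zero hσ)]; ring

lemma Lm.cmul {U : Filter ℝ} {k : ℕ} {f : X → ℝ} {a : ℝ} (c : ℝ)
    (hf : Lm ν U k f a) : Lm ν U k (fun z => c * f z) (c * a) := by
  refine ⟨hf.1.cmul c, (hf.2.const_mul c).congr fun σ => ?_⟩
  rw [integral_const_mul]; ring

lemma Lm.sum (h : Str m ν e P b) {U : Filter ℝ} (hU0 : U ≤ 𝓝[>] 0) {k : ℕ} {κ : Type*} [Fintype κ] {f : κ → X → ℝ} {a : κ → ℝ}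
    (hf : ∀ i, Lm ν U k (f i) (a i)) : Lm ν U k (fun z => ∑ i, f i z) (∑ i, a i) := by
  refine ⟨PG.sum _ fun i _ => (hf i).1, (tendsto_finsetSum _ fun i _ => (hf i).2).congr' ?_⟩
  filter_upwards [hU0 self_mem_nhdsWithin] with σ hσ
  rw [integral_finsetSum _ fun i _ => (hf i).1.int h.unif h.zero hσ, Finset.mul_sum]

lemma Lm.congr {U : Filter ℝ} {k : ℕ} {f g : X → ℝ} {a : ℝ}
    (hf : Lm ν U k f a) (hg : PG g) (hfg : ∀ z ∈ Sp ν, f z = g z) : Lm ν U k g a := by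
  refine ⟨hg, hf.2.congr fun σ => ?_⟩
  rw [integral_congr_ae ((GP_ae ν σ).mono fun z hz => hfg z hz)]

lemma Lm.unique {U : Filter ℝ} [U.NeBot] {k : ℕ} {f : X → ℝ} {a c : ℝ}
    (hf : Lm ν U k f a) (hg : Lm ν U k f c) : a = c := tendsto_nhds_unique hf.2 hg.2

lemma Str.Lm_small (h : Str m ν e P b) {U : Filter ℝ} (hU0 : U ≤ 𝓝[>] 0) {k l : ℕ} (hkl : k < l) {f : X → ℝ} (hPG : PG f) {C : ℝ}
    (hf : ∀ z ∈ Sp ν, |f z| ≤ C * ‖z‖^k) : Lm ν U l f 0 :=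
  ⟨hPG, (av_small h.unif h.zero hkl hf).mono_left hU0⟩

lemma Str.Lm_two (h : Str m ν e P b) {U : Filter ℝ} (hU0 : U ≤ 𝓝[>] 0) (u w : X) :
    Lm ν U 2 (fun z => ⟪u, z⟫ * ⟪w, z⟫) (1/2 * ⟪wp e P u, wp e P w⟫) := by
  have key : ∀ u : X, Lm ν U 2 (fun z => ⟪u, z⟫^2) (1/2 * ‖wp e P u‖^2) := fun u =>
    ⟨(PG.inner u).pow 2, (((h.sec u).mono_left hU0).const_mul (1/2)).congr fun σ => by ring⟩
  have wadd : wp e P (u + w) = wp e P u + wp e P w := by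
    unfold wp; simp only [inner_add_right, add_smul, Finset.sum_add_distrib]
  have t := Lm.add h hU0 ((key (u + w)).cmul (1/2)) (Lm.add h hU0 ((key u).cmul (-1/2)) ((key w).cmul (-1/2)))
  rw [wadd, norm_add_sq_real] at t
  have e0 : ∀ x y z : ℝ, 1/2 * (1/2 * (x + 2 * y + z)) + (-1/2 * (1/2 * x) + -1/2 * (1/2 * z)) = 1/2 * y := fun x y z => by ring
  rw [e0] at t
  exact t.congr ((PG.inner u).mul (PG.inner w)) fun z _ => by rw [inner_add_left]; ring

lemma Str.P4_lip (h : Str m ν e P b) (U : Ultrafilter ℝ) (hU0 : (U : Filter ℝ) ≤ 𝓝[>] 0)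
    {P4 : X → ℝ} (hP4 : ∀ u, Tendsto (fun σ => σ^4 * ∫ z, ⟪u, z⟫^4 ∂(GP ν σ)) U (𝓝 (P4 u))) (u w : X) :
    |P4 u - P4 w| ≤ ‖u - w‖ * (‖u‖ + ‖w‖)^3 * Ck ν 4 := by
  refine le_of_tendsto ((hP4 u).sub (hP4 w)).abs ?_
  filter_upwards [hU0 self_mem_nhdsWithin] with σ hσ
  rw [← mul_sub, ← integral_sub (((PG.inner u).pow 4).int h.unif h.zero hσ) (((PG.inner w).pow 4).int h.unif h.zero hσ)]
  refine av_bound' h.unif h.zero hσ fun z hz => ?_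
  have e1 : ⟪u, z⟫^4 - ⟪w, z⟫^4 = ⟪u - w, z⟫ * ((⟪u, z⟫ + ⟪w, z⟫) * (⟪u, z⟫^2 + ⟪w, z⟫^2)) := by
    rw [inner_sub_left]; ring
  have a1 := abs_real_inner_le_norm u z
  have a2 := abs_real_inner_le_norm w z
  have a3 : |⟪u, z⟫ + ⟪w, z⟫| ≤ (‖u‖ + ‖w‖) * ‖z‖ := (abs_add_le _ _).trans (by linarith)
  have a4 : |⟪u, z⟫^2 + ⟪w, z⟫^2| ≤ ((‖u‖ + ‖w‖) * ‖z‖)^2 := by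
    rw [abs_of_nonneg (by positivity), ← sq_abs ⟪u, z⟫, ← sq_abs ⟪w, z⟫]
    have : |⟪u, z⟫|^2 + |⟪w, z⟫|^2 ≤ (|⟪u, z⟫| + |⟪w, z⟫|)^2 := by
      nlinarith [abs_nonneg ⟪u, z⟫, abs_nonneg ⟪w, z⟫, mul_nonneg (abs_nonneg ⟪u, z⟫) (abs_nonneg ⟪w, z⟫)]
    refine this.trans ?_
    gcongr; linarith
  rw [e1, abs_mul, abs_mul]
  calc _ ≤ (‖u - w‖ * ‖z‖) * (((‖u‖ + ‖w‖) * ‖z‖) * ((‖u‖ + ‖w‖) * ‖z‖)^2) := by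
        gcongr; exact abs_real_inner_le_norm _ _
    _ = _ := by ring

lemma P4_cont {P4 : X → ℝ} {C : ℝ} (hl : ∀ u w, |P4 u - P4 w| ≤ ‖u - w‖ * (‖u‖ + ‖w‖)^3 * C) : Continuous P4 := by
  rw [continuous_iff_continuousAt]
  intro w
  unfold ContinuousAt
  rw [tendsto_iff_norm_sub_tendsto_zero]
  have : Tendsto (fun u : X => ‖u - w‖ * (‖u‖ + ‖w‖)^3 * C) (𝓝 w) (𝓝 (‖w - w‖ * (‖w‖ + ‖w‖)^3 * C)) := by
    apply Continuous.tendsto (f := fun u : X => ‖u - w‖ * (‖u‖ + ‖w‖)^3 * C)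
    fun_prop
  rw [sub_self, norm_zero, zero_mul, zero_mul] at this
  exact squeeze_zero (fun _ => norm_nonneg _) (fun u => hl u w) this

lemma P4_smul {U : Filter ℝ} [U.NeBot] {P4 : X → ℝ} (hP4 : ∀ u, Tendsto (fun σ => σ^4 * ∫ z, ⟪u, z⟫^4 ∂(GP ν σ)) U (𝓝 (P4 u))) (c : ℝ) (u : X) :
    P4 (c • u) = c^4 * P4 u := by
  refine tendsto_nhds_unique (hP4 (c • u)) (((hP4 u).const_mul (c^4)).congr fun σ => ?_)
  simp only [real_inner_smul_left, mul_pow]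
  rw [integral_const_mul]; ring

lemma wp_smul (c : ℝ) (x : X) : wp e P (c • x) = c • wp e P x := by
  unfold wp; simp only [real_inner_smul_right, Finset.smul_sum, mul_smul]

lemma wp_cont : Continuous (wp e P) := by unfold wp; fun_prop

lemma cc_plane {u : X} (hu : u ∈ planeOf e P) (i : ι) : ⟪cc e P i, u⟫ = 0 := by
  rw [← wp_of_mem e P hu, cc_wp]

lemma lin_scale (f : ι → X) (l : ι → ℝ) (c : ℝ) (y : X) : ∑ i, l i * ⟪f i, c • y⟫ = c * ∑ i, l i * ⟪f i, y⟫ := by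
  simp only [real_inner_smul_right, Finset.mul_sum]
  exact Finset.sum_congr rfl fun i _ => by ring
lemma quad_scale (f g : ι → X) (l : ι → ι → ℝ) (c : ℝ) (y : X) :
    ∑ i, ∑ j, l i j * (⟪f i, c • y⟫ * ⟪g j, c • y⟫) = c^2 * ∑ i, ∑ j, l i j * (⟪f i, y⟫ * ⟪g j, y⟫) := by
  simp only [real_inner_smul_right, Finset.mul_sum]
  exact Finset.sum_congr rfl fun i _ => Finset.sum_congr rfl fun j _ => by ring
lemma cub_scale (f g k : ι → X) (l : ι → ι → ι → ℝ) (c : ℝ) (y : X) :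
    ∑ i, ∑ j, ∑ p, l i j p * (⟪f i, c • y⟫ * ⟪g j, c • y⟫ * ⟪k p, c • y⟫) =
      c^3 * ∑ i, ∑ j, ∑ p, l i j p * (⟪f i, y⟫ * ⟪g j, y⟫ * ⟪k p, y⟫) := by
  simp only [real_inner_smul_right, Finset.mul_sum]
  exact Finset.sum_congr rfl fun i _ => Finset.sum_congr rfl fun j _ => Finset.sum_congr rfl fun p _ => by ring

lemma Str.eqn2 (h : Str m ν e P b) (U : Ultrafilter ℝ) (hU0 : (U : Filter ℝ) ≤ 𝓝[>] 0)
    {S : ι → ι → ι → ℝ} (hS : ∀ i j p, Tendsto (fun σ => σ^2 * ∫ z, ⟪ac e P i, z⟫ * ⟪ac e P j, z⟫ * ⟪cc e P p, z⟫ ∂(GP ν σ)) U (𝓝 (S i j p)))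
    {P4 : X → ℝ} (hP4 : ∀ u, Tendsto (fun σ => σ^4 * ∫ z, ⟪u, z⟫^4 ∂(GP ν σ)) U (𝓝 (P4 u))) :
    (∀ u ∈ planeOf e P, P4 u = 3/4 * ‖u‖^4) ∧
    ∃ (l : ι → ℝ) (κ : ι → ι → ℝ),
      (∑ i, ∑ j, κ i j * ⟪ac e P i, ac e P j⟫ = -‖b‖^2) ∧
      ∀ x ∈ Sp ν, ⟪b, x⟫ * ‖wp e P x‖^2 + ⟪b, x⟫^2 / 2 -
          4 * ∑ i, ∑ j, ∑ p, S i j p * (⟪ac e P i, x⟫ * ⟪ac e P j, x⟫ * ⟪cc e P p, x⟫) =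
        ∑ i, l i * ⟪e i, x⟫ + ∑ i, ∑ j, κ i j * (⟪e i, x⟫ * ⟪e j, x⟫) := by
  obtain ⟨l, κ, T, hκ, heq⟩ := h.eqn1 U hU0 hS hP4
  have heq : ∀ x ∈ Sp ν, ‖x‖^4 / 2 - (2/3) * P4 (wp e P x) -
          4 * ∑ i, ∑ j, ∑ p, S i j p * (⟪ac e P i, x⟫ * ⟪ac e P j, x⟫ * ⟪cc e P p, x⟫) =
        ∑ i, l i * ⟪e i, x⟫ + ∑ i, ∑ j, κ i j * (⟪e i, x⟫ * ⟪e j, x⟫) +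
        ∑ i, ∑ j, ∑ k, T i j k * (⟪ac e P i, x⟫ * ⟪ac e P j, x⟫ * ⟪ac e P k, x⟫) := by
    intro x hx
    rw [← heq x hx]
    congr 2
    exact Finset.sum_congr rfl fun i _ => Finset.sum_congr rfl fun j _ => Finset.sum_congr rfl fun p _ => by ring
  have hcont := P4_cont (h.P4_lip U hU0 hP4)
  set A1 : X → ℝ := fun x => ∑ i, l i * ⟪e i, x⟫ with hA1
  set A2 : X → ℝ := fun x => ∑ i, ∑ j, κ i j * (⟪e i, x⟫ * ⟪e j, x⟫) with hA2
  set A3 : X → ℝ := fun x => ∑ i, ∑ j, ∑ k, T i j k * (⟪ac e P i, x⟫ * ⟪ac e P j, x⟫ * ⟪ac e P k, x⟫) with hA3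
  set B3 : X → ℝ := fun x => ∑ i, ∑ j, ∑ p, S i j p * (⟪ac e P i, x⟫ * ⟪ac e P j, x⟫ * ⟪cc e P p, x⟫) with hB3
  have s1 : ∀ c y, A1 (c • y) = c * A1 y := fun c y => lin_scale _ _ c y
  have s2 : ∀ c y, A2 (c • y) = c^2 * A2 y := fun c y => quad_scale _ _ _ c y
  have s3 : ∀ c y, A3 (c • y) = c^3 * A3 y := fun c y => cub_scale _ _ _ _ c y
  have s4 : ∀ c y, B3 (c • y) = c^3 * B3 y := fun c y => cub_scale _ _ _ _ c y
  have c1 : Continuous A1 := by rw [hA1]; fun_prop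
  have c2 : Continuous A2 := by rw [hA2]; fun_prop
  have c3 : Continuous A3 := by rw [hA3]; fun_prop
  have c4 : Continuous B3 := by rw [hB3]; fun_prop
  have heq : ∀ x ∈ Sp ν, ‖x‖^4 / 2 - (2/3) * P4 (wp e P x) - 4 * B3 x = A1 x + A2 x + A3 x := heq
  have hinv : Tendsto (fun R : ℝ => R⁻¹) atTop (𝓝 0) := tendsto_inv_atTop_zero
  have hq : ∀ u ∈ planeOf e P, P4 u = 3/4 * ‖u‖^4 := by
    intro u hu
    obtain ⟨x, hx, hlim⟩ := h.growth hu
    have L : Tendsto (fun R : ℝ => ‖R⁻¹ • x R‖^4 / 2 - (2/3) * P4 (wp e P (R⁻¹ • x R)) - R⁻¹ * (4 * B3 (R⁻¹ • x R))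
        - (R⁻¹^3 * A1 (R⁻¹ • x R) + R⁻¹^2 * A2 (R⁻¹ • x R) + R⁻¹ * A3 (R⁻¹ • x R))) atTop
        (𝓝 (‖u‖^4 / 2 - (2/3) * P4 (wp e P u) - 0 * (4 * B3 u) - (0^3 * A1 u + 0^2 * A2 u + 0 * A3 u))) := by
      refine Tendsto.sub (Tendsto.sub (Tendsto.sub ?_ ?_) ?_) (Tendsto.add (Tendsto.add ?_ ?_) ?_)
      · exact (hlim.norm.pow 4).div_const 2
      · exact ((hcont.comp wp_cont).continuousAt.tendsto.comp hlim).const_mul _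
      · exact hinv.mul ((c4.continuousAt.tendsto.comp hlim).const_mul 4)
      · exact (hinv.pow 3).mul (c1.continuousAt.tendsto.comp hlim)
      · exact (hinv.pow 2).mul (c2.continuousAt.tendsto.comp hlim)
      · exact hinv.mul (c3.continuousAt.tendsto.comp hlim)
    have L0 : (‖u‖^4 / 2 - (2/3) * P4 (wp e P u) - 0 * (4 * B3 u) - (0^3 * A1 u + 0^2 * A2 u + 0 * A3 u)) = 0 := by
      refine tendsto_nhds_unique L (tendsto_const_nhds.congr' ?_)
      filter_upwards [eventually_gt_atTop 0] with R hR
      have := heq _ (hx R)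
      rw [wp_smul, P4_smul hP4, s1, s2, s3, s4, norm_smul, Real.norm_eq_abs, abs_of_pos (by positivity)]
      linear_combination (-(R⁻¹)^4) * this
    rw [wp_of_mem e P hu] at L0
    linarith
  refine ⟨hq, l, κ, hκ, ?_⟩
  have heq2 : ∀ x ∈ Sp ν, ⟪b, x⟫ * ‖wp e P x‖^2 + ⟪b, x⟫^2 / 2 - 4 * B3 x = A1 x + A2 x + A3 x := by
    intro x hx
    rw [← heq x hx, hq _ (wp_mem e P x)]
    have : ‖x‖^2 = ‖wp e P x‖^2 + ⟪b, x⟫ := by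
      rw [norm_split e P x, ← norm_wp, ← norm_vp, h.hv x hx]
    have e4 : ‖x‖^4 = (‖x‖^2)^2 := by ring
    rw [e4, this]; ring
  have hT : ∀ u ∈ planeOf e P, A3 u = 0 := by
    intro u hu
    obtain ⟨x, hx, hlim⟩ := h.growth hu
    have L : Tendsto (fun R : ℝ => ⟪b, R⁻¹ • x R⟫ * ‖wp e P (R⁻¹ • x R)‖^2 + R⁻¹ * (⟪b, R⁻¹ • x R⟫^2 / 2) - 4 * B3 (R⁻¹ • x R)
        - (R⁻¹^2 * A1 (R⁻¹ • x R) + R⁻¹ * A2 (R⁻¹ • x R) + A3 (R⁻¹ • x R))) atTop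
        (𝓝 (⟪b, u⟫ * ‖wp e P u‖^2 + 0 * (⟪b, u⟫^2 / 2) - 4 * B3 u - (0^2 * A1 u + 0 * A2 u + A3 u))) := by
      have hb : Tendsto (fun R : ℝ => ⟪b, R⁻¹ • x R⟫) atTop (𝓝 ⟪b, u⟫) := tendsto_const_nhds.inner hlim
      refine Tendsto.sub (Tendsto.sub (Tendsto.add ?_ ?_) ?_) (Tendsto.add (Tendsto.add ?_ ?_) ?_)
      · exact hb.mul (((wp_cont).continuousAt.tendsto.comp hlim).norm.pow 2)
      · exact hinv.mul ((hb.pow 2).div_const 2)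
      · exact (c4.continuousAt.tendsto.comp hlim).const_mul 4
      · exact (hinv.pow 2).mul (c1.continuousAt.tendsto.comp hlim)
      · exact hinv.mul (c2.continuousAt.tendsto.comp hlim)
      · exact c3.continuousAt.tendsto.comp hlim
    have L0 : (⟪b, u⟫ * ‖wp e P u‖^2 + 0 * (⟪b, u⟫^2 / 2) - 4 * B3 u - (0^2 * A1 u + 0 * A2 u + A3 u)) = 0 := by
      refine tendsto_nhds_unique L (tendsto_const_nhds.congr' ?_)
      filter_upwards [eventually_gt_atTop 0] with R hR
      have := heq2 _ (hx R)
      rw [wp_smul, s1, s2, s3, s4, norm_smul, Real.norm_eq_abs, abs_of_pos (by positivity), real_inner_smul_right]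
      linear_combination (-(R⁻¹)^3) * this
    have hB : B3 u = 0 := by
      simp only [hB3, cc_plane hu, mul_zero, Finset.sum_const_zero]
    rw [h.b_perp hu, hB] at L0
    linarith
  intro x hx
  have := heq2 x hx
  have h3 : A3 x = 0 := by
    rw [← hT _ (wp_mem e P x)]
    simp only [hA3, ac_wp]
  rw [h3, add_zero] at this
  exact this

end stage5
end FT

namespace FT

section stage6
variable {X : Type*} [NormedAddCommGroup X] [InnerProductSpace ℝ X] [FiniteDimensional ℝ X]
  [MeasurableSpace X] [BorelSpace X]
variable {m : ℕ} {ν : Measure X} {ι : Type*} [Fintype ι]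
variable {e : OrthonormalBasis ι ℝ X} {P : Finset ι} {b : X}

lemma wp_add (u w : X) : wp e P (u + w) = wp e P u + wp e P w := by
  unfold wp; simp only [inner_add_right, add_smul, Finset.sum_add_distrib]

lemma wp_e (i : ι) : wp e P (e i) = ac e P i := by
  rw [← ac_add_cc e P i, wp_add, wp_of_mem e P (ac_mem e P i)]
  have : wp e P (cc e P i) = 0 := by unfold wp; simp [inner_ac_cc]
  rw [this, add_zero]

lemma Str.norm_b (h : Str m ν e P b) : ∑ p, ⟪cc e P p, b⟫^2 = ‖b‖^2 := by
  rw [norm_split e P b]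
  have : ∀ i, ⟪ac e P i, b⟫ = 0 := fun i => by rw [real_inner_comm, h.b_perp (ac_mem e P i)]
  simp [this]

lemma Str.inner_b' (h : Str m ν e P b) (z : X) : ⟪b, z⟫ = ∑ p, ⟪cc e P p, b⟫ * ⟪cc e P p, z⟫ := by
  rw [inner_split e P b z]
  have : ∀ i, ⟪ac e P i, b⟫ = 0 := fun i => by rw [real_inner_comm, h.b_perp (ac_mem e P i)]
  simp [this]

lemma Str.inner_b_bound (h : Str m ν e P b) {x : X} (hx : x ∈ Sp ν) : |⟪b, x⟫| ≤ ‖b‖^2 := by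
  rw [← h.hv x hx, abs_of_nonneg (by positivity)]
  have := h.vp_bound hx
  gcongr

lemma Str.trace_S (h : Str m ν e P b) (U : Ultrafilter ℝ) (hU0 : (U : Filter ℝ) ≤ 𝓝[>] 0)
    {S : ι → ι → ι → ℝ} (hS : ∀ i j p, Lm ν U 2 (fun z => ⟪ac e P i, z⟫ * ⟪ac e P j, z⟫ * ⟪cc e P p, z⟫) (S i j p)) (p : ι) :
    ∑ i, S i i p = m / 4 * ⟪cc e P p, b⟫ := by
  have pg : PG (fun z : X => ∑ q, ⟪cc e P q, z⟫^2 * ⟪cc e P p, z⟫) :=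
    PG.sum _ fun q _ => ((PG.inner _).pow 2).mul (PG.inner _)
  have t1 : Lm ν U 2 (fun z : X => ∑ q, ⟪cc e P q, z⟫^2 * ⟪cc e P p, z⟫) 0 := by
    refine h.Lm_small hU0 (k := 0) (by norm_num) pg (C := ‖b‖^2 * ‖b‖) fun z hz => ?_
    rw [← Finset.sum_mul, ← norm_vp, abs_mul, abs_of_nonneg (by positivity), pow_zero, mul_one]
    gcongr
    · exact h.vp_bound hz
    · exact h.cc_bound hz p
  have t2 := Lm.add h hU0 (Lm.sum h hU0 fun i => hS i i p) t1
  rw [add_zero] at t2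
  have t3 := t2.congr (g := fun z => ⟪cc e P p, z⟫ * ‖z‖^2) ((PG.inner _).mul (PG.norm.pow 2)) fun z _ => by
    rw [norm_split e P z, mul_add, Finset.mul_sum, Finset.mul_sum]
    congr 1 <;> exact Finset.sum_congr rfl fun i _ => by ring
  have := trace_lemma h.unif h.zero U hU0 (PG.inner (cc e P p)) (fun z hz => h.cc_bound hz p) (h.fst (cc e P p)) t3.2
  rw [this, real_inner_comm]; ring

lemma Str.sum_S (h : Str m ν e P b) (U : Ultrafilter ℝ) (hU0 : (U : Filter ℝ) ≤ 𝓝[>] 0)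
    {S : ι → ι → ι → ℝ} (hS : ∀ i j p, Lm ν U 2 (fun z => ⟪ac e P i, z⟫ * ⟪ac e P j, z⟫ * ⟪cc e P p, z⟫) (S i j p))
    {l : ι → ℝ} {κ : ι → ι → ℝ} (hκ : ∑ i, ∑ j, κ i j * ⟪ac e P i, ac e P j⟫ = -‖b‖^2)
    (heq : ∀ x ∈ Sp ν, ⟪b, x⟫ * ‖wp e P x‖^2 + ⟪b, x⟫^2 / 2 -
          4 * ∑ i, ∑ j, ∑ p, S i j p * (⟪ac e P i, x⟫ * ⟪ac e P j, x⟫ * ⟪cc e P p, x⟫) =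
        ∑ i, l i * ⟪e i, x⟫ + ∑ i, ∑ j, κ i j * (⟪e i, x⟫ * ⟪e j, x⟫)) :
    4 * ∑ i, ∑ j, ∑ p, S i j p ^ 2 = ‖b‖^2 / 2 + m / 4 * ‖b‖^2 := by
  have r1 : Lm ν U 2 (fun z => ∑ i, l i * ⟪e i, z⟫) 0 := by
    have : Lm ν U 2 (fun z => ∑ i, l i * ⟪e i, z⟫) (∑ i, l i * 0) := Lm.sum h hU0 fun i => Lm.cmul (l i)
      (h.Lm_small hU0 (k := 1) (C := 1) (by norm_num) (PG.inner (e i)) fun z _ => by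
        simpa using abs_real_inner_le_norm (e i) z)
    simpa using this
  have r2 : Lm ν U 2 (fun z => ∑ i, ∑ j, κ i j * (⟪e i, z⟫ * ⟪e j, z⟫)) (1/2 * (-‖b‖^2)) := by
    rw [← hκ]
    have : Lm ν U 2 (fun z => ∑ i, ∑ j, κ i j * (⟪e i, z⟫ * ⟪e j, z⟫)) (∑ i, ∑ j, κ i j * (1/2 * ⟪wp e P (e i), wp e P (e j)⟫)) :=
      Lm.sum h hU0 fun i => Lm.sum h hU0 fun j => (h.Lm_two hU0 (e i) (e j)).cmul (κ i j)
    convert this using 1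
    simp only [wp_e, Finset.mul_sum]
    exact Finset.sum_congr rfl fun i _ => Finset.sum_congr rfl fun j _ => by ring
  have r := Lm.add h hU0 r1 r2
  have s1 : Lm ν U 2 (fun z => ∑ p, ⟪cc e P p, b⟫ * ∑ i, ⟪ac e P i, z⟫ * ⟪ac e P i, z⟫ * ⟪cc e P p, z⟫) (m / 4 * ‖b‖^2) := by
    have : Lm ν U 2 (fun z => ∑ p, ⟪cc e P p, b⟫ * ∑ i, ⟪ac e P i, z⟫ * ⟪ac e P i, z⟫ * ⟪cc e P p, z⟫)
      (∑ p, ⟪cc e P p, b⟫ * ∑ i, S i i p) :=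
      Lm.sum h hU0 fun p => Lm.cmul _ (Lm.sum h hU0 fun i => hS i i p)
    convert this using 1
    rw [← h.norm_b, Finset.mul_sum]
    exact Finset.sum_congr rfl fun p _ => by rw [h.trace_S U hU0 hS]; ring
  have s2 : Lm ν U 2 (fun z => ⟪b, z⟫^2) 0 :=
    h.Lm_small hU0 (k := 0) (C := (‖b‖^2)^2) (by norm_num) ((PG.inner b).pow 2) fun z hz => by
      rw [abs_pow, pow_zero, mul_one]
      have := h.inner_b_bound hz
      gcongr
  have s3 : Lm ν U 2 (fun z => ∑ i, ∑ j, ∑ p, S i j p * (⟪ac e P i, z⟫ * ⟪ac e P j, z⟫ * ⟪cc e P p, z⟫))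
      (∑ i, ∑ j, ∑ p, S i j p * S i j p) :=
    Lm.sum h hU0 fun i => Lm.sum h hU0 fun j => Lm.sum h hU0 fun p => (hS i j p).cmul _
  have s := (Lm.add h hU0 (Lm.add h hU0 s1 (s2.cmul (1/2))) (s3.cmul (-4))).congr r.1 fun z hz => by
    rw [← heq z hz]
    have : ∑ p, ⟪cc e P p, b⟫ * ∑ i, ⟪ac e P i, z⟫ * ⟪ac e P i, z⟫ * ⟪cc e P p, z⟫ = ⟪b, z⟫ * ‖wp e P z‖^2 := by
      rw [h.inner_b', norm_wp, Finset.sum_mul]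
      refine Finset.sum_congr rfl fun p _ => ?_
      rw [Finset.mul_sum, Finset.mul_sum]
      exact Finset.sum_congr rfl fun i _ => by ring
    rw [this]; ring
  have := s.unique r
  simp only [← pow_two] at this
  linarith

lemma norm4_polar (a b c d : X) :
    ‖a + b + c + d‖^4 - ‖a + b + c - d‖^4 - ‖a + b - c + d‖^4 + ‖a + b - c - d‖^4
      - ‖a - b + c + d‖^4 + ‖a - b + c - d‖^4 + ‖a - b - c + d‖^4 - ‖a - b - c - d‖^4 =
    64 * (⟪a, b⟫ * ⟪c, d⟫ + ⟪a, c⟫ * ⟪b, d⟫ + ⟪a, d⟫ * ⟪b, c⟫) := by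
  have e4 : ∀ u : X, ‖u‖^4 = ⟪u, u⟫^2 := fun u => by rw [real_inner_self_eq_norm_sq]; ring
  simp only [e4, inner_add_left, inner_sub_left, inner_add_right, inner_sub_right]
  rw [real_inner_comm a b, real_inner_comm a c, real_inner_comm a d, real_inner_comm b c, real_inner_comm b d,
    real_inner_comm c d]
  ring

lemma Str.Lm_four (h : Str m ν e P b) {U : Filter ℝ} (hU0 : U ≤ 𝓝[>] 0)
    (h4 : ∀ u ∈ planeOf e P, Lm ν U 4 (fun z => ⟪u, z⟫^4) (3/4 * ‖u‖^4)) {a b c d : X}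
    (ha : a ∈ planeOf e P) (hb : b ∈ planeOf e P) (hc : c ∈ planeOf e P) (hd : d ∈ planeOf e P) :
    Lm ν U 4 (fun z => (⟪a, z⟫ * ⟪b, z⟫) * (⟪c, z⟫ * ⟪d, z⟫))
      (1/4 * (⟪a, b⟫ * ⟪c, d⟫ + ⟪a, c⟫ * ⟪b, d⟫ + ⟪a, d⟫ * ⟪b, c⟫)) := by
  have hab := add_mem ha hb
  have hab' := sub_mem ha hb
  have m1 := h4 _ (add_mem (add_mem hab hc) hd)
  have m2 := h4 _ (sub_mem (add_mem hab hc) hd)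
  have m3 := h4 _ (add_mem (sub_mem hab hc) hd)
  have m4 := h4 _ (sub_mem (sub_mem hab hc) hd)
  have m5 := h4 _ (add_mem (add_mem hab' hc) hd)
  have m6 := h4 _ (sub_mem (add_mem hab' hc) hd)
  have m7 := h4 _ (add_mem (sub_mem hab' hc) hd)
  have m8 := h4 _ (sub_mem (sub_mem hab' hc) hd)
  have t := Lm.add h hU0 (Lm.add h hU0 (Lm.add h hU0 (m1.cmul (1/192)) (m2.cmul (-1/192)))
    (Lm.add h hU0 (m3.cmul (-1/192)) (m4.cmul (1/192))))
    (Lm.add h hU0 (Lm.add h hU0 (m5.cmul (-1/192)) (m6.cmul (1/192)))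
    (Lm.add h hU0 (m7.cmul (1/192)) (m8.cmul (-1/192))))
  have t' := t.congr (g := fun z => (⟪a, z⟫ * ⟪b, z⟫) * (⟪c, z⟫ * ⟪d, z⟫))
    (((PG.inner a).mul (PG.inner b)).mul ((PG.inner c).mul (PG.inner d))) fun z _ => by
      simp only [inner_add_left, inner_sub_left]; ring
  convert t' using 1
  have := norm4_polar a b c d
  linear_combination (-1/256) * this

end stage6
end FT

namespace FT

section stage7
variable {X : Type*} [NormedAddCommGroup X] [InnerProductSpace ℝ X] [FiniteDimensional ℝ X]
  [MeasurableSpace X] [BorelSpace X]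
variable {m : ℕ} {ν : Measure X} {ι : Type*} [Fintype ι]
variable {e : OrthonormalBasis ι ℝ X} {P : Finset ι} {b : X}

lemma g_contract (e : OrthonormalBasis ι ℝ X) (P : Finset ι) {x : ι → ι → ℝ} (hx : ∀ i ∉ P, x i i = 0) :
    ∑ i, ∑ j, ⟪ac e P i, ac e P j⟫ * x i j = ∑ i, x i i := by
  classical
  refine Finset.sum_congr rfl fun i _ => ?_
  rw [Finset.sum_eq_single i]
  · rw [inner_ac_ac]
    by_cases h : i ∈ P
    · simp [h]
    · simp [h, hx i h]
  · intro j _ hj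
    rw [inner_ac_ac]; simp [Ne.symm hj]
  · simp

lemma g_project (e : OrthonormalBasis ι ℝ X) (P : Finset ι) {x : ι → ι → ℝ} (hx : ∀ i j, i ∉ P ∨ j ∉ P → x i j = 0) (i j : ι) :
    ∑ k, ∑ l, ⟪ac e P i, ac e P k⟫ * ⟪ac e P j, ac e P l⟫ * x k l = x i j := by
  classical
  rw [Finset.sum_eq_single i, Finset.sum_eq_single j]
  · rw [inner_ac_ac, inner_ac_ac]
    by_cases h : i ∈ P <;> by_cases h' : j ∈ P
    · simp [h, h']
    · simp [hx i j (Or.inr h')]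
    · simp [hx i j (Or.inl h)]
    · simp [hx i j (Or.inl h)]
  · intro l _ hl
    rw [inner_ac_ac e P j l]; simp [Ne.symm hl]
  · simp
  · intro k _ hk
    rw [inner_ac_ac e P i k]; simp [Ne.symm hk]
  · simp

/-- contraction of two symmetric trace-free forms with the isotropic fourth moment tensor -/
lemma four_contract (e : OrthonormalBasis ι ℝ X) (P : Finset ι) {x : ι → ι → ℝ} (hx : ∀ i j, i ∉ P ∨ j ∉ P → x i j = 0)
    (hs : ∀ i j, x i j = x j i) (ht : ∑ i, ∑ j, ⟪ac e P i, ac e P j⟫ * x i j = 0) :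
    ∑ i, ∑ j, ∑ k, ∑ l, (x i j * x k l) * (1/4 * (⟪ac e P i, ac e P j⟫ * ⟪ac e P k, ac e P l⟫ +
      ⟪ac e P i, ac e P k⟫ * ⟪ac e P j, ac e P l⟫ + ⟪ac e P i, ac e P l⟫ * ⟪ac e P j, ac e P k⟫)) =
      1/2 * ∑ i, ∑ j, x i j ^ 2 := by
  have e1 : ∀ i j, ∑ k, ∑ l, (x i j * x k l) * (1/4 * (⟪ac e P i, ac e P j⟫ * ⟪ac e P k, ac e P l⟫ +
      ⟪ac e P i, ac e P k⟫ * ⟪ac e P j, ac e P l⟫ + ⟪ac e P i, ac e P l⟫ * ⟪ac e P j, ac e P k⟫)) =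
      x i j / 4 * ⟪ac e P i, ac e P j⟫ * (∑ k, ∑ l, ⟪ac e P k, ac e P l⟫ * x k l) +
      x i j / 4 * (∑ k, ∑ l, ⟪ac e P i, ac e P k⟫ * ⟪ac e P j, ac e P l⟫ * x k l) +
      x i j / 4 * (∑ k, ∑ l, ⟪ac e P j, ac e P k⟫ * ⟪ac e P i, ac e P l⟫ * x k l) := by
    intro i j
    simp only [Finset.mul_sum, ← Finset.sum_add_distrib]
    exact Finset.sum_congr rfl fun k _ => Finset.sum_congr rfl fun l _ => by ring
  simp only [e1, ht, g_project e P hx, Finset.mul_sum]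
  refine Finset.sum_congr rfl fun i _ => Finset.sum_congr rfl fun j _ => ?_
  rw [hs j i]; ring

set_option maxHeartbeats 1600000 in
lemma Str.b_zero (h : Str m ν e P b) : b = 0 := by
  let U : Ultrafilter ℝ := Ultrafilter.of (𝓝[>] 0)
  have hU0 : (U : Filter ℝ) ≤ 𝓝[>] 0 := Ultrafilter.of_le _
  obtain ⟨S, hS0⟩ := h.S_exists U hU0
  obtain ⟨P4, hP4⟩ := h.P4_exists U hU0
  obtain ⟨hq, l, κ, hκ, heq⟩ := h.eqn2 U hU0 hS0 hP4
  have hS : ∀ i j p, Lm ν U 2 (fun z => ⟪ac e P i, z⟫ * ⟪ac e P j, z⟫ * ⟪cc e P p, z⟫) (S i j p) :=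
    fun i j p => ⟨((PG.inner _).mul (PG.inner _)).mul (PG.inner _), hS0 i j p⟩
  have h4 : ∀ u ∈ planeOf e P, Lm ν U 4 (fun z => ⟪u, z⟫^4) (3/4 * ‖u‖^4) := fun u hu =>
    ⟨(PG.inner u).pow 4, by rw [← hq u hu]; exact hP4 u⟩
  have hsum := h.sum_S U hU0 hS hκ heq
  have htr := h.trace_S U hU0 hS
  have hsym : ∀ i j p, S i j p = S j i p := fun i j p =>
    (hS i j p).unique ((hS j i p).congr (hS i j p).1 fun z _ => by ring)
  have hac : ∀ i ∉ P, ac e P i = 0 := fun i hi => by unfold ac; simp [hi]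
  have hzero : ∀ i j p, i ∉ P ∨ j ∉ P → S i j p = 0 := by
    intro i j p hij
    refine (hS i j p).unique (h.Lm_small hU0 (k := 0) (C := 0) (by norm_num) (hS i j p).1 fun z _ => ?_)
    rcases hij with hi | hi <;> simp [hac _ hi]
  set g : ι → ι → ℝ := fun i j => ⟪ac e P i, ac e P j⟫ with hg
  have hgz : ∀ i j, i ∉ P ∨ j ∉ P → g i j = 0 := by
    rintro i j (hi | hi) <;> simp [hg, hac _ hi]
  set β : ι → ℝ := fun p => ⟪cc e P p, b⟫ with hβ
  have hββ : ∑ p, β p ^ 2 = ‖b‖^2 := h.norm_b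
  set T : ι → ι → ι → ℝ := fun i j p => S i j p - g i j * β p / 4 with hT
  have hTz : ∀ p i j, i ∉ P ∨ j ∉ P → T i j p = 0 := fun p i j hij => by
    simp [hT, hzero i j p hij, hgz i j hij]
  have hTs : ∀ p i j, T i j p = T j i p := fun p i j => by
    simp only [hT, hg]; rw [hsym i j p, real_inner_comm]
  have hgS : ∀ p, ∑ i, ∑ j, g i j * S i j p = m / 4 * β p := fun p => by
    rw [g_contract e P fun i hi => hzero i i p (Or.inl hi)]; exact htr p
  have hgg : ∑ i, ∑ j, g i j * g i j = m := h.trace_sq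
  have hTt : ∀ p, ∑ i, ∑ j, g i j * T i j p = 0 := fun p => by
    have : ∑ i, ∑ j, g i j * T i j p = ∑ i, ∑ j, g i j * S i j p - β p / 4 * ∑ i, ∑ j, g i j * g i j := by
      simp only [Finset.mul_sum, ← Finset.sum_sub_distrib]
      exact Finset.sum_congr rfl fun i _ => Finset.sum_congr rfl fun j _ => by simp only [hT]; ring
    rw [this, hgS, hgg]; ring
  have hTT0 : ∀ p, ∑ i, ∑ j, T i j p ^ 2 = ∑ i, ∑ j, S i j p ^ 2 - m / 16 * β p ^ 2 := fun p => by
    have : ∑ i, ∑ j, T i j p ^ 2 = ∑ i, ∑ j, S i j p ^ 2 - β p / 2 * (∑ i, ∑ j, g i j * S i j p) +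
        β p ^2 / 16 * ∑ i, ∑ j, g i j * g i j := by
      simp only [Finset.mul_sum, ← Finset.sum_sub_distrib, ← Finset.sum_add_distrib]
      exact Finset.sum_congr rfl fun i _ => Finset.sum_congr rfl fun j _ => by simp only [hT]; ring
    rw [this, hgS, hgg]; ring
  have hcomm : ∑ i, ∑ j, ∑ p, S i j p ^ 2 = ∑ p, ∑ i, ∑ j, S i j p ^ 2 := by
    refine Eq.trans (Finset.sum_congr rfl fun i _ => Finset.sum_comm) Finset.sum_comm
  have hTT : ∑ p, ∑ i, ∑ j, T i j p ^ 2 = ‖b‖^2 / 8 := by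
    simp only [hTT0]
    rw [Finset.sum_sub_distrib, ← Finset.mul_sum, hββ, ← hcomm]
    linarith
  set Q : ι → X → ℝ := fun p z => ∑ i, ∑ j, T i j p * (⟪ac e P i, z⟫ * ⟪ac e P j, z⟫) with hQ
  have pgQ : ∀ p, PG (Q p) := fun p => PG.sum _ fun i _ => PG.sum _ fun j _ =>
    ((PG.inner _).mul (PG.inner _)).cmul _
  have L1 : Lm ν U 2 (fun z => ∑ p, Q p z * (⟪cc e P p, z⟫ - β p / 2)) (‖b‖^2 / 8) := by
    rw [← hTT]
    refine Lm.sum h hU0 fun p => ?_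
    have t : Lm ν U 2 (fun z => ∑ i, ∑ j, T i j p * ((⟪ac e P i, z⟫ * ⟪ac e P j, z⟫ * ⟪cc e P p, z⟫) +
        (-β p / 2) * (⟪ac e P i, z⟫ * ⟪ac e P j, z⟫)))
        (∑ i, ∑ j, T i j p * (S i j p + (-β p / 2) * (1/2 * ⟪wp e P (ac e P i), wp e P (ac e P j)⟫))) :=
      Lm.sum h hU0 fun i => Lm.sum h hU0 fun j => Lm.cmul _ (Lm.add h hU0 (hS i j p) ((h.Lm_two hU0 _ _).cmul _))
    have t2 := t.congr (g := fun z => Q p z * (⟪cc e P p, z⟫ - β p / 2)) ((pgQ p).mul ((PG.inner _).sub (PG.const _))) fun z _ => by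
      simp only [hQ, Finset.sum_mul]
      exact Finset.sum_congr rfl fun i _ => Finset.sum_congr rfl fun j _ => by ring
    convert t2 using 1
    refine Finset.sum_congr rfl fun i _ => Finset.sum_congr rfl fun j _ => ?_
    rw [wp_of_mem e P (ac_mem e P i), wp_of_mem e P (ac_mem e P j)]
    simp only [hT, hg]; ring
  have L2 : Lm ν U 4 (fun z => ∑ p, Q p z ^ 2) (‖b‖^2 / 16) := by
    have e0 : ‖b‖^2 / 16 = ∑ p, 1/2 * ∑ i, ∑ j, T i j p ^ 2 := by
      rw [← Finset.mul_sum, hTT]; ring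
    rw [e0]
    refine Lm.sum h hU0 fun p => ?_
    rw [← four_contract e P (x := fun i j => T i j p) (hTz p) (hTs p) (hTt p)]
    have t : Lm ν U 4 (fun z => ∑ i, ∑ j, ∑ k, ∑ l, (T i j p * T k l p) * ((⟪ac e P i, z⟫ * ⟪ac e P j, z⟫) * (⟪ac e P k, z⟫ * ⟪ac e P l, z⟫)))
        (∑ i, ∑ j, ∑ k, ∑ l, (T i j p * T k l p) * (1/4 * (⟪ac e P i, ac e P j⟫ * ⟪ac e P k, ac e P l⟫ +
      ⟪ac e P i, ac e P k⟫ * ⟪ac e P j, ac e P l⟫ + ⟪ac e P i, ac e P l⟫ * ⟪ac e P j, ac e P k⟫))) :=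
      Lm.sum h hU0 fun i => Lm.sum h hU0 fun j => Lm.sum h hU0 fun k => Lm.sum h hU0 fun l =>
        Lm.cmul _ (h.Lm_four hU0 h4 (ac_mem e P i) (ac_mem e P j) (ac_mem e P k) (ac_mem e P l))
    refine t.congr ((pgQ p).pow 2) fun z _ => ?_
    simp only [hQ, pow_two, Finset.sum_mul, Finset.mul_sum]
    exact Finset.sum_congr rfl fun i _ => Finset.sum_congr rfl fun j _ => Finset.sum_congr rfl fun k _ =>
      Finset.sum_congr rfl fun l _ => by ring
  by_contra hb
  have hbpos : 0 < ‖b‖ := norm_pos_iff.2 hb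
  -- bound for the quadratic forms
  set M : ℝ := ∑ p, (∑ i, ∑ j, |T i j p|)^2 with hM
  have hM0 : 0 ≤ M := Finset.sum_nonneg fun _ _ => sq_nonneg _
  have hQM : ∀ z, ∑ p, Q p z ^ 2 ≤ M * ‖z‖^4 := by
    intro z
    rw [hM, Finset.sum_mul]
    refine Finset.sum_le_sum fun p _ => ?_
    have hQp : |Q p z| ≤ (∑ i, ∑ j, |T i j p|) * ‖z‖^2 := by
      simp only [hQ, Finset.sum_mul]
      refine (Finset.abs_sum_le_sum_abs _ _).trans (Finset.sum_le_sum fun i _ => ?_)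
      refine (Finset.abs_sum_le_sum_abs _ _).trans (Finset.sum_le_sum fun j _ => ?_)
      rw [abs_mul, abs_mul]
      have a1 : ∀ i, |⟪ac e P i, z⟫| ≤ ‖z‖ := fun i => (abs_real_inner_le_norm _ _).trans
        (mul_le_of_le_one_left (norm_nonneg _) (norm_ac_le e P i))
      rw [pow_two]
      gcongr
      · exact a1 i
      · exact a1 j
    calc Q p z ^ 2 = |Q p z|^2 := (sq_abs _).symm
      _ ≤ ((∑ i, ∑ j, |T i j p|) * ‖z‖^2)^2 := by gcongr
      _ = _ := by ring
  set δ : ℝ := min 1 (‖b‖^2 / (64 * (M + 1))) with hδ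
  have hδ0 : 0 < δ := by positivity
  have hδ1 : 4 * (M * δ^4) ≤ ‖b‖^2 / 16 := by
    have h1 : δ ≤ 1 := min_le_left _ _
    have h2 : δ ≤ ‖b‖^2 / (64 * (M + 1)) := min_le_right _ _
    have h3 : δ^4 ≤ δ := by
      calc δ^4 ≤ δ^1 := pow_le_pow_of_le_one hδ0.le h1 (by norm_num)
        _ = δ := pow_one _
    rw [le_div_iff₀ (by positivity)] at h2
    nlinarith
  obtain ⟨q, hq0, hqm⟩ := GP_mass h.unif h.zero hδ0
  have Lim : Tendsto (fun σ => ‖b‖^2 / 4 + (-4) * (σ^2 * ∫ z, ∑ p, Q p z * (⟪cc e P p, z⟫ - β p / 2) ∂(GP ν σ)) +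
      4 * (σ^4 * ∫ z, ∑ p, Q p z ^ 2 ∂(GP ν σ))) U (𝓝 (‖b‖^2 / 4 + (-4) * (‖b‖^2 / 8) + 4 * (‖b‖^2 / 16))) :=
    ((L1.2.const_mul (-4)).const_add _).add (L2.2.const_mul 4)
  have : q * (‖b‖^2 / 16) ≤ ‖b‖^2 / 4 + (-4) * (‖b‖^2 / 8) + 4 * (‖b‖^2 / 16) := by
    refine ge_of_tendsto Lim ?_
    filter_upwards [hU0 self_mem_nhdsWithin] with σ hσ
    have hσ : 0 < σ := hσ
    haveI := GP_prob h.unif h.zero hσ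
    have i1 := L1.1.int h.unif h.zero hσ
    have i2 := L2.1.int h.unif h.zero hσ
    have e1 : ‖b‖^2 / 4 + (-4) * (σ^2 * ∫ z, ∑ p, Q p z * (⟪cc e P p, z⟫ - β p / 2) ∂(GP ν σ)) +
      4 * (σ^4 * ∫ z, ∑ p, Q p z ^ 2 ∂(GP ν σ)) =
      ∫ z, (‖b‖^2 / 4 + (-4 * σ^2) * (∑ p, Q p z * (⟪cc e P p, z⟫ - β p / 2)) + (4 * σ^4) * ∑ p, Q p z ^ 2) ∂(GP ν σ) := by
      have i3 : Integrable (fun z => ‖b‖^2 / 4 + (-4 * σ^2) * (∑ p, Q p z * (⟪cc e P p, z⟫ - β p / 2))) (GP ν σ) :=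
        (integrable_const _).add (i1.const_mul _)
      rw [integral_add i3 (i2.const_mul _),
        integral_add (integrable_const _) (i1.const_mul _), integral_const_mul, integral_const_mul, integral_const]
      simp; ring
    have hmeas : MeasurableSet {z : X | σ * ‖z‖ ≤ δ} := measurableSet_le (by fun_prop) (by fun_prop)
    have e2 : q * (‖b‖^2 / 16) = ∫ z, {z : X | σ * ‖z‖ ≤ δ}.indicator (fun _ => ‖b‖^2 / 16) z ∂(GP ν σ) := by
      rw [integral_indicator_const _ hmeas, hqm σ hσ, smul_eq_mul]
    rw [e1, e2]
    refine integral_mono_ae ((integrable_const _).indicator hmeas)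
      (((integrable_const _).add (i1.const_mul _)).add (i2.const_mul _)) ?_
    filter_upwards [GP_ae ν σ] with z hz
    have k1 : ∑ p, (⟪cc e P p, z⟫ - β p / 2)^2 = ‖b‖^2 / 4 := by
      have : ∑ p, (⟪cc e P p, z⟫ - β p / 2)^2 = ∑ p, ⟪cc e P p, z⟫^2 - (∑ p, β p * ⟪cc e P p, z⟫) + 1/4 * ∑ p, β p ^ 2 := by
        simp only [Finset.mul_sum, ← Finset.sum_sub_distrib, ← Finset.sum_add_distrib]
        exact Finset.sum_congr rfl fun i _ => by ring
      rw [this, hββ, ← h.inner_b', ← norm_vp, h.hv z hz]; ring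
    have k2 : ‖b‖^2 / 4 + (-4 * σ^2) * (∑ p, Q p z * (⟪cc e P p, z⟫ - β p / 2)) + (4 * σ^4) * ∑ p, Q p z ^ 2 =
        ∑ p, (⟪cc e P p, z⟫ - β p / 2 - 2 * σ^2 * Q p z)^2 := by
      rw [← k1]
      simp only [Finset.mul_sum, ← Finset.sum_add_distrib]
      exact Finset.sum_congr rfl fun i _ => by ring
    by_cases hzδ : σ * ‖z‖ ≤ δ
    · rw [Set.indicator_of_mem (show z ∈ {z : X | σ * ‖z‖ ≤ δ} from hzδ)]
      show _ ≤ ‖b‖^2 / 4 + (-4 * σ^2) * (∑ p, Q p z * (⟪cc e P p, z⟫ - β p / 2)) + (4 * σ^4) * ∑ p, Q p z ^ 2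
      rw [k2]
      have k3 : ∑ p, (1/2 * (⟪cc e P p, z⟫ - β p / 2)^2 - 4 * σ^4 * Q p z ^ 2) ≤ ∑ p, (⟪cc e P p, z⟫ - β p / 2 - 2 * σ^2 * Q p z)^2 :=
        Finset.sum_le_sum fun p _ => by
          nlinarith [sq_nonneg ((⟪cc e P p, z⟫ - β p / 2) - 4 * σ^2 * Q p z)]
      rw [Finset.sum_sub_distrib, ← Finset.mul_sum, ← Finset.mul_sum, k1] at k3
      have k4 : σ^4 * ∑ p, Q p z ^ 2 ≤ M * δ^4 := by
        calc σ^4 * ∑ p, Q p z ^ 2 ≤ σ^4 * (M * ‖z‖^4) := by gcongr; exact hQM z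
          _ = M * (σ * ‖z‖)^4 := by ring
          _ ≤ M * δ^4 := by gcongr
      linarith
    · rw [Set.indicator_of_notMem (show z ∉ {z : X | σ * ‖z‖ ≤ δ} from hzδ)]
      show _ ≤ ‖b‖^2 / 4 + (-4 * σ^2) * (∑ p, Q p z * (⟪cc e P p, z⟫ - β p / 2)) + (4 * σ^4) * ∑ p, Q p z ^ 2
      rw [k2]
      exact Finset.sum_nonneg fun _ _ => sq_nonneg _
  have : 0 < q * (‖b‖^2 / 16) := by positivity
  linarith

theorem theoremU (hU : Unif m ν) (h0 : (0:X) ∈ Sp ν)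
    (hG : ∀ R₀ : ℝ, ∃ R > R₀, Good m (eps0 m) (Sp ν) R) :
    ∃ W : Submodule ℝ X, finrank ℝ W = m ∧ Sp ν = W := by
  obtain ⟨e, P, b, h⟩ := exists_Str hU h0 hG
  have hb := h.b_zero
  have hW : finrank ℝ (planeOf e P) = m := by rw [planeOf_finrank, h.card]
  refine ⟨planeOf e P, hW, lemmaF hU h0 _ hW fun x hx => ?_⟩
  have h1 := h.hv x hx
  rw [hb, inner_zero_left] at h1
  have h2 : vp e P x = 0 := by simpa using h1
  have := wp_add_vp e P x
  rw [h2, add_zero] at this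
  rw [← this]
  exact wp_mem e P x

end stage7
end FT

namespace FT

section aod
variable {X : Type*} [NormedAddCommGroup X] [InnerProductSpace ℝ X] [FiniteDimensional ℝ X]
  [MeasurableSpace X] [BorelSpace X]
variable {m : ℕ} {μ : Measure X} {α : Type*}

def AODg (m : ℕ) (μ : Measure X) : Prop :=
  ∀ K : Set X, K ⊆ Sp μ → IsCompact K → ∀ δ : ℝ, 0 < δ →
    ∃ r₀ : ℝ, 0 < r₀ ∧ ∀ x ∈ K, ∀ r : ℝ, 0 < r → r ≤ r₀ →
      ∀ τ : ℝ, τ ∈ Set.Icc (1/2 : ℝ) 1 →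
        |(μ (closedBall x (τ * r))).toReal / (μ (closedBall x r)).toReal - τ ^ m| < δ

def mb (μ : Measure X) (x : X) (r : ℝ) : ℝ := (μ (closedBall x r)).toReal

lemma mb_pos [IsLocallyFiniteMeasure μ] {x : X} (hx : x ∈ Sp μ) {r : ℝ} (hr : 0 < r) : 0 < mb μ x r :=
  ENNReal.toReal_pos (hx r hr).ne' measure_closedBall_lt_top.ne

lemma mb_mono [IsLocallyFiniteMeasure μ] {x y : X} {r s : ℝ} (h : dist x y + r ≤ s) : mb μ x r ≤ mb μ y s :=
  ENNReal.toReal_mono measure_closedBall_lt_top.ne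
    (measure_mono (closedBall_subset_closedBall' (by linarith)))

lemma ratio_small [IsLocallyFiniteMeasure μ] (hA : AODg m μ) {x : X} (hx : x ∈ Sp μ) {U : Filter α} {y : α → X}
    (hy : ∀ᶠ i in U, y i ∈ Sp μ ∩ closedBall x 1) (k : ℕ) :
    ∀ ρ : ℝ, (1/2)^k ≤ ρ → ρ ≤ 1 → ∀ s : α → ℝ, (∀ i, 0 < s i) → Tendsto s U (𝓝 0) →
      Tendsto (fun i => mb μ (y i) (ρ * s i) / mb μ (y i) (s i)) U (𝓝 (ρ^m)) := by
  have base : ∀ ρ : ℝ, 1/2 ≤ ρ → ρ ≤ 1 → ∀ s : α → ℝ, (∀ i, 0 < s i) → Tendsto s U (𝓝 0) →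
      Tendsto (fun i => mb μ (y i) (ρ * s i) / mb μ (y i) (s i)) U (𝓝 (ρ^m)) := by
    intro ρ h1 h2 s hs hs0
    rw [Metric.tendsto_nhds]
    intro δ hδ
    obtain ⟨r₀, hr₀, H⟩ := hA (Sp μ ∩ closedBall x 1) inter_subset_left
      ((isCompact_closedBall x 1).inter_left (Sp_closed μ)) δ hδ
    filter_upwards [hy, hs0.eventually (Iio_mem_nhds hr₀)] with i hi hi2
    exact H _ hi _ (hs i) (le_of_lt hi2) ρ ⟨h1, h2⟩
  induction k with
  | zero =>
    intro ρ h1 h2 s hs hs0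
    exact base ρ (by simp at h1; linarith) h2 s hs hs0
  | succ k ih =>
    intro ρ h1 h2 s hs hs0
    by_cases hρ : 1/2 ≤ ρ
    · exact base ρ hρ h2 s hs hs0
    · push Not at hρ
      have hρ0 : 0 < ρ := lt_of_lt_of_le (by positivity) h1
      have t1 := base (1/2) le_rfl (by norm_num) (fun i => (2 * ρ) * s i) (fun i => by have := hs i; positivity)
        (by simpa using hs0.const_mul (2 * ρ))
      have t2 := ih (2 * ρ) (by rw [pow_succ] at h1; linarith) (by linarith) s hs hs0
      have t3 := t1.mul t2
      rw [← mul_pow] at t3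
      have e1 : 1/2 * (2 * ρ) = ρ := by ring
      rw [e1] at t3
      refine t3.congr' ?_
      filter_upwards [hy] with i hi
      have p1 := mb_pos hi.1 (hs i)
      have p2 := mb_pos hi.1 (show 0 < 2 * ρ * s i by have := hs i; positivity)
      rw [show 1/2 * (2 * ρ * s i) = ρ * s i by ring, div_mul_div_cancel₀ p2.ne']

lemma ratio_any [IsLocallyFiniteMeasure μ] (hA : AODg m μ) {x : X} (hx : x ∈ Sp μ) {U : Filter α} {y : α → X}
    (hy : ∀ᶠ i in U, y i ∈ Sp μ ∩ closedBall x 1) {ρ : ℝ} (hρ : 0 < ρ) {s : α → ℝ} (hs : ∀ i, 0 < s i)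
    (hs0 : Tendsto s U (𝓝 0)) :
      Tendsto (fun i => mb μ (y i) (ρ * s i) / mb μ (y i) (s i)) U (𝓝 (ρ^m)) := by
  have small : ∀ ρ : ℝ, 0 < ρ → ρ ≤ 1 → ∀ s : α → ℝ, (∀ i, 0 < s i) → Tendsto s U (𝓝 0) →
      Tendsto (fun i => mb μ (y i) (ρ * s i) / mb μ (y i) (s i)) U (𝓝 (ρ^m)) := by
    intro ρ h0 h1 s hs hs0
    obtain ⟨k, hk⟩ := exists_pow_lt_of_lt_one h0 (by norm_num : (1/2:ℝ) < 1)
    exact ratio_small hA hx hy k ρ hk.le h1 s hs hs0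
  by_cases h1 : ρ ≤ 1
  · exact small ρ hρ h1 s hs hs0
  · push Not at h1
    have t := small ρ⁻¹ (by positivity) (inv_le_one_of_one_le₀ h1.le) (fun i => ρ * s i)
      (fun i => by have := hs i; positivity) (by simpa using hs0.const_mul ρ)
    have t2 := t.inv₀ (by positivity)
    rw [inv_pow, inv_inv] at t2
    refine t2.congr fun i => ?_
    rw [inv_mul_cancel_left₀ hρ.ne', inv_div]

lemma center_change [IsLocallyFiniteMeasure μ] (hA : AODg m μ) {x : X} (hx : x ∈ Sp μ) {U : Filter α} {y : α → X}
    (hy : ∀ i, y i ∈ Sp μ) {t : α → ℝ} (ht : ∀ i, 0 < t i) (ht0 : Tendsto t U (𝓝 0))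
    {C : ℝ} (hC : ∀ i, ‖y i - x‖ ≤ C * t i) :
    Tendsto (fun i => mb μ (y i) (t i) / mb μ x (t i)) U (𝓝 1) := by
  have hyE : ∀ᶠ i in U, y i ∈ Sp μ ∩ closedBall x 1 := by
    have := ht0.const_mul C
    rw [mul_zero] at this
    filter_upwards [this.eventually (Iio_mem_nhds one_pos)] with i hi
    exact ⟨hy i, by rw [mem_closedBall, dist_eq_norm]; exact (hC i).trans (le_of_lt hi)⟩
  have hxE : ∀ᶠ i in U, (fun _ : α => x) i ∈ Sp μ ∩ closedBall x 1 := Eventually.of_forall fun i =>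
    ⟨hx, mem_closedBall_self zero_le_one⟩
  -- limits of the comparison factors
  have fac : ∀ c : ℝ, Tendsto (fun R : ℝ => ((R + c) / R)^m) atTop (𝓝 1) := by
    intro c
    have h1 : Tendsto (fun R : ℝ => 1 + c * R⁻¹) atTop (𝓝 (1 + c * 0)) :=
      (tendsto_inv_atTop_zero.const_mul c).const_add 1
    have h2 := h1.pow m
    simp only [mul_zero, add_zero, one_pow] at h2
    refine h2.congr' ?_
    filter_upwards [eventually_gt_atTop 0] with R hR
    congr 1; field_simp
  rw [tendsto_order]
  constructor
  · intro a ha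
    obtain ⟨R, hR1, hR2, hR3⟩ := (((fac (-C)).eventually (Ioi_mem_nhds ha)).and ((eventually_gt_atTop C).and (eventually_gt_atTop 0))).exists
    have hRC : 0 < R + -C := by linarith
    have q1 := (ratio_any hA hx hyE hR3 ht ht0).inv₀ (by positivity)
    have q2 := ratio_any hA hx hxE hRC ht ht0
    have q := q2.mul q1
    rw [← inv_pow, ← mul_pow, ← div_eq_mul_inv] at q
    filter_upwards [q.eventually (Ioi_mem_nhds hR1)] with i hi
    refine lt_of_lt_of_le hi ?_
    have p1 := mb_pos hx (ht i)
    have p2 := mb_pos (hy i) (ht i)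
    have p3 := mb_pos (hy i) (mul_pos hR3 (ht i))
    have : mb μ x ((R + -C) * t i) ≤ mb μ (y i) (R * t i) := mb_mono (by
      rw [dist_comm, dist_eq_norm]; nlinarith [hC i])
    rw [inv_div, div_mul_div_comm, div_le_div_iff₀ (by positivity) p1]
    nlinarith [mul_le_mul_of_nonneg_right this (mul_pos p1 p2).le]
  · intro a ha
    obtain ⟨R, hR1, hR2, hR3⟩ := (((fac C).eventually (Iio_mem_nhds ha)).and ((eventually_gt_atTop (-C)).and (eventually_gt_atTop 0))).exists
    have hRC : 0 < R + C := by linarith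
    have q1 := (ratio_any hA hx hyE hR3 ht ht0).inv₀ (by positivity)
    have q2 := ratio_any hA hx hxE hRC ht ht0
    have q := q2.mul q1
    rw [← inv_pow, ← mul_pow, ← div_eq_mul_inv] at q
    filter_upwards [q.eventually (Iio_mem_nhds hR1)] with i hi
    refine lt_of_le_of_lt ?_ hi
    have p1 := mb_pos hx (ht i)
    have p2 := mb_pos (hy i) (ht i)
    have p3 := mb_pos (hy i) (mul_pos hR3 (ht i))
    have : mb μ (y i) (R * t i) ≤ mb μ x ((R + C) * t i) := mb_mono (by
      rw [dist_eq_norm]; nlinarith [hC i])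
    rw [inv_div, div_mul_div_comm, div_le_div_iff₀ p1 (by positivity)]
    nlinarith [mul_le_mul_of_nonneg_right this (mul_pos p1 p2).le]

lemma blow_limit [IsLocallyFiniteMeasure μ] (hA : AODg m μ) {x : X} (hx : x ∈ Sp μ) (U : Ultrafilter α)
    {t : α → ℝ} (ht : ∀ i, 0 < t i) (ht0 : Tendsto t U (𝓝 0)) :
    ∃ ν : Measure X, Unif m ν ∧ (0:X) ∈ Sp ν ∧
      (∀ f : X → ℝ, Continuous f → HasCompactSupport f →
        Tendsto (fun i => ∫ y, f y ∂(blow μ x (t i) (mb μ x (t i))⁻¹)) U (𝓝 (∫ y, f y ∂ν))) ∧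
      ∀ z, z ∈ Sp ν ↔ ∀ ε : ℝ, 0 < ε → ∀ᶠ i in U, ∃ z', x + t i • z' ∈ Sp μ ∧ ‖z' - z‖ ≤ ε := by
  have hc : ∀ i, 0 < (mb μ x (t i))⁻¹ := fun i => inv_pos.2 (mb_pos hx (ht i))
  have hSp : ∀ i z, z ∈ Sp (blow μ x (t i) (mb μ x (t i))⁻¹) ↔ x + t i • z ∈ Sp μ := fun i z => blow_Sp μ x (ht i) (hc i) z
  obtain ⟨ν, h1, h2, h3, h4⟩ := compactness (m := m) U (fun i => blow μ x (t i) (mb μ x (t i))⁻¹)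
    (fun i => blow_locfin μ x (ht i) _) (fun i => by rw [hSp, smul_zero, add_zero]; exact hx) (by
      rintro z hz ⟨C, hC⟩ r hr
      have hy : ∀ i, x + t i • z i ∈ Sp μ := fun i => (hSp i _).1 (hz i)
      have hyn : ∀ i, ‖x + t i • z i - x‖ ≤ C * t i := fun i => by
        rw [add_sub_cancel_left, norm_smul, Real.norm_of_nonneg (ht i).le, mul_comm]
        exact mul_le_mul_of_nonneg_right (hC i) (ht i).le
      have hyE : ∀ᶠ i in (U : Filter α), x + t i • z i ∈ Sp μ ∩ closedBall x 1 := by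
        have := ht0.const_mul C
        rw [mul_zero] at this
        filter_upwards [this.eventually (Iio_mem_nhds one_pos)] with i hi
        exact ⟨hy i, by rw [mem_closedBall, dist_eq_norm]; exact (hyn i).trans (le_of_lt hi)⟩
      have t1 := (ratio_any hA hx hyE hr ht ht0).mul (center_change hA hx hy ht ht0 hyn)
      rw [mul_one] at t1
      refine t1.congr fun i => ?_
      have p1 := mb_pos hx (ht i)
      have p2 := mb_pos (hy i) (ht i)
      rw [blow_ball μ x (ht i), ENNReal.toReal_mul, ENNReal.toReal_ofReal (hc i).le]
      rw [show (μ (closedBall (x + t i • z i) (t i * r))).toReal = mb μ (x + t i • z i) (r * t i) by rw [mul_comm]; rfl]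
      field_simp)
  refine ⟨ν, h1, h2, h3, fun z => ?_⟩
  rw [h4]
  simp only [hSp]

end aod
end FT

namespace FT

section lims
variable {X : Type*} [NormedAddCommGroup X] [InnerProductSpace ℝ X] [FiniteDimensional ℝ X]
variable {m : ℕ} {α : Type*}

def Tl (U : Ultrafilter α) (t : α → ℝ) (S : Set X) : Set X :=
  {z | ∀ ε : ℝ, 0 < ε → ∀ᶠ i in U, ∃ z', t i • z' ∈ S ∧ ‖z' - z‖ ≤ ε}

lemma vec_lim (U : Ultrafilter α) {Y : Type*} [PseudoMetricSpace Y] [ProperSpace Y] {g : α → Y} {c : Y} {C : ℝ}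
    (h : ∀ᶠ i in U, g i ∈ closedBall c C) : ∃ l, Tendsto g U (𝓝 l) := by
  obtain ⟨l, _, hl⟩ := (isCompact_closedBall c C).ultrafilter_le_nhds (U.map g) (by
    rw [le_principal_iff]; exact h)
  exact ⟨l, hl⟩

lemma Tl_mem_of_tendsto {U : Ultrafilter α} {t : α → ℝ} {S : Set X} {z : α → X} {l : X}
    (hz : ∀ᶠ i in U, t i • z i ∈ S) (h : Tendsto z U (𝓝 l)) : l ∈ Tl U t S := by
  intro ε hε
  filter_upwards [hz, h.eventually (closedBall_mem_nhds l hε)] with i h1 h2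
  exact ⟨z i, h1, by rwa [dist_eq_norm] at h2⟩

lemma Tl_unif_in {U : Ultrafilter α} {t : α → ℝ} {S : Set X} {K : Set X} (hK : IsCompact K)
    (hKT : K ⊆ Tl U t S) {ε : ℝ} (hε : 0 < ε) :
    ∀ᶠ i in U, ∀ z ∈ K, ∃ z', t i • z' ∈ S ∧ ‖z' - z‖ ≤ ε := by
  obtain ⟨F, hF, hcov⟩ := hK.elim_nhds_subcover (fun z => ball z (ε/2)) (fun z _ => ball_mem_nhds z (by positivity))
  have : ∀ᶠ i in (U : Filter α), ∀ y ∈ F, ∃ z', t i • z' ∈ S ∧ ‖z' - y‖ ≤ ε/2 :=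
    (F.eventually_all).2 fun y hy => hKT (hF y hy) _ (by positivity)
  filter_upwards [this] with i hi z hz
  obtain ⟨y, hy, hzy⟩ := mem_iUnion₂.1 (hcov hz)
  obtain ⟨z', h1, h2⟩ := hi y hy
  refine ⟨z', h1, ?_⟩
  rw [mem_ball, dist_comm, dist_eq_norm] at hzy
  calc ‖z' - z‖ = ‖(z' - y) + (y - z)‖ := by rw [sub_add_sub_cancel]
    _ ≤ ‖z' - y‖ + ‖y - z‖ := norm_add_le _ _
    _ ≤ ε := by linarith

lemma Tl_unif_out {U : Ultrafilter α} {t : α → ℝ} {S : Set X} (R : ℝ) {ε : ℝ} (hε : 0 < ε) :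
    ∀ᶠ i in U, ∀ z', t i • z' ∈ S → ‖z'‖ ≤ R → ∃ z ∈ Tl U t S, ‖z' - z‖ ≤ ε := by
  by_contra hcon
  have h1 : ∀ᶠ i in (U : Filter α), ∃ z', t i • z' ∈ S ∧ ‖z'‖ ≤ R ∧ ∀ z ∈ Tl U t S, ε < ‖z' - z‖ := by
    have := Ultrafilter.eventually_not.2 hcon
    filter_upwards [this] with i hi
    push Not at hi
    exact hi
  choose! g hg using fun i (hi : ∃ z', t i • z' ∈ S ∧ ‖z'‖ ≤ R ∧ ∀ z ∈ Tl U t S, ε < ‖z' - z‖) => hi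
  obtain ⟨l, hl⟩ := vec_lim U (g := g) (c := 0) (C := R) (by
    filter_upwards [h1] with i hi
    simpa using (hg i hi).2.1)
  have hlT : l ∈ Tl U t S := Tl_mem_of_tendsto (by filter_upwards [h1] with i hi using (hg i hi).1) hl
  obtain ⟨i, hi1, hi2⟩ := (h1.and (hl.eventually (ball_mem_nhds l hε))).exists
  have := (hg i hi1).2.2 l hlT
  rw [dist_eq_norm] at hi2
  linarith

lemma good_of_plane {U : Ultrafilter α} {t : α → ℝ} (ht : ∀ i, 0 < t i) {S : Set X} {W : Submodule ℝ X}
    (hW : finrank ℝ W = m) (hT : Tl U t S = W) {ε : ℝ} (hε : 0 < ε) {δ M : ℝ} (hδ : 0 < δ) :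
    ∀ᶠ i in U, ∀ s : ℝ, δ ≤ s → s ≤ M → Good m ε S (s * t i) := by
  have hK : IsCompact ((W : Set X) ∩ closedBall 0 M) :=
    (isCompact_closedBall 0 M).inter_left W.closed_of_finiteDimensional
  filter_upwards [Tl_unif_in (S := S) (t := t) (U := U) hK (by rw [hT]; exact inter_subset_left) (mul_pos hε hδ)] with i hi s h1 h2
  have hs : 0 < s := hδ.trans_le h1
  let b := (stdOrthonormalBasis ℝ W).reindex (finCongr hW)
  refine ⟨fun j => (b j : X), ?_, fun w hw hw1 => ?_⟩
  · exact b.orthonormal.comp_linearIsometry W.subtypeₗᵢ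
  · have hwW : w ∈ W := by
      refine (Submodule.span_le.2 ?_) hw
      rintro _ ⟨j, rfl⟩
      exact (b j).2
    obtain ⟨z', hz, hz2⟩ := hi (s • w) ⟨W.smul_mem _ hwW, by
      rw [mem_closedBall_zero_iff, norm_smul, Real.norm_of_nonneg hs.le]
      nlinarith [norm_nonneg w]⟩
    refine ⟨_, hz, ?_⟩
    rw [mul_comm s, mul_smul, ← smul_sub, norm_smul, Real.norm_of_nonneg (ht i).le]
    have := ht i
    calc t i * ‖z' - s • w‖ ≤ t i * (ε * δ) := by gcongr
      _ ≤ t i * (ε * s) := by gcongr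
      _ = ε * (t i * s) := by ring

lemma good_lim {U : Ultrafilter α} {t : α → ℝ} (ht : ∀ i, 0 < t i) {S : Set X} {ε R : ℝ} (hR : 0 < R)
    (h : ∀ᶠ i in U, Good m ε S (R * t i)) : Good m ε (Tl U t S) R := by
  choose! v hv using fun i (hi : Good m ε S (R * t i)) => hi
  obtain ⟨l, hl⟩ := vec_lim U (g := v) (c := 0) (C := 1) (by
    filter_upwards [h] with i hi
    rw [mem_closedBall_zero_iff]
    refine (pi_norm_le_iff_of_nonneg zero_le_one).2 fun j => ((hv i hi).1.1 j).le)
  have hlj : ∀ j, Tendsto (fun i => v i j) U (𝓝 (l j)) := fun j => (tendsto_pi_nhds.1 hl) j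
  have hlo : Orthonormal ℝ l := by
    rw [orthonormal_iff_ite]
    intro j k
    refine tendsto_nhds_unique ((hlj j).inner (hlj k)) ?_
    refine tendsto_const_nhds.congr' ?_
    filter_upwards [h] with i hi
    exact ((orthonormal_iff_ite.1 (hv i hi).1) j k).symm
  refine ⟨l, hlo, fun w hw hw1 => ?_⟩
  obtain ⟨a, rfl⟩ := (Submodule.mem_span_range_iff_exists_fun ℝ).1 hw
  have hwi : Tendsto (fun i => ∑ j, a j • v i j) U (𝓝 (∑ j, a j • l j)) :=
    tendsto_finsetSum _ fun j _ => (hlj j).const_smul (a j)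
  have hnorm : ∀ u : Fin m → X, Orthonormal ℝ u → ‖∑ j, a j • u j‖^2 = ∑ j, (a j)^2 := by
    intro u hu
    rw [← real_inner_self_eq_norm_sq, hu.inner_sum]
    simp [sq]
  have hex : ∀ᶠ i in (U : Filter α), ∃ z, t i • z ∈ S ∧ ‖z - R • ∑ j, a j • v i j‖ ≤ ε * R ∧ ‖∑ j, a j • v i j‖ ≤ 1 := by
    filter_upwards [h] with i hi
    have hn : ‖∑ j, a j • v i j‖ ≤ 1 := by
      have e : ‖∑ j, a j • v i j‖^2 = ‖∑ j, a j • l j‖^2 := by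
        rw [hnorm _ (hv i hi).1, hnorm _ hlo]
      have := (sq_eq_sq₀ (norm_nonneg _) (norm_nonneg _)).1 e
      rwa [this]
    obtain ⟨y, hy, hy2⟩ := (hv i hi).2 (∑ j, a j • v i j)
      ((Submodule.mem_span_range_iff_exists_fun ℝ).2 ⟨a, rfl⟩) hn
    have hti := ht i
    refine ⟨(t i)⁻¹ • y, by rwa [smul_inv_smul₀ hti.ne'], ?_, hn⟩
    have e : (t i)⁻¹ • y - R • ∑ j, a j • v i j = (t i)⁻¹ • (y - (R * t i) • ∑ j, a j • v i j) := by
      rw [smul_sub, smul_smul, mul_comm R, inv_mul_cancel_left₀ hti.ne']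
    rw [e, norm_smul, norm_inv, Real.norm_of_nonneg hti.le, inv_mul_le_iff₀ hti]
    linarith
  choose! z hz using fun i (hi : ∃ z, t i • z ∈ S ∧ ‖z - R • ∑ j, a j • v i j‖ ≤ ε * R ∧ ‖∑ j, a j • v i j‖ ≤ 1) => hi
  obtain ⟨y, hy⟩ := vec_lim U (g := z) (c := 0) (C := ε * R + R) (by
    filter_upwards [hex] with i hi
    obtain ⟨h1, h2, h3⟩ := hz i hi
    rw [mem_closedBall_zero_iff]
    calc ‖z i‖ = ‖(z i - R • ∑ j, a j • v i j) + R • ∑ j, a j • v i j‖ := by rw [sub_add_cancel]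
      _ ≤ _ := norm_add_le _ _
      _ ≤ ε * R + R := by
        rw [norm_smul, Real.norm_of_nonneg hR.le]
        nlinarith)
  refine ⟨y, Tl_mem_of_tendsto (by filter_upwards [hex] with i hi using (hz i hi).1) hy, ?_⟩
  refine le_of_tendsto (hy.sub (hwi.const_smul R)).norm ?_
  filter_upwards [hex] with i hi using (hz i hi).2.1

end lims
end FT

namespace FT

section mainA
variable {X : Type*} [NormedAddCommGroup X] [InnerProductSpace ℝ X] [FiniteDimensional ℝ X]
  [MeasurableSpace X] [BorelSpace X]
variable {m : ℕ} {μ : Measure X} {α : Type*}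

def shf (μ : Measure X) (x : X) : Set X := {z | x + z ∈ Sp μ}

lemma plane_of_good [IsLocallyFiniteMeasure μ] (hA : AODg m μ) {x : X} (hx : x ∈ Sp μ) (U : Ultrafilter α)
    {t : α → ℝ} (ht : ∀ i, 0 < t i) (ht0 : Tendsto t U (𝓝 0))
    (hG : ∀ R : ℝ, 2 < R → ∀ᶠ i in U, Good m (eps0 m) (shf μ x) (R * t i)) :
    ∃ W : Submodule ℝ X, finrank ℝ W = m ∧ Tl U t (shf μ x) = W := by
  obtain ⟨ν, h1, h2, -, h4⟩ := blow_limit hA hx U ht ht0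
  have e : Sp ν = Tl U t (shf μ x) := by
    ext z; exact h4 z
  have := theoremU h1 h2 (fun R₀ => ⟨max R₀ 2 + 1, by have := le_max_left R₀ 2; linarith, by
    rw [e]
    have h3 := le_max_right R₀ 2
    exact good_lim ht (by linarith) (hG _ (by linarith))⟩)
  rwa [e] at this

lemma all_good [IsLocallyFiniteMeasure μ] (hA : AODg m μ) {x : X} (hx : x ∈ Sp μ) (U : Ultrafilter α)
    {r : α → ℝ} (hr : ∀ i, 0 < r i) (hr0 : Tendsto r U (𝓝 0)) {W : Submodule ℝ X} (hW : finrank ℝ W = m)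
    (hT : Tl U r (shf μ x) = W) :
    ∃ t₀ : ℝ, 0 < t₀ ∧ ∀ t, 0 < t → t ≤ t₀ → Good m (eps0 m) (shf μ x) t := by
  by_contra hcon
  push Not at hcon
  have key : ∀ i, ∃ t, 0 < t ∧ t ≤ r i ∧ ¬ Good m (eps0 m) (shf μ x) t ∧
      ∀ s, 2 * t < s → s ≤ r i → Good m (eps0 m) (shf μ x) s := by
    intro i
    let B := {t : ℝ | 0 < t ∧ t ≤ r i ∧ ¬ Good m (eps0 m) (shf μ x) t}
    obtain ⟨t', a1, a2, a3⟩ := hcon (r i) (hr i)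
    have hne : B.Nonempty := ⟨t', a1, a2, a3⟩
    have hbd : BddAbove B := ⟨r i, fun t ht => ht.2.1⟩
    have hpos : 0 < sSup B := a1.trans_le (le_csSup hbd ⟨a1, a2, a3⟩)
    obtain ⟨t, htB, ht⟩ := exists_lt_of_lt_csSup hne (half_lt_self hpos)
    refine ⟨t, htB.1, htB.2.1, htB.2.2, fun s hs hsr => ?_⟩
    by_contra hb
    have : s ≤ sSup B := le_csSup hbd ⟨by linarith [htB.1], hsr, hb⟩
    linarith
  choose t h1 h2 h3 h4 using key
  have ht0 : Tendsto t U (𝓝 0) := squeeze_zero (fun i => (h1 i).le) h2 hr0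
  have small : ∀ δ : ℝ, 0 < δ → ∀ᶠ i in U, t i < δ * r i := by
    intro δ hδ
    filter_upwards [good_of_plane hr hW hT (eps0_pos m) (M := 1) hδ] with i hi
    by_contra hb
    push Not at hb
    have hri := hr i
    have := hi (t i / r i) (by rwa [le_div_iff₀ hri]) (by rw [div_le_one hri]; exact h2 i)
    rw [div_mul_cancel₀ _ hri.ne'] at this
    exact h3 i this
  obtain ⟨W', hW', hT'⟩ := plane_of_good hA hx U h1 ht0 (by
    intro R hR
    filter_upwards [small R⁻¹ (by positivity)] with i hi
    have hti := h1 i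
    refine h4 i _ (by nlinarith) ?_
    rw [← div_eq_inv_mul, lt_div_iff₀ (by linarith)] at hi
    linarith)
  obtain ⟨i, hi⟩ := (good_of_plane h1 hW' hT' (eps0_pos m) (M := 1) one_pos).exists
  have := hi 1 le_rfl le_rfl
  rw [one_mul] at this
  exact h3 i this

lemma all_planes [IsLocallyFiniteMeasure μ] (hA : AODg m μ) {x : X} (hx : x ∈ Sp μ)
    (hg : ∃ t₀ : ℝ, 0 < t₀ ∧ ∀ t, 0 < t → t ≤ t₀ → Good m (eps0 m) (shf μ x) t)
    (U : Ultrafilter α) {t : α → ℝ} (ht : ∀ i, 0 < t i) (ht0 : Tendsto t U (𝓝 0)) :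
    ∃ W : Submodule ℝ X, finrank ℝ W = m ∧ Tl U t (shf μ x) = W := by
  obtain ⟨t₀, h0, h⟩ := hg
  refine plane_of_good hA hx U ht ht0 fun R hR => ?_
  have := ht0.const_mul R
  rw [mul_zero] at this
  filter_upwards [this.eventually (Iio_mem_nhds h0)] with i hi
  exact h _ (by have := ht i; positivity) (le_of_lt hi)

/-- the flat measure has support equal to the plane -/
lemma flat_Sp {L : AffineSubspace ℝ X} (hne : (L : Set X).Nonempty) (hL : finrank ℝ L.direction = m) :
    IsLocallyFiniteMeasure ((Measure.hausdorffMeasure (m : ℝ)).restrict (L : Set X) : Measure X) ∧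
    Sp ((Measure.hausdorffMeasure (m : ℝ)).restrict (L : Set X) : Measure X) = L := by
  obtain ⟨p, hp⟩ := hne
  let f : L.direction → X := fun v => p + (v : X)
  have hf : Isometry f := Isometry.of_dist_eq fun a b => by simp [f, dist_eq_norm]
  have hrange : range f = (L : Set X) := by
    ext y
    constructor
    · rintro ⟨v, rfl⟩
      have := AffineSubspace.vadd_mem_of_mem_direction v.2 hp
      simpa [f, add_comm] using this
    · intro hy
      exact ⟨⟨y - p, by simpa using AffineSubspace.vsub_mem_direction hy hp⟩, by simp [f]⟩
  have hmap : Measure.map f (Measure.hausdorffMeasure (m : ℝ)) =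
      (Measure.hausdorffMeasure (m : ℝ)).restrict (L : Set X) := by
    rw [hf.map_hausdorffMeasure (Or.inl (by positivity)), hrange]
  have hH : (Measure.hausdorffMeasure (m : ℝ) : Measure L.direction).IsAddHaarMeasure := by
    rw [← hL]; infer_instance
  have hLc : IsClosed (L : Set X) := L.closed_of_finiteDimensional
  have hball : ∀ z r, ((Measure.hausdorffMeasure (m : ℝ)).restrict (L : Set X) : Measure X) (closedBall z r)
      = (Measure.hausdorffMeasure (m : ℝ) : Measure L.direction) (f ⁻¹' closedBall z r) := by
    intro z r
    rw [← hmap, Measure.map_apply hf.continuous.measurable isClosed_closedBall.measurableSet]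
  constructor
  · refine ⟨fun z => ⟨closedBall z 1, closedBall_mem_nhds z one_pos, ?_⟩⟩
    rw [hball]
    refine lt_of_le_of_lt (measure_mono ?_) (measure_closedBall_lt_top (x := (0 : L.direction)) (r := 1 + ‖z‖ + ‖p‖))
    intro v hv
    rw [mem_preimage, mem_closedBall, dist_eq_norm] at hv
    rw [mem_closedBall_zero_iff]
    change ‖(v : X)‖ ≤ _
    calc ‖(v : X)‖ = ‖(p + (v:X) - z) + z - p‖ := by congr 1; abel
      _ ≤ ‖(p + (v:X) - z) + z‖ + ‖p‖ := norm_sub_le _ _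
      _ ≤ _ := by have := norm_add_le (p + (v:X) - z) z; linarith [show ‖p + (v:X) - z‖ ≤ 1 from hv]
  · ext z
    constructor
    · intro hz
      by_contra hzL
      obtain ⟨r, hr, hrs⟩ := Metric.isOpen_iff.1 hLc.isOpen_compl z hzL
      have := hz (r/2) (by positivity)
      rw [Measure.restrict_apply isClosed_closedBall.measurableSet] at this
      have he : closedBall z (r/2) ∩ (L : Set X) = ∅ := by
        rw [← disjoint_iff_inter_eq_empty, ← subset_compl_iff_disjoint_right]
        exact (closedBall_subset_ball (by linarith)).trans hrs
      rw [he] at this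
      simp at this
    · intro hz r hr
      rw [← hrange] at hz
      obtain ⟨v, rfl⟩ := hz
      rw [hball, hf.preimage_closedBall]
      exact measure_closedBall_pos _ _ hr

lemma Sp_iff_bump {ρ : Measure X} [IsLocallyFiniteMeasure ρ] (z : X) :
    z ∈ Sp ρ ↔ ∀ r : ℝ, 0 < r → 0 < ∫ y, bump z r (2 * r) y ∂ρ := by
  constructor
  · intro hz r hr
    exact lt_of_lt_of_le (mb_pos hz hr) (bump_lower ρ z (by linarith))
  · intro h r hr
    by_contra hb
    have h0 : ρ (closedBall z r) = 0 := by simpa using hb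
    have := h (r/2) (by positivity)
    rw [show 2 * (r/2) = r by ring] at this
    have h1 : ∫ y, bump z (r/2) r y ∂ρ = 0 := by
      refine integral_eq_zero_of_ae ?_
      have : ∀ᵐ y ∂ρ, y ∉ closedBall z r := measure_eq_zero_iff_ae_notMem.1 h0
      filter_upwards [this] with y hy
      exact bump_zero (by linarith) hy
    linarith

lemma tangent_plane [IsLocallyFiniteMeasure μ] (hA : AODg m μ) {x : X} (hx : x ∈ Sp μ) (U : Ultrafilter α)
    {r c : α → ℝ} (hr : ∀ i, 0 < r i) (hr0 : Tendsto r U (𝓝 0)) (hc : ∀ i, 0 < c i) {ν : Measure X}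
    (hlim : ∀ f : X → ℝ, Continuous f → HasCompactSupport f →
      Tendsto (fun i => ∫ y, f y ∂(blow μ x (r i) (c i))) U (𝓝 (∫ y, f y ∂ν)))
    {L : AffineSubspace ℝ X} (hne : (L : Set X).Nonempty) (hL : finrank ℝ L.direction = m)
    (hν : ν = (Measure.hausdorffMeasure (m : ℝ)).restrict (L : Set X)) :
    ∃ W : Submodule ℝ X, finrank ℝ W = m ∧ Tl U r (shf μ x) = W := by
  obtain ⟨ν', h1, h2, h3, h4⟩ := blow_limit hA hx U hr hr0
  have e : Sp ν' = Tl U r (shf μ x) := by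
    ext z; exact h4 z
  haveI : IsLocallyFiniteMeasure ν' := h1.locfin h2
  obtain ⟨hlf, hSp⟩ := flat_Sp hne hL
  rw [← hν] at hlf hSp
  let a : α → ℝ := fun i => c i * mb μ x (r i)
  have ha : ∀ (i) (f : X → ℝ), ∫ y, f y ∂(blow μ x (r i) (c i)) = a i * ∫ y, f y ∂(blow μ x (r i) (mb μ x (r i))⁻¹) := by
    intro i f
    have hp := mb_pos hx (hr i)
    unfold blow
    rw [integral_smul_measure, integral_smul_measure, ENNReal.toReal_ofReal (hc i).le, ENNReal.toReal_ofReal (inv_pos.2 hp).le,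
      smul_eq_mul, smul_eq_mul]
    simp only [a]
    rw [← mul_assoc, mul_assoc (c i), mul_inv_cancel₀ hp.ne', mul_one]
  have ha0 : ∀ i, 0 < a i := fun i => mul_pos (hc i) (mb_pos hx (hr i))
  have hp := (Sp_iff_bump (ρ := ν') 0).1 h2 1 one_pos
  have hfc := bump_cont (0:X) 1 (2 * 1)
  have hfs := bump_cs (z := (0:X)) (show (1:ℝ) < 2 * 1 by norm_num)
  obtain ⟨b, hb⟩ : ∃ b, Tendsto a U (𝓝 b) := by
    refine ⟨_, ((hlim _ hfc hfs).div (h3 _ hfc hfs) hp.ne').congr' ?_⟩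
    filter_upwards [(h3 _ hfc hfs).eventually (Ioi_mem_nhds hp)] with i hi
    simp only [Pi.div_apply]
    rw [ha, mul_div_cancel_right₀ _ (ne_of_gt hi)]
  have hb0 : 0 ≤ b := ge_of_tendsto hb (Eventually.of_forall fun i => (ha0 i).le)
  have hint : ∀ f : X → ℝ, Continuous f → HasCompactSupport f → ∫ y, f y ∂ν = b * ∫ y, f y ∂ν' := by
    intro f hf hf2
    refine tendsto_nhds_unique (hlim f hf hf2) ?_
    simp only [ha]
    exact hb.mul (h3 f hf hf2)
  have hb1 : 0 < b := by
    refine lt_of_le_of_ne hb0 fun h => ?_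
    obtain ⟨p, hp⟩ := hne
    rw [← hSp] at hp
    have := (Sp_iff_bump p).1 hp 1 one_pos
    rw [hint _ (bump_cont _ _ _) (bump_cs (by norm_num)), ← h, zero_mul] at this
    exact lt_irrefl _ this
  have heq : Sp ν' = L := by
    rw [← hSp]
    ext z
    rw [Sp_iff_bump, Sp_iff_bump]
    refine forall₂_congr fun r hr => ?_
    rw [hint _ (bump_cont _ _ _) (bump_cs (by linarith)), mul_pos_iff_of_pos_left hb1]
  have h0L : (0:X) ∈ L := by
    rw [heq] at h2; exact h2
  refine ⟨L.direction, hL, ?_⟩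
  rw [← e, heq]
  ext y
  have := AffineSubspace.vsub_right_mem_direction_iff_mem h0L y
  simp only [vsub_eq_sub, sub_zero] at this
  exact this.symm

end mainA
end FT

namespace FT

lemma setD_le {n : ℕ} {A B : Set (E n)} {c : ℝ} (hc : 0 ≤ c) (h : ∀ a ∈ A, ∃ b ∈ B, dist a b ≤ c) :
    setD A B ≤ c := by
  unfold setD
  refine Real.iSup_le (fun a => Real.iSup_le (fun ha => ?_) hc) hc
  obtain ⟨b, hb, hab⟩ := h a ha
  exact (infDist_le_dist_of_mem hb).trans hab

lemma setD_nonneg {n : ℕ} (A B : Set (E n)) : 0 ≤ setD A B := by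
  unfold setD
  exact Real.iSup_nonneg fun a => Real.iSup_nonneg fun _ => infDist_nonneg

lemma Dxr_nonneg {n : ℕ} (x : E n) {r : ℝ} (hr : 0 < r) (A B : Set (E n)) : 0 ≤ Dxr x r A B := by
  unfold Dxr dxr
  exact le_max_of_le_left (mul_nonneg (by positivity) (setD_nonneg _ _))

lemma theta_nonneg {n m : ℕ} (S : Set (E n)) (x : E n) {r : ℝ} (hr : 0 < r) : 0 ≤ thetaP m S x r := by
  unfold thetaP
  exact Real.iInf_nonneg fun L => Dxr_nonneg x hr _ _

lemma theta_le {n m : ℕ} {S : Set (E n)} {x : E n} {t ε : ℝ} (ht : 0 < t) (hε : 0 < ε) (hε1 : ε ≤ 1)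
    {W : Submodule ℝ (E n)} (hW : finrank ℝ W = m)
    (hin : ∀ w ∈ W, ‖w‖ ≤ 1 → ∃ z', x + t • z' ∈ S ∧ ‖z' - w‖ ≤ ε)
    (hout : ∀ z', x + t • z' ∈ S → ‖z'‖ ≤ 1 → ∃ z ∈ W, ‖z' - z‖ ≤ ε) :
    thetaP m S x t ≤ 2 * ε := by
  unfold thetaP
  have hbd : BddBelow (range fun L : {L : AffineSubspace ℝ (E n) // x ∈ L ∧ Module.finrank ℝ L.direction = m} =>
      Dxr x t S (L.1 : Set (E n))) := ⟨0, by rintro _ ⟨L, rfl⟩; exact Dxr_nonneg x ht _ _⟩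
  refine (ciInf_le hbd ⟨AffineSubspace.mk' x W, AffineSubspace.self_mem_mk' x W, by
    rw [AffineSubspace.direction_mk', hW]⟩).trans ?_
  have hmem : ∀ w ∈ W, x + t • w ∈ AffineSubspace.mk' x W := by
    intro w hw
    rw [AffineSubspace.mem_mk']
    simpa using W.smul_mem t hw
  have hb : ∀ w : E n, ‖w‖ ≤ 1 → x + t • w ∈ closedBall x t := by
    intro w hw
    rw [mem_closedBall, dist_eq_norm, add_sub_cancel_left, norm_smul, Real.norm_of_nonneg ht.le]
    nlinarith
  have hrep : ∀ a ∈ closedBall x t, a = x + t • (t⁻¹ • (a - x)) ∧ ‖t⁻¹ • (a - x)‖ ≤ 1 := by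
    intro a ha
    rw [smul_inv_smul₀ ht.ne', norm_smul, norm_inv, Real.norm_of_nonneg ht.le, inv_mul_le_iff₀ ht, mul_one,
      ← dist_eq_norm]
    exact ⟨by abel, ha⟩
  have hdist : ∀ u v : E n, dist (x + t • u) (x + t • v) = t * ‖u - v‖ := by
    intro u v
    rw [dist_add_left, dist_eq_norm, ← smul_sub, norm_smul, Real.norm_of_nonneg ht.le]
  unfold Dxr dxr
  refine max_le ?_ ?_
  · rw [one_div, inv_mul_le_iff₀ ht]
    refine setD_le (by positivity) fun a ha => ?_
    obtain ⟨ea, na⟩ := hrep a ha.2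
    set z' := t⁻¹ • (a - x) with hz'
    obtain ⟨z, hz, hzz⟩ := hout z' (ea ▸ ha.1) na
    refine ⟨x + t • W.starProjection z', ⟨hmem _ (Submodule.starProjection_apply_mem W z'),
      hb _ ((Submodule.norm_starProjection_apply_le W z').trans na)⟩, ?_⟩
    rw [ea, hdist]
    have : ‖z' - W.starProjection z'‖ ≤ ‖z' - z‖ := by
      rw [Submodule.starProjection_minimal]
      exact ciInf_le ⟨0, by rintro _ ⟨y, rfl⟩; exact norm_nonneg _⟩ (⟨z, hz⟩ : W)
    gcongr
    linarith
  · rw [one_div, inv_mul_le_iff₀ ht]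
    refine setD_le (by positivity) fun a ha => ?_
    obtain ⟨ea, na⟩ := hrep a ha.2
    have haL : a ∈ AffineSubspace.mk' x W := ha.1
    rw [AffineSubspace.mem_mk'] at haL
    have hw : t⁻¹ • (a - x) ∈ W := W.smul_mem _ haL
    set w := t⁻¹ • (a - x) with hw'
    have hnw : ‖(1 - ε) • w‖ ≤ 1 - ε := by
      rw [norm_smul, Real.norm_of_nonneg (by linarith)]
      nlinarith
    obtain ⟨z', h1, h2⟩ := hin ((1 - ε) • w) (W.smul_mem _ hw) (by linarith)
    have n1 : ‖z'‖ ≤ 1 := by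
      calc ‖z'‖ = ‖(z' - (1 - ε) • w) + (1 - ε) • w‖ := by rw [sub_add_cancel]
        _ ≤ _ := norm_add_le _ _
        _ ≤ 1 := by linarith
    refine ⟨x + t • z', ⟨h1, hb _ n1⟩, ?_⟩
    rw [ea, hdist, norm_sub_rev]
    have : ‖z' - w‖ ≤ 2 * ε := by
      calc ‖z' - w‖ = ‖(z' - (1 - ε) • w) + (-ε) • w‖ := by congr 1; module
        _ ≤ _ := norm_add_le _ _
        _ ≤ ε + ε * 1 := by
          rw [norm_smul, norm_neg, Real.norm_of_nonneg hε.le]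
          gcongr
        _ = 2 * ε := by ring
    gcongr

end FT

/-- Corollary 3.5 / `strongconnectedness`: for an `m`-asymptotically
optimally doubling measure, if one tangent measure at `x` is `m`-flat then `x` is a flat
point of the support. -/
theorem flat_tangent_measure_implies_flat_point {n m : ℕ} (μ : Measure (E n))
    (hRadon : IsLocallyFiniteMeasure μ) (hAOD : AOD m μ) (x : E n) (hx : x ∈ msupp μ)
    (ν : Measure (E n)) (hν : IsTangentMeasure μ ν x) (hflat : IsFlatMeasure m ν) :
    Tendsto (fun r : ℝ => thetaP m (msupp μ) x r) (nhdsWithin 0 (Set.Ioi 0)) (nhds 0) := by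
  have hA : FT.AODg m μ := hAOD
  have hx' : x ∈ FT.Sp μ := hx
  obtain ⟨-, r, c, hr, hr0, hc, hlim⟩ := hν
  obtain ⟨L, hne, hL, hνL⟩ := hflat
  let U : Ultrafilter ℕ := hyperfilter ℕ
  have hU : (U : Filter ℕ) ≤ atTop := Nat.hyperfilter_le_atTop
  obtain ⟨W, hW, hT⟩ := FT.tangent_plane hA hx' U hr (hr0.mono_left hU) hc
    (fun f hf hf2 => (hlim f hf hf2).mono_left hU) hne hL hνL
  have hg := FT.all_good hA hx' U hr (hr0.mono_left hU) hW hT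
  rw [Metric.tendsto_nhds]
  intro ε hε
  by_contra hcon
  have hfreq : ∃ᶠ t in nhdsWithin (0:ℝ) (Set.Ioi 0), ε ≤ thetaP m (msupp μ) x t := by
    have h1 := (not_eventually.1 hcon).and_eventually self_mem_nhdsWithin
    refine h1.mono fun t ⟨h2, h3⟩ => ?_
    rw [Real.dist_eq, sub_zero, abs_of_nonneg (FT.theta_nonneg _ _ h3), not_lt] at h2
    exact h2
  have key : ∀ i : ℕ, ∃ t : ℝ, 0 < t ∧ t < 1 / ((i : ℝ) + 1) ∧ ε ≤ thetaP m (msupp μ) x t := by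
    intro i
    have h1 : ∀ᶠ t in nhdsWithin (0:ℝ) (Set.Ioi 0), t < 1 / ((i : ℝ) + 1) :=
      mem_nhdsWithin_of_mem_nhds (Iio_mem_nhds (by positivity))
    obtain ⟨t, h2, h3, h4⟩ := (hfreq.and_eventually (h1.and self_mem_nhdsWithin)).exists
    exact ⟨t, h4, h3, h2⟩
  choose t h1 h2 h3 using key
  have ht0 : Tendsto t U (𝓝 0) :=
    (squeeze_zero (fun i => (h1 i).le) (fun i => (h2 i).le) tendsto_one_div_add_atTop_nhds_zero_nat).mono_left hU
  obtain ⟨V, hV, hTV⟩ := FT.all_planes hA hx' hg U h1 ht0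
  let η := min 1 (ε / 4)
  have hη : 0 < η := lt_min one_pos (by positivity)
  have hK : IsCompact ((V : Set (E n)) ∩ closedBall 0 1) :=
    (isCompact_closedBall 0 1).inter_left V.closed_of_finiteDimensional
  obtain ⟨i, hi1, hi2⟩ := ((FT.Tl_unif_in (S := FT.shf μ x) (t := t) (U := U) hK
    (by rw [hTV]; exact inter_subset_left) hη).and
    (FT.Tl_unif_out (S := FT.shf μ x) (t := t) (U := U) 1 hη)).exists
  have := FT.theta_le (S := msupp μ) (x := x) (h1 i) hη (min_le_left _ _) hV
    (fun w hw hw1 => hi1 w ⟨hw, by simpa using hw1⟩)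
    (fun z' hz hz1 => by
      obtain ⟨z, hzT, hzz⟩ := hi2 z' hz hz1
      rw [hTV] at hzT
      exact ⟨z, hzT, hzz⟩)
  have h4 : η ≤ ε / 4 := min_le_right _ _
  linarith [h3 i]
end
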